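/- arXiv:2009.00423 — 2 statements merged into one kernel-verified Lean document; each statement's English description precedes it below -/
import Mathlib

section
/- For every even integer k ≥ 6, there exist infinitely many pairwise non-isomorphic 3-connected cubic planar graphs G such that G has circumference at least k and the cycle spectrum of G contains no element of the interval [k, 2k+2], i.e., G has no cycle whose length ℓ satisfies k ≤ ℓ ≤ 2k+2. -/
open SimpleGraph

/-- The cycle spectrum of a graph: the set of lengths of its cycles. -/
def CycleLengths {V : Type*} (G : SimpleGraph V) : Set ℕ :=
  {n | ∃ (v : V) (w : G.Walk v v), w.IsCycle ∧ w.length = n}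

/-- `G` has circumference at least `k`: some cycle has length at least `k`. -/
def CircumferenceAtLeast {V : Type*} (G : SimpleGraph V) (k : ℕ) : Prop :=
  ∃ n ∈ CycleLengths G, k ≤ n

/-- A graph is cubic if every vertex has exactly three neighbours. -/
def IsCubic {V : Type*} (G : SimpleGraph V) : Prop :=
  ∀ v : V, (G.neighborSet v).ncard = 3

/-- A graph is 3-connected if it has more than 3 vertices and deleting any set of
fewer than 3 vertices leaves it connected. -/
def IsThreeConnected {V : Type*} (G : SimpleGraph V) : Prop :=
  3 < (Set.univ : Set V).ncard ∧
    ∀ s : Set V, s.Finite → s.ncard < 3 → (G.induce (sᶜ : Set V)).Connected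

/-- Reversal of darts, as a permutation. -/
def dartReversal {V : Type*} (G : SimpleGraph V) : Equiv.Perm G.Dart :=
  Function.Involutive.toPerm SimpleGraph.Dart.symm Dart.symm_involutive

/-- A combinatorial embedding of `G` on an orientable surface, given by a rotation
system: a permutation of the darts preserving tails, acting transitively on the
darts at each vertex. -/
structure PlaneEmbedding {V : Type*} (G : SimpleGraph V) where
  rot : Equiv.Perm G.Dart
  rot_tail : ∀ d : G.Dart, (rot d).toProd.1 = d.toProd.1
  rot_orbit : ∀ d e : G.Dart, d.toProd.1 = e.toProd.1 → ∃ n : ℕ, (rot ^ n) d = e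

namespace PlaneEmbedding

variable {V : Type*} {G : SimpleGraph V}

/-- The face permutation of a combinatorial embedding. -/
def facePerm (E : PlaneEmbedding G) : Equiv.Perm G.Dart :=
  (dartReversal G).trans E.rot

/-- The face (orbit of the face permutation) containing a given dart. -/
def faceOf (E : PlaneEmbedding G) (d : G.Dart) : Set G.Dart :=
  {e | ∃ n : ℤ, (E.facePerm ^ n) d = e}

/-- The set of faces of a combinatorial embedding. -/
def faces (E : PlaneEmbedding G) : Set (Set G.Dart) :=
  {s | ∃ d : G.Dart, s = E.faceOf d}

/-- A combinatorial embedding is spherical (planar) when Euler's formula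
`|V| + |F| = |E| + 2` holds. -/
def IsSpherical (E : PlaneEmbedding G) : Prop :=
  (Set.univ : Set V).ncard + E.faces.ncard = G.edgeSet.ncard + 2

end PlaneEmbedding

/-- A graph is planar if it is connected and admits a spherical combinatorial
embedding (Heffter–Edmonds). -/
def IsPlanar {V : Type*} (G : SimpleGraph V) : Prop :=
  G.Connected ∧ ∃ E : PlaneEmbedding G, E.IsSpherical

/-- A cubic graph with a rotation at every vertex: the darts at `v` are `(v, 0)`, `(v, 1)`,
`(v, 2)` in cyclic order, and `opp` sends a dart to the reverse dart. -/
structure CubicMap (V : Type) where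
  opp : V × Fin 3 → V × Fin 3
  opp_opp : ∀ x, opp (opp x) = x
  loopless : ∀ x, (opp x).1 ≠ x.1
  simple : ∀ v i j, (opp (v, i)).1 = (opp (v, j)).1 → i = j

namespace CubicMap

variable {V : Type} (M : CubicMap V)

/-- The dart following `x` on its face. -/
def face (x : V × Fin 3) : V × Fin 3 := ((M.opp x).1, (M.opp x).2 + 1)

/-- After deleting any `p` and `q`, every property that is invariant along the remaining edges
holds for all or for none of the remaining vertices. -/
def ThreeConnected : Prop :=
  ∀ p q : V, ∀ f : V → Prop,
    (∀ v i, v ≠ p → v ≠ q → (M.opp (v, i)).1 ≠ p → (M.opp (v, i)).1 ≠ q →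
      (f v ↔ f (M.opp (v, i)).1)) →
    ∀ v w, v ≠ p → v ≠ q → w ≠ p → w ≠ q → (f v ↔ f w)

/-- The map is spherical: its faces can be labelled by a type with `|V| / 2 + 2` elements. -/
def Spherical [Fintype V] : Prop :=
  ∃ (F : Type) (_ : Fintype F) (lab : V × Fin 3 → F),
    Function.Surjective lab ∧ (∀ x, lab (M.face x) = lab x) ∧
    (∀ x y, lab x = lab y → Relation.EqvGen (fun a b => M.face a = b) x y) ∧
    2 * Fintype.card F = Fintype.card V + 4

/-- A set of darts that is closed under reversal and has even degree at every vertex. -/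
def IsEvenSet (S : V × Fin 3 → Bool) : Prop :=
  (∀ x, S (M.opp x) = S x) ∧ ∀ v, (S (v, 0) ^^ (S (v, 1) ^^ S (v, 2))) = false

/-- Every even set of edges that leaves some class of the partition `cls` has weight at least `L`,
where the weight of an edge is the sum of the weights `d` of its two darts. -/
def Heavy [Fintype V] {P : Type} (cls : V → P) (d : V × Fin 3 → ℕ) (L : ℕ) : Prop :=
  ∀ S, M.IsEvenSet S → (∃ x, S x = true ∧ cls (M.opp x).1 ≠ cls x.1) →
    L ≤ ∑ v, ∑ i, if S (v, i) then d (v, i) else 0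

/-- The underlying simple graph, with vertices relabelled along `e`. -/
def graph {U : Type} (e : U ≃ V) : SimpleGraph U where
  Adj u v := ∃ i, (M.opp (e u, i)).1 = e v
  symm := ⟨by
    rintro u v ⟨i, hi⟩
    refine ⟨(M.opp (e u, i)).2, ?_⟩
    rw [← hi, Prod.mk.eta, M.opp_opp]⟩
  loopless := ⟨by
    rintro u ⟨i, hi⟩
    exact M.loopless _ hi⟩

section graph

variable {U : Type} (e : U ≃ V)

/-- The darts of the underlying graph. -/
def toDart (x : V × Fin 3) : (M.graph e).Dart :=
  ⟨(e.symm x.1, e.symm (M.opp x).1), x.2, by simp⟩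

theorem toDart_bijective : Function.Bijective (M.toDart e) := by
  constructor
  · rintro ⟨v, i⟩ ⟨w, j⟩ h
    have h' := congrArg SimpleGraph.Dart.toProd h
    simp only [toDart, Prod.mk.injEq, EmbeddingLike.apply_eq_iff_eq] at h'
    obtain ⟨rfl, h2⟩ := h'
    rw [M.simple v i j h2]
  · rintro ⟨⟨u, v⟩, i, hi⟩
    refine ⟨(e u, i), ?_⟩
    ext <;> simp [toDart, hi]

/-- The darts of the underlying graph, as an equivalence. -/
noncomputable def dartEquiv : V × Fin 3 ≃ (M.graph e).Dart :=
  Equiv.ofBijective _ (M.toDart_bijective e)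

theorem dartEquiv_fst (x : V × Fin 3) : (M.dartEquiv e x).toProd.1 = e.symm x.1 := rfl

theorem dartEquiv_opp (x : V × Fin 3) : M.dartEquiv e (M.opp x) = (M.dartEquiv e x).symm := by
  ext
  · rfl
  · change e.symm (M.opp (M.opp x)).1 = e.symm x.1
    rw [M.opp_opp]

/-- Rotation about the tail of a dart. -/
def rotate (V : Type) : Equiv.Perm (V × Fin 3) :=
  Equiv.prodCongr (Equiv.refl V) (Equiv.addRight 1)

theorem rotate_pow (n : ℕ) (x : V × Fin 3) : (rotate V ^ n) x = (x.1, x.2 + n • 1) := by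
  induction n with
  | zero => simp
  | succ n ih =>
    rw [pow_succ', Equiv.Perm.mul_apply, ih]
    simp [rotate, add_assoc, succ_nsmul]

/-- The rotation system of the underlying graph. -/
noncomputable def embedding : PlaneEmbedding (M.graph e) where
  rot := (M.dartEquiv e).permCongr (rotate V)
  rot_tail d := by
    obtain ⟨x, rfl⟩ := (M.dartEquiv e).surjective d
    simp [Equiv.permCongr_apply, dartEquiv_fst, rotate]
  rot_orbit d d' h := by
    obtain ⟨x, rfl⟩ := (M.dartEquiv e).surjective d
    obtain ⟨y, rfl⟩ := (M.dartEquiv e).surjective d'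
    simp only [dartEquiv_fst, EmbeddingLike.apply_eq_iff_eq] at h
    refine ⟨(y.2 - x.2 : Fin 3).val, ?_⟩
    have hp : ∀ n : ℕ, ((M.dartEquiv e).permCongr (rotate V)) ^ n =
        (M.dartEquiv e).permCongr (rotate V ^ n) := by
      intro n
      exact (map_pow (M.dartEquiv e).permCongrHom (rotate V) n).symm
    rw [hp, Equiv.permCongr_apply, Equiv.symm_apply_apply, rotate_pow]
    congr 1
    ext1
    · exact h
    · exact (by decide : ∀ i j : Fin 3, i + (j - i).val • 1 = j) _ _

theorem embedding_facePerm (x : V × Fin 3) :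
    (M.embedding e).facePerm (M.dartEquiv e x) = M.dartEquiv e (M.face x) := by
  have h : dartReversal (M.graph e) (M.dartEquiv e x) = M.dartEquiv e (M.opp x) :=
    (M.dartEquiv_opp e x).symm
  simp only [PlaneEmbedding.facePerm, Equiv.trans_apply, h]
  simp [embedding, Equiv.permCongr_apply, face, rotate, Prod.map]

theorem self_mem_faceOf {G : SimpleGraph U} (E : PlaneEmbedding G) (d : G.Dart) :
    d ∈ E.faceOf d := ⟨0, rfl⟩

theorem faceOf_eq_of_eqvGen {x y : V × Fin 3}
    (h : Relation.EqvGen (fun a b => M.face a = b) x y) :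
    (M.embedding e).faceOf (M.dartEquiv e x) = (M.embedding e).faceOf (M.dartEquiv e y) := by
  induction h with
  | rel a b h =>
    subst h
    rw [← embedding_facePerm]
    ext d
    constructor
    · rintro ⟨n, hn⟩
      refine ⟨n - 1, ?_⟩
      rw [← Equiv.Perm.mul_apply, ← zpow_add_one, sub_add_cancel, hn]
    · rintro ⟨n, hn⟩
      refine ⟨n + 1, ?_⟩
      rw [zpow_add_one, Equiv.Perm.mul_apply, hn]
  | refl a => rfl
  | symm a b _ ih => exact ih.symm
  | trans a b c _ _ ih1 ih2 => exact ih1.trans ih2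

theorem lab_eq_of_mem_faceOf {F : Type} (lab : V × Fin 3 → F)
    (hlab : ∀ x, lab (M.face x) = lab x) {x y : V × Fin 3}
    (h : M.dartEquiv e y ∈ (M.embedding e).faceOf (M.dartEquiv e x)) : lab y = lab x := by
  obtain ⟨n, hn⟩ := h
  have key : ∀ d, lab ((M.dartEquiv e).symm ((M.embedding e).facePerm d)) =
      lab ((M.dartEquiv e).symm d) := by
    intro d
    obtain ⟨z, rfl⟩ := (M.dartEquiv e).surjective d
    rw [embedding_facePerm]
    simp [hlab]
  have key2 : ∀ (n : ℤ) d, lab ((M.dartEquiv e).symm (((M.embedding e).facePerm ^ n) d)) =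
      lab ((M.dartEquiv e).symm d) := by
    intro n
    induction n with
    | zero => intro d; rfl
    | succ n ih => intro d; rw [zpow_add_one, Equiv.Perm.mul_apply, ih, key]
    | pred n ih =>
      intro d
      rw [zpow_sub_one, Equiv.Perm.mul_apply, ih, ← key]
      exact congrArg _ (congrArg _ (Equiv.apply_symm_apply _ d))
  have := key2 n (M.dartEquiv e x)
  rw [hn] at this
  simpa using this

theorem two_mul_ncard_edgeSet [Fintype V] :
    2 * (M.graph e).edgeSet.ncard = 3 * Fintype.card V := by
  classical
  have : Fintype U := Fintype.ofEquiv V e.symm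
  have h1 := (M.graph e).dart_card_eq_twice_card_edges
  rw [← Fintype.card_congr (M.dartEquiv e)] at h1
  rw [← SimpleGraph.coe_edgeFinset, Set.ncard_coe_finset, ← h1]
  simp [mul_comm]

theorem isSpherical_embedding [Fintype V] (h : M.Spherical) : (M.embedding e).IsSpherical := by
  obtain ⟨F, _, lab, hsurj, hinv, heqv, hcard⟩ := h
  have hfaces : (M.embedding e).faces.ncard = Fintype.card F := by
    choose r hr using hsurj
    have hrange : (M.embedding e).faces =
        Set.range (fun a => (M.embedding e).faceOf (M.dartEquiv e (r a))) := by
      ext s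
      constructor
      · rintro ⟨d, rfl⟩
        obtain ⟨x, rfl⟩ := (M.dartEquiv e).surjective d
        exact ⟨lab x, M.faceOf_eq_of_eqvGen e (heqv _ _ (hr _))⟩
      · rintro ⟨a, rfl⟩
        exact ⟨_, rfl⟩
    have hinj : Function.Injective
        (fun a => (M.embedding e).faceOf (M.dartEquiv e (r a))) := by
      intro a b hab
      have hmem : M.dartEquiv e (r a) ∈ (M.embedding e).faceOf (M.dartEquiv e (r b)) := by
        have := self_mem_faceOf (M.embedding e) (M.dartEquiv e (r a))
        exact (congrArg (M.dartEquiv e (r a) ∈ ·) hab).mp this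
      have := M.lab_eq_of_mem_faceOf e lab hinv hmem
      rwa [hr, hr] at this
    rw [hrange, ← Set.image_univ, Set.ncard_image_of_injective _ hinj, Set.ncard_univ,
      Nat.card_eq_fintype_card]
  have hV : (Set.univ : Set U).ncard = Fintype.card V := by
    rw [Set.ncard_univ, Nat.card_congr e, Nat.card_eq_fintype_card]
  have hE := M.two_mul_ncard_edgeSet e
  unfold PlaneEmbedding.IsSpherical
  omega

theorem isCubic_graph : IsCubic (M.graph e) := by
  intro u
  have : (M.graph e).neighborSet u = Set.range (fun i => e.symm (M.opp (e u, i)).1) := by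
    ext v
    simp [graph, Equiv.symm_apply_eq]
  rw [this, ← Set.image_univ, Set.ncard_image_of_injective, Set.ncard_univ]
  · simp
  · intro i j h
    exact M.simple _ _ _ (e.symm.injective h)

variable {M}

theorem ThreeConnected.avoid (h : M.ThreeConnected) [Fintype V] (hV : 3 < Fintype.card V)
    (s : Set V) (hs : s.Finite) (hs3 : s.ncard < 3) (f : V → Prop)
    (hf : ∀ v i, v ∉ s → (M.opp (v, i)).1 ∉ s → (f v ↔ f (M.opp (v, i)).1))
    (v w : V) (hv : v ∉ s) (hw : w ∉ s) : f v ↔ f w := by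
  classical
  obtain ⟨p, q, hpq, hvp, hvq, hwp, hwq⟩ : ∃ p q, s ⊆ {p, q} ∧ v ≠ p ∧ v ≠ q ∧ w ≠ p ∧ w ≠ q := by
    obtain h0 | h1 | h2 : s.ncard = 0 ∨ s.ncard = 1 ∨ s.ncard = 2 := by omega
    · obtain ⟨p, -, hp⟩ := Finset.exists_mem_notMem_of_card_lt_card
        (s := {v, w}) (t := Finset.univ) (by
          have := Finset.card_le_two (a := v) (b := w)
          rw [Finset.card_univ]
          omega)
      simp only [Finset.mem_insert, Finset.mem_singleton, not_or] at hp
      rw [Set.ncard_eq_zero hs] at h0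
      refine ⟨p, p, by simp [h0], ?_⟩
      tauto
    · obtain ⟨p, rfl⟩ := Set.ncard_eq_one.mp h1
      refine ⟨p, p, by simp, ?_⟩
      simp only [Set.mem_singleton_iff] at hv hw
      tauto
    · obtain ⟨p, q, -, rfl⟩ := Set.ncard_eq_two.mp h2
      refine ⟨p, q, by simp, ?_⟩
      simp only [Set.mem_insert_iff, Set.mem_singleton_iff, not_or] at hv hw
      tauto
  have hns : ∀ x, x ≠ p → x ≠ q → x ∉ s := by
    intro x h1 h2 hx
    rcases hpq hx with h | h
    exacts [h1 h, h2 h]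
  exact h p q f (fun x i h1 h2 h3 h4 => hf x i (hns _ h1 h2) (hns _ h3 h4)) v w hvp hvq hwp hwq

theorem ThreeConnected.isThreeConnected_graph (h : M.ThreeConnected) [Fintype V]
    (hV : 3 < Fintype.card V) : IsThreeConnected (M.graph e) := by
  have hU : Nat.card U = Fintype.card V := by
    rw [Nat.card_congr e, Nat.card_eq_fintype_card]
  have : Finite U := Finite.of_equiv V e.symm
  refine ⟨by rwa [Set.ncard_univ, hU], fun s hs hs3 => ?_⟩
  have hpre : ((M.graph e).induce (sᶜ : Set U)).Preconnected := by
    rintro ⟨u, hu⟩ ⟨v, hv⟩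
    let f : V → Prop := fun x =>
      ∃ hx : e.symm x ∈ sᶜ, ((M.graph e).induce (sᶜ : Set U)).Reachable ⟨u, hu⟩ ⟨e.symm x, hx⟩
    have hmem : ∀ x, x ∉ e '' s → e.symm x ∈ sᶜ := by
      intro x hx hx'
      exact hx ⟨_, hx', by simp⟩
    have key := h.avoid hV (e '' s) (hs.image _)
      (by rwa [Set.ncard_image_of_injective _ e.injective]) f (by
        intro x i hx hy
        have hadj : ((M.graph e).induce (sᶜ : Set U)).Adj ⟨e.symm x, hmem _ hx⟩
            ⟨e.symm (M.opp (x, i)).1, hmem _ hy⟩ := ⟨i, by simp⟩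
        constructor
        · rintro ⟨_, hr⟩
          exact ⟨hmem _ hy, hr.trans hadj.reachable⟩
        · rintro ⟨_, hr⟩
          exact ⟨hmem _ hx, hr.trans hadj.symm.reachable⟩) (e u) (e v)
      (by rintro ⟨x, hx, h⟩; exact hu (e.injective h ▸ hx))
      (by rintro ⟨x, hx, h⟩; exact hv (e.injective h ▸ hx))
    obtain ⟨hx, hr⟩ := key.mp ⟨by simpa using hu, by simp⟩
    simpa using hr
  have hne : (sᶜ : Set U).Nonempty := by
    rw [Set.nonempty_compl]
    rintro rfl
    rw [Set.ncard_univ, hU] at hs3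
    omega
  exact SimpleGraph.connected_iff _ |>.mpr ⟨hpre, hne.to_subtype⟩

theorem ThreeConnected.connected_graph (h : M.ThreeConnected) [Fintype V]
    (hV : 3 < Fintype.card V) : (M.graph e).Connected := by
  have h3 := (h.isThreeConnected_graph e hV).2 ∅ Set.finite_empty (by simp)
  refine (SimpleGraph.connected_iff _).mpr ⟨fun u v => ?_, ?_⟩
  · have := h3.preconnected ⟨u, by simp⟩ ⟨v, by simp⟩
    simpa using this.map (SimpleGraph.Embedding.induce _).toHom
  · obtain ⟨x⟩ := h3.nonempty
    exact ⟨x.1⟩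

end graph

end CubicMap

theorem SimpleGraph.Walk.apply_eq_of_forall_darts {U P : Type*} {G : SimpleGraph U} (g : U → P)
    {u v : U} (w : G.Walk u v) (h : ∀ d ∈ w.darts, g d.toProd.1 = g d.toProd.2) :
    ∀ x ∈ w.support, g x = g u := by
  induction w with
  | nil => simp
  | cons hadj w ih =>
    intro x hx
    rw [SimpleGraph.Walk.support_cons, List.mem_cons] at hx
    have h0 := h ⟨(_, _), hadj⟩ (by simp)
    rcases hx with rfl | hx
    · rfl
    · rw [ih (fun d hd => h d (by simp [hd])) x hx]
      exact h0.symm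

theorem SimpleGraph.Walk.IsCycle.even_ncard_incident {U : Type*} {G : SimpleGraph U} {u : U}
    {w : G.Walk u u} (hw : w.IsCycle) (v : U) : Even {x | s(v, x) ∈ w.edges}.ncard := by
  have hset : {x | s(v, x) ∈ w.edges} = w.toSubgraph.neighborSet v := by
    ext x
    simp [SimpleGraph.Walk.adj_toSubgraph_iff_mem_edges]
  rw [hset]
  by_cases hv : v ∈ w.support
  · rw [hw.ncard_neighborSet_toSubgraph_eq_two hv]
    exact even_two
  · have : w.toSubgraph.neighborSet v = ∅ := by
      ext x
      simp only [SimpleGraph.Subgraph.mem_neighborSet, Set.mem_empty_iff_false, iff_false]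
      intro h
      exact hv ((SimpleGraph.Walk.mem_verts_toSubgraph w).mp h.fst_mem)
    simp [this]

namespace CubicMap

variable {V U : Type} {M : CubicMap V} (e : U ≃ V)

open Classical in
/-- The set of darts whose edge lies on a walk. -/
noncomputable def edgeSetOf {u v : U} (w : (M.graph e).Walk u v) (x : V × Fin 3) : Bool :=
  decide (s(e.symm x.1, e.symm (M.opp x).1) ∈ w.edges)

theorem isEvenSet_edgeSetOf {u : U} {w : (M.graph e).Walk u u} (hw : w.IsCycle) :
    M.IsEvenSet (edgeSetOf e w) := by
  constructor
  · intro x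
    rw [Bool.eq_iff_iff]
    simp only [edgeSetOf, decide_eq_true_eq, M.opp_opp]
    rw [Sym2.eq_swap]
  · intro v
    have h := hw.even_ncard_incident (e.symm v)
    have hset : {x | s(e.symm v, x) ∈ w.edges} = (fun i => e.symm (M.opp (v, i)).1) ''
        {i | edgeSetOf e w (v, i) = true} := by
      ext x
      simp only [edgeSetOf, Set.mem_ofPred_eq, Set.mem_image, decide_eq_true_eq]
      constructor
      · intro hx
        obtain ⟨i, hi⟩ := w.adj_of_mem_edges hx
        rw [e.apply_symm_apply] at hi
        refine ⟨i, ?_, ?_⟩ <;> simp [hi, hx]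
      · rintro ⟨i, hi, rfl⟩
        exact hi
    have hinj : Function.Injective (fun i => e.symm (M.opp (v, i)).1) :=
      fun i j hij => M.simple _ _ _ (e.symm.injective hij)
    rw [hset, Set.ncard_image_of_injective _ hinj] at h
    generalize edgeSetOf e w = S at h
    have hfin : {i | S (v, i) = true} = ((Finset.univ.filter fun i => S (v, i) = true :
        Finset (Fin 3)) : Set (Fin 3)) := by
      ext; simp
    rw [hfin, Set.ncard_coe_finset, Finset.card_filter, Fin.sum_univ_three] at h
    revert h
    generalize S (v, 0) = a
    generalize S (v, 1) = b
    generalize S (v, 2) = c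
    revert a b c
    decide

theorem sum_edgeSetOf_le [Fintype V] {u v : U} (w : (M.graph e).Walk u v) :
    (∑ v, ∑ i, if edgeSetOf e w (v, i) then 1 else 0) ≤ 2 * w.length := by
  classical
  rw [← Fintype.sum_prod_type' (f := fun v i => if edgeSetOf e w (v, i) then 1 else 0),
    ← Finset.card_filter]
  have hsub : (Finset.univ.filter fun x : V × Fin 3 => edgeSetOf e w (x.1, x.2) = true).image
      (M.dartEquiv e) ⊆ w.darts.toFinset ∪ w.darts.toFinset.image SimpleGraph.Dart.symm := by
    intro d hd
    obtain ⟨x, hx, rfl⟩ := Finset.mem_image.mp hd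
    simp only [Finset.mem_filter, Finset.mem_univ, true_and, edgeSetOf, decide_eq_true_eq] at hx
    obtain ⟨d, hd, hde⟩ := List.mem_map.mp hx
    have hx' : (M.dartEquiv e x).edge = s(e.symm x.1, e.symm (M.opp x).1) := rfl
    rcases SimpleGraph.dart_edge_eq_iff _ _ |>.mp (hx'.trans hde.symm) with h | h
    · rw [h]
      simp [hd]
    · rw [h]
      simp [hd]
  have h1 := Finset.card_le_card hsub
  rw [Finset.card_image_of_injective _ (M.dartEquiv e).injective] at h1
  have h2 := Finset.card_union_le w.darts.toFinset (w.darts.toFinset.image SimpleGraph.Dart.symm)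
  have h3 := Finset.card_image_le (s := w.darts.toFinset) (f := SimpleGraph.Dart.symm)
  have h4 := w.darts.toFinset_card_le
  rw [w.length_darts] at h4
  simp only [Prod.mk.eta] at h1 ⊢
  omega

variable [Fintype V] {P : Type} {cls : V → P} {L : ℕ}

theorem Heavy.le_length_of_mem_edges (h : M.Heavy cls (fun _ => 1) L) {u : U}
    {w : (M.graph e).Walk u u} (hw : w.IsCycle) {x y : U} (hxy : s(x, y) ∈ w.edges)
    (hne : cls (e x) ≠ cls (e y)) : L ≤ 2 * w.length := by
  refine le_trans (h _ (isEvenSet_edgeSetOf e hw) ?_) (sum_edgeSetOf_le e w)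
  obtain ⟨i, hi⟩ := w.adj_of_mem_edges hxy
  refine ⟨(e x, i), ?_, ?_⟩
  · simp [edgeSetOf, hi, hxy]
  · rw [hi]
    exact hne.symm

theorem Heavy.length_le_or_le_length (h : M.Heavy cls (fun _ => 1) L) {K : ℕ}
    (hK : ∀ p, {v | cls v = p}.ncard ≤ K) {u : U}
    {w : (M.graph e).Walk u u} (hw : w.IsCycle) : w.length ≤ K ∨ L ≤ 2 * w.length := by
  classical
  by_cases hd : ∀ d ∈ w.darts, cls (e d.toProd.1) = cls (e d.toProd.2)
  · left
    have hs := w.apply_eq_of_forall_darts (fun x => cls (e x)) hd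
    have hlen : w.support.tail.length = w.length := by simp
    rw [← hlen, ← List.toFinset_card_of_nodup hw.support_nodup, ← Set.ncard_coe_finset,
      ← Set.ncard_image_of_injective _ e.injective]
    refine le_trans (Set.ncard_le_ncard ?_ (Set.toFinite _)) (hK (cls (e u)))
    rintro _ ⟨x, hx, rfl⟩
    refine hs x (List.mem_of_mem_tail ?_)
    simpa using hx
  · right
    push Not at hd
    obtain ⟨d, hd, hne⟩ := hd
    exact h.le_length_of_mem_edges e hw (List.mem_map.mpr ⟨d, hd, rfl⟩) hne

theorem Heavy.exists_isCycle (h : M.Heavy cls (fun _ => 1) L) (hconn : M.ThreeConnected)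
    (hV : 3 < Fintype.card V) (hcls : ∃ v w, cls v ≠ cls w) :
    ∃ (u : U) (w : (M.graph e).Walk u u), w.IsCycle ∧ L ≤ 2 * w.length := by
  have hG := hconn.connected_graph e hV
  obtain ⟨x, y, hadj, hne⟩ : ∃ x y, (M.graph e).Adj x y ∧ cls (e x) ≠ cls (e y) := by
    by_contra! hcon
    obtain ⟨v, w, hvw⟩ := hcls
    obtain ⟨p⟩ := hG.preconnected (e.symm v) (e.symm w)
    have := p.apply_eq_of_forall_darts (fun x => cls (e x)) (fun d _ => hcon _ _ d.adj) _
      p.end_mem_support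
    simp only [e.apply_symm_apply] at this
    exact hvw this.symm
  have hbr : ¬ (M.graph e).IsBridge s(x, y) := by
    rw [SimpleGraph.isBridge_iff]
    intro hb
    apply hb
    set H := (M.graph e).deleteEdges {s(x, y)} with hH
    have hyx : y ≠ x := hadj.ne'
    obtain ⟨i, hi⟩ := hadj.symm
    have hadjH : ∀ v j, (v, j) ≠ (e y, i) → M.opp (v, j) ≠ (e y, i) →
        H.Adj (e.symm v) (e.symm (M.opp (v, j)).1) := by
      intro v j h1 h2
      rw [hH, SimpleGraph.deleteEdges_adj]
      refine ⟨⟨j, by simp⟩, ?_⟩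
      intro h3
      rw [Set.mem_singleton_iff, Sym2.eq_iff] at h3
      simp only [Equiv.symm_apply_eq] at h3
      rcases h3 with ⟨rfl, h4⟩ | ⟨rfl, h4⟩
      · apply h2
        have hoi : M.opp (M.opp (e y, i)) = (e y, i) := M.opp_opp _
        rw [← hoi]
        congr 1
        have h5 : M.opp (e y, i) = (e x, (M.opp (e y, i)).2) := by rw [← hi]
        rw [h5]
        congr 1
        apply M.simple (e x)
        rw [← h5, hoi, h4]
      · apply h1
        congr 1
        exact M.simple (e y) _ _ (h4.trans hi.symm)
    have hns : ∀ j, e y ≠ (M.opp (e y, j)).1 := fun j hj => M.loopless _ hj.symm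
    have key := hconn (e y) (e y) (fun v => H.Reachable x (e.symm v)) (by
      intro v j hv _ hw _
      have := (hadjH v j (fun h => hv (congrArg Prod.fst h))
        (fun h => hw (congrArg Prod.fst h))).reachable
      exact ⟨fun h => h.trans this, fun h => h.trans this.symm⟩)
      (e x) (M.opp (e y, i + 1)).1 (fun h => hyx (e.injective h.symm))
      (fun h => hyx (e.injective h.symm)) (hns _).symm (hns _).symm
    have h1 : H.Reachable x (e.symm (M.opp (e y, i + 1)).1) := key.mp (by simp)
    have h2 := hadjH (e y) (i + 1) (by simp) (fun h => hns _ (congrArg Prod.fst h).symm)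
    simpa using h1.trans h2.symm.reachable
  rw [SimpleGraph.isBridge_iff_forall_cycle_notMem (SimpleGraph.mem_edgeSet _ |>.mpr hadj)] at hbr
  push Not at hbr
  obtain ⟨u, w, hw, hmem⟩ := hbr
  exact ⟨u, w, hw, h.le_length_of_mem_edges e hw hmem hne⟩

section truncate

variable {V : Type} (M : CubicMap V) (v₀ : V)

/-- Contraction of the new triangle. -/
def contract : {u // u ≠ v₀} ⊕ Fin 3 → V
  | Sum.inl u => u
  | Sum.inr _ => v₀

theorem contract_inr (k : Fin 3) : contract v₀ (Sum.inr k) = v₀ := rfl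

variable [DecidableEq V]

/-- The vertex of the truncation at which an old dart starts. -/
def ext (x : V × Fin 3) : ({u // u ≠ v₀} ⊕ Fin 3) × Fin 3 :=
  if h : x.1 = v₀ then (Sum.inr x.2, 0) else (Sum.inl ⟨x.1, h⟩, x.2)

/-- Reversal of darts in the truncation. -/
def truncOpp : ({u // u ≠ v₀} ⊕ Fin 3) × Fin 3 → ({u // u ≠ v₀} ⊕ Fin 3) × Fin 3
  | (Sum.inl u, i) => ext v₀ (M.opp (u, i))
  | (Sum.inr k, 0) => ext v₀ (M.opp (v₀, k))
  | (Sum.inr k, 1) => (Sum.inr (k + 1), 2)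
  | (Sum.inr k, 2) => (Sum.inr (k - 1), 1)

variable {v₀}

theorem ext_self (k : Fin 3) : ext v₀ (v₀, k) = (Sum.inr k, 0) := by
  simp [ext]

theorem ext_of_ne {u : V} (h : u ≠ v₀) (i : Fin 3) : ext v₀ (u, i) = (Sum.inl ⟨u, h⟩, i) := by
  simp [ext, h]

theorem contract_ext (x : V × Fin 3) : contract v₀ (ext v₀ x).1 = x.1 := by
  obtain ⟨u, i⟩ := x
  by_cases h : u = v₀
  · subst h
    simp [ext_self, contract]
  · simp [ext_of_ne h, contract]

theorem truncOpp_ext (x : V × Fin 3) : M.truncOpp v₀ (ext v₀ x) = ext v₀ (M.opp x) := by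
  obtain ⟨u, i⟩ := x
  by_cases h : u = v₀
  · subst h
    simp [ext_self, truncOpp]
  · simp [ext_of_ne h, truncOpp]

theorem ext_or_internal (y : ({u // u ≠ v₀} ⊕ Fin 3) × Fin 3) :
    (∃ x, y = ext v₀ x) ∨ ∃ k, y = (Sum.inr k, 1) ∨ y = (Sum.inr k, 2) := by
  obtain ⟨u | k, i⟩ := y
  · exact Or.inl ⟨(u, i), by simp [ext_of_ne u.2]⟩
  · fin_cases i
    · exact Or.inl ⟨(v₀, k), by simp [ext_self]⟩
    · exact Or.inr ⟨k, Or.inl rfl⟩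
    · exact Or.inr ⟨k, Or.inr rfl⟩

variable (v₀)

/-- Replace the vertex `v₀` by a triangle. -/
def truncate : CubicMap ({u // u ≠ v₀} ⊕ Fin 3) where
  opp := M.truncOpp v₀
  opp_opp y := by
    rcases ext_or_internal y with ⟨x, rfl⟩ | ⟨k, rfl | rfl⟩
    · rw [truncOpp_ext, truncOpp_ext, M.opp_opp]
    · simp [truncOpp]
    · simp [truncOpp]
  loopless y h := by
    rcases ext_or_internal y with ⟨x, rfl⟩ | ⟨k, rfl | rfl⟩
    · rw [truncOpp_ext] at h
      have := congrArg (contract v₀) h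
      rw [contract_ext, contract_ext] at this
      exact M.loopless x this
    · simp [truncOpp] at h
    · simp [truncOpp, sub_eq_self] at h
  simple y i j h := by
    have hc := congrArg (contract v₀) h
    rcases y with u | k
    · simp only [truncOpp, contract_ext] at hc
      exact M.simple _ _ _ hc
    · have hne := M.loopless (v₀, k)
      fin_cases i <;> fin_cases j <;>
        simp [truncOpp, contract_ext, contract_inr] at h hc ⊢
      · exact hne hc
      · exact hne hc
      · exact hne hc.symm
      · exact (by decide : ∀ k : Fin 3, k + 1 ≠ k - 1) k h
      · exact hne hc.symm
      · exact (by decide : ∀ k : Fin 3, k - 1 ≠ k + 1) k h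

variable {v₀}

theorem truncate_opp_ext (x : V × Fin 3) : (M.truncate v₀).opp (ext v₀ x) = ext v₀ (M.opp x) :=
  M.truncOpp_ext x

theorem face_truncate_one (k : Fin 3) :
    (M.truncate v₀).face (Sum.inr k, 1) = (Sum.inr (k + 1), 0) :=
  Prod.ext rfl (by decide : (2 : Fin 3) + 1 = 0)

theorem face_truncate_ext (x : V × Fin 3) :
    (M.truncate v₀).face (ext v₀ x) = ext v₀ (M.face x) ∨
    ∃ k, (M.truncate v₀).face (ext v₀ x) = (Sum.inr k, 1) ∧ M.face x = (v₀, k + 1) := by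
  unfold face
  rw [truncate_opp_ext]
  generalize M.opp x = y
  obtain ⟨u, i⟩ := y
  by_cases h : u = v₀
  · subst h
    right
    exact ⟨i, by simp [ext_self]⟩
  · left
    simp [ext_of_ne h]

open Classical in
theorem ThreeConnected.truncate {M : CubicMap V} (h : M.ThreeConnected) :
    (M.truncate v₀).ThreeConnected := by
  intro p' q' f' hf'
  have hedge : ∀ x : V × Fin 3, (ext v₀ x).1 ≠ p' → (ext v₀ x).1 ≠ q' →
      (ext v₀ (M.opp x)).1 ≠ p' → (ext v₀ (M.opp x)).1 ≠ q' →
      (f' (ext v₀ x).1 ↔ f' (ext v₀ (M.opp x)).1) := by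
    intro x h1 h2 h3 h4
    have := hf' (ext v₀ x).1 (ext v₀ x).2 h1 h2
    rw [Prod.mk.eta, truncate_opp_ext] at this
    exact this h3 h4
  have htri : ∀ j k : Fin 3, Sum.inr j ≠ p' → Sum.inr j ≠ q' → Sum.inr k ≠ p' →
      Sum.inr k ≠ q' → (f' (Sum.inr j) ↔ f' (Sum.inr k)) := by
    intro j k h1 h2 h3 h4
    obtain rfl | rfl | rfl : k = j ∨ k = j + 1 ∨ k = j - 1 := by
      clear * -
      revert j k; decide
    · rfl
    · exact hf' (Sum.inr j) 1 h1 h2 h3 h4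
    · exact hf' (Sum.inr j) 2 h1 h2 h3 h4
  by_cases hcase : ∃ k : Fin 3, Sum.inr k = p' ∨ Sum.inr k = q'
  · obtain ⟨q, hout⟩ : ∃ q : V, (∀ u : {u // u ≠ v₀}, Sum.inl u = p' ∨ Sum.inl u = q' → u.1 = q) ∧
        (∀ j k : Fin 3, q ≠ v₀ → (Sum.inr j = p' ∨ Sum.inr j = q') →
          (Sum.inr k = p' ∨ Sum.inr k = q') → j = k) ∧
        ∀ hq : q ≠ v₀, Sum.inl ⟨q, hq⟩ = p' ∨ Sum.inl ⟨q, hq⟩ = q' := by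
      obtain ⟨k, rfl | rfl⟩ := hcase
      · rcases q' with u | l
        · refine ⟨u.1, ?_, ?_, ?_⟩
          · simp +contextual
          · simp +contextual
          · simp
        · exact ⟨v₀, by simp, by simp, by simp⟩
      · rcases p' with u | l
        · refine ⟨u.1, ?_, ?_, ?_⟩
          · simp +contextual
          · simp +contextual
          · simp
        · exact ⟨v₀, by simp, by simp, by simp⟩
    obtain ⟨hq1, hq2, hq3⟩ := hout
    have hkeep : ∀ u : {u // u ≠ v₀}, u.1 ≠ q → Sum.inl u ≠ p' ∧ Sum.inl u ≠ q' := by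
      intro u hu
      constructor <;> intro hh <;> apply hu <;> apply hq1 <;> simp [hh]
    have key := h v₀ q (fun u => if hu : u = v₀ then True else f' (Sum.inl ⟨u, hu⟩)) (by
      intro v i h1 h2 h3 h4
      have := hedge (v, i)
      rw [ext_of_ne h1] at this
      have h5 : ext v₀ (M.opp (v, i)) = (Sum.inl ⟨_, h3⟩, (M.opp (v, i)).2) := ext_of_ne h3 _
      rw [h5] at this
      simp only [h1, h3, dite_false]
      exact this (hkeep ⟨v, h1⟩ h2).1 (hkeep ⟨v, h1⟩ h2).2 (hkeep ⟨_, h3⟩ h4).1 (hkeep ⟨_, h3⟩ h4).2)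
    have hred : ∀ y, y ≠ p' → y ≠ q' →
        ∃ u : {u // u ≠ v₀}, u.1 ≠ q ∧ (f' y ↔ f' (Sum.inl u)) := by
      have hnb : ∀ j : Fin 3, Sum.inr j ≠ p' → Sum.inr j ≠ q' → (M.opp (v₀, j)).1 ≠ q →
          ∃ u : {u // u ≠ v₀}, u.1 ≠ q ∧ (f' (Sum.inr j) ↔ f' (Sum.inl u)) := by
        intro j h1 h2 h3
        have hne : (M.opp (v₀, j)).1 ≠ v₀ := M.loopless (v₀, j)
        have h5 : ext v₀ (M.opp (v₀, j)) = (Sum.inl ⟨_, hne⟩, (M.opp (v₀, j)).2) := ext_of_ne hne _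
        have := hedge (v₀, j)
        rw [h5, ext_self] at this
        exact ⟨⟨_, hne⟩, h3, this h1 h2 (hkeep ⟨_, hne⟩ h3).1 (hkeep ⟨_, hne⟩ h3).2⟩
      rintro (u | j) h1 h2
      · refine ⟨u, fun hu => ?_, Iff.rfl⟩
        obtain ⟨u, hu'⟩ := u
        change u = q at hu
        subst hu
        rcases hq3 hu' with hh | hh
        exacts [h1 hh, h2 hh]
      · by_cases h3 : (M.opp (v₀, j)).1 = q
        · have hqv : q ≠ v₀ := h3 ▸ M.loopless (v₀, j)
          obtain ⟨k, hk⟩ := hcase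
          obtain ⟨l, hlj, hlk⟩ : ∃ l : Fin 3, l ≠ j ∧ l ≠ k := by
            clear * -
            revert j k; decide
          have hl : ¬ (Sum.inr l = p' ∨ Sum.inr l = q') := fun hl => hlk (hq2 l k hqv hl hk)
          rw [not_or] at hl
          obtain ⟨u, hu, hu'⟩ := hnb l hl.1 hl.2
            (fun h4 => hlj (M.simple v₀ _ _ (h4.trans h3.symm)))
          exact ⟨u, hu, (htri j l h1 h2 hl.1 hl.2).trans hu'⟩
        · exact hnb j h1 h2 h3
    intro v w hv1 hv2 hw1 hw2
    obtain ⟨u, hu, hu'⟩ := hred v hv1 hv2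
    obtain ⟨x, hx, hx'⟩ := hred w hw1 hw2
    rw [hu', hx']
    have := key u.1 x.1 u.2 hu x.2 hx
    simpa [u.2, x.2] using this
  · push Not at hcase
    have hp : ∀ y, y ≠ p' ↔ contract v₀ y ≠ contract v₀ p' := by
      rcases p' with u | k
      · rintro (y | j)
        · simp [contract, Subtype.ext_iff]
        · simp [contract, u.2.symm]
      · exact absurd rfl (hcase k).1
    have hq : ∀ y, y ≠ q' ↔ contract v₀ y ≠ contract v₀ q' := by
      rcases q' with u | k
      · rintro (y | j)
        · simp [contract, Subtype.ext_iff]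
        · simp [contract, u.2.symm]
      · exact absurd rfl (hcase k).2
    let f : V → Prop := fun u => if hu : u = v₀ then f' (Sum.inr 0) else f' (Sum.inl ⟨u, hu⟩)
    have hf : ∀ y, f (contract v₀ y) ↔ f' y := by
      rintro (u | k)
      · simp [f, contract, u.2]
      · simp only [f, contract, dite_true]
        exact htri _ _ (hcase _).1 (hcase _).2 (hcase _).1 (hcase _).2
    have key := h (contract v₀ p') (contract v₀ q') f (by
      intro v i h1 h2 h3 h4
      have := hedge (v, i)
      rw [hp, hp, hq, hq, contract_ext, contract_ext, ← hf, ← hf, contract_ext, contract_ext] at this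
      exact this h1 h2 h3 h4)
    intro v w hv1 hv2 hw1 hw2
    rw [hp] at hv1 hw1
    rw [hq] at hv2 hw2
    rw [← hf, ← hf]
    exact key _ _ hv1 hv2 hw1 hw2

theorem card_truncate [Fintype V] :
    Fintype.card ({u // u ≠ v₀} ⊕ Fin 3) = Fintype.card V + 2 := by
  have : 0 < Fintype.card V := Fintype.card_pos_iff.mpr ⟨v₀⟩
  simp [Fintype.card_subtype_compl]
  omega

theorem Spherical.truncate [Fintype V] {M : CubicMap V} (h : M.Spherical) :
    (M.truncate v₀).Spherical := by
  obtain ⟨F, _, lab, hsurj, hinv, heqv, hcard⟩ := h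
  let lab' : ({u // u ≠ v₀} ⊕ Fin 3) × Fin 3 → Option F := fun y =>
    match y with
    | (Sum.inl u, i) => some (lab (u, i))
    | (Sum.inr k, 0) => some (lab (v₀, k))
    | (Sum.inr k, 1) => some (lab (v₀, k + 1))
    | (Sum.inr _, 2) => none
  have hext : ∀ x, lab' (ext v₀ x) = some (lab x) := by
    rintro ⟨u, i⟩
    by_cases hu : u = v₀
    · subst hu
      simp [ext_self, lab']
    · simp [ext_of_ne hu, lab']
  refine ⟨Option F, inferInstance, lab', ?_, ?_, ?_, ?_⟩
  · rintro (_ | a)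
    · exact ⟨(Sum.inr 0, 2), rfl⟩
    · obtain ⟨x, rfl⟩ := hsurj a
      exact ⟨_, hext x⟩
  · intro y
    rcases ext_or_internal y with ⟨x, rfl⟩ | ⟨k, rfl | rfl⟩
    · rw [hext]
      rcases M.face_truncate_ext x with hx | ⟨k, hx, hk⟩
      · rw [hx, hext, hinv]
      · rw [hx, ← hinv x, hk]
    · rfl
    · rfl
  · have hstep : ∀ x y, Relation.EqvGen (fun a b => M.face a = b) x y →
        Relation.EqvGen (fun a b => (M.truncate v₀).face a = b) (ext v₀ x) (ext v₀ y) := by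
      intro x y hxy
      induction hxy with
      | rel x y hxy =>
        subst hxy
        rcases M.face_truncate_ext x with hx | ⟨k, hx, hk⟩
        · exact Relation.EqvGen.rel _ _ hx
        · refine Relation.EqvGen.trans _ _ _ (Relation.EqvGen.rel _ _ hx)
            (Relation.EqvGen.rel _ _ ?_)
          rw [hk, ext_self, face_truncate_one]
      | refl x => exact Relation.EqvGen.refl _
      | symm x y _ ih => exact Relation.EqvGen.symm _ _ ih
      | trans x y z _ _ ih1 ih2 => exact Relation.EqvGen.trans _ _ _ ih1 ih2
    have hrep : ∀ y, (∃ x, Relation.EqvGen (fun a b => (M.truncate v₀).face a = b) y (ext v₀ x) ∧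
        lab' y = some (lab x)) ∨ ∃ k, y = (Sum.inr k, 2) := by
      intro y
      rcases ext_or_internal y with ⟨x, rfl⟩ | ⟨k, rfl | rfl⟩
      · exact Or.inl ⟨x, Relation.EqvGen.refl _, hext x⟩
      · refine Or.inl ⟨(v₀, k + 1), Relation.EqvGen.rel _ _ ?_, rfl⟩
        rw [ext_self, face_truncate_one]
      · exact Or.inr ⟨k, rfl⟩
    intro y z hyz
    rcases hrep y with ⟨x, hx, hlx⟩ | ⟨k, rfl⟩ <;> rcases hrep z with ⟨w, hw, hlw⟩ | ⟨l, rfl⟩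
    · rw [hlx, hlw, Option.some_inj] at hyz
      exact (hx.trans _ _ _ (hstep _ _ (heqv _ _ hyz))).trans _ _ _ (hw.symm _ _)
    · rw [hlx] at hyz
      exact absurd hyz (Option.some_ne_none _)
    · rw [hlw] at hyz
      exact absurd hyz.symm (Option.some_ne_none _)
    · obtain rfl | rfl | rfl : l = k ∨ l = k - 1 ∨ k = l - 1 := by
        clear * -
        revert k l; decide
      · exact Relation.EqvGen.refl _
      · exact Relation.EqvGen.rel _ _ rfl
      · exact Relation.EqvGen.symm _ _ (Relation.EqvGen.rel _ _ rfl)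
  · rw [Fintype.card_option, card_truncate]
    omega

theorem sum_truncate [Fintype V] (g : {u // u ≠ v₀} ⊕ Fin 3 → ℕ) (g₀ : V → ℕ)
    (h : ∀ u : {u // u ≠ v₀}, g (Sum.inl u) = g₀ u) :
    ∑ y, g y + g₀ v₀ = ∑ v, g₀ v + ∑ k, g (Sum.inr k) := by
  rw [Fintype.sum_sum_type, Finset.sum_congr rfl (fun u _ => h u)]
  have := Fintype.sum_subtype_add_sum_subtype (fun u => u ≠ v₀) g₀
  have h2 : ∑ u : {u // ¬ u ≠ v₀}, g₀ u = g₀ v₀ := by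
    have : ∀ u : {u // ¬ u ≠ v₀}, g₀ u = g₀ v₀ := fun u => by rw [not_not.mp u.2]
    rw [Finset.sum_congr rfl (fun u _ => this u)]
    simp
  omega

/-- The weights of the truncation: `a k` is moved from the dart `(v₀, k)` to the new triangle. -/
def truncWeight (d : V × Fin 3 → ℕ) (a : Fin 3 → ℕ) :
    ({u // u ≠ v₀} ⊕ Fin 3) × Fin 3 → ℕ
  | (Sum.inl u, i) => d (u, i)
  | (Sum.inr k, 0) => d (v₀, k) - a k
  | (Sum.inr k, _) => a k

theorem IsEvenSet.of_truncate {M : CubicMap V} {S : ({u // u ≠ v₀} ⊕ Fin 3) × Fin 3 → Bool}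
    (hS : (M.truncate v₀).IsEvenSet S) : M.IsEvenSet (fun x => S (ext v₀ x)) := by
  constructor
  · intro x
    change S (ext v₀ (M.opp x)) = S (ext v₀ x)
    rw [← truncate_opp_ext, hS.1]
  · intro v
    by_cases hv : v = v₀
    · subst hv
      simp only [ext_self]
      have h0 := hS.2 (Sum.inr 0)
      have h1 := hS.2 (Sum.inr 1)
      have h2 := hS.2 (Sum.inr 2)
      have e0 : S (Sum.inr 1, 2) = S (Sum.inr 0, 1) := hS.1 (Sum.inr 0, 1)
      have e1 : S (Sum.inr 2, 2) = S (Sum.inr 1, 1) := hS.1 (Sum.inr 1, 1)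
      have e2 : S (Sum.inr 0, 2) = S (Sum.inr 2, 1) := hS.1 (Sum.inr 2, 1)
      rw [e0] at h1
      rw [e1] at h2
      rw [e2] at h0
      revert h0 h1 h2
      generalize S (Sum.inr 0, 0) = a
      generalize S (Sum.inr 1, 0) = b
      generalize S (Sum.inr 2, 0) = c
      generalize S (Sum.inr 0, 1) = x
      generalize S (Sum.inr 1, 1) = y
      generalize S (Sum.inr 2, 1) = z
      revert a b c x y z
      decide
    · simp only [ext_of_ne hv]
      exact hS.2 _

theorem Heavy.truncate [Fintype V] {M : CubicMap V} {P : Type} {cls : V → P}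
    {d : V × Fin 3 → ℕ} {L : ℕ} (h : M.Heavy cls d L) (a : Fin 3 → ℕ)
    (ha : ∀ k, a k ≤ d (v₀, k)) :
    (M.truncate v₀).Heavy (fun y => cls (contract v₀ y)) (truncWeight (v₀ := v₀) d a) L := by
  intro S hS hcross
  refine (h _ hS.of_truncate ?_).trans ?_
  · obtain ⟨y, hy, hne⟩ := hcross
    rcases ext_or_internal y with ⟨x, rfl⟩ | ⟨k, rfl | rfl⟩
    · refine ⟨x, hy, ?_⟩
      simpa only [truncate_opp_ext, contract_ext] using hne
    · exact absurd rfl hne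
    · exact absurd rfl hne
  · have hsum := sum_truncate (v₀ := v₀)
      (fun y => ∑ i, if S (y, i) then truncWeight (v₀ := v₀) d a (y, i) else 0)
      (fun v => ∑ i, if S (ext v₀ (v, i)) then d (v, i) else 0) (by
        intro u
        simp [ext_of_ne u.2, truncWeight])
    have hloc : ∑ i, (if S (ext v₀ (v₀, i)) then d (v₀, i) else 0) ≤
        ∑ k, ∑ i, if S (Sum.inr k, i) then truncWeight (v₀ := v₀) d a (Sum.inr k, i) else 0 := by
      refine Finset.sum_le_sum fun k _ => ?_
      have hev := hS.2 (Sum.inr k)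
      have hak := ha k
      rw [Fin.sum_univ_three, ext_self]
      simp only [truncWeight]
      revert hev
      generalize S (Sum.inr k, 0) = x
      generalize S (Sum.inr k, 1) = y
      generalize S (Sum.inr k, 2) = z
      cases x <;> cases y <;> cases z <;> simp <;> omega
    omega

end truncate

/-- A vertex at which no further truncation is needed (`κ = 0`), or `κ` further ones are. -/
def Expandable {V : Type} (κ : V → ℕ) (d : V × Fin 3 → ℕ) (v : V) : Prop :=
  (κ v = 0 ∧ ∀ i, d (v, i) ≤ 1) ∨
    ∃ c : Fin 3 → ℕ, (∀ i, d (v, i) = 2 * c i + 2) ∧ κ v = 1 + ∑ i, c i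

theorem Heavy.mono {V : Type} [Fintype V] {M : CubicMap V} {P : Type} {cls : V → P}
    {d d' : V × Fin 3 → ℕ} {L : ℕ} (h : M.Heavy cls d L) (hd : ∀ x, d x ≤ d' x) :
    M.Heavy cls d' L := by
  intro S hS hx
  refine (h S hS hx).trans (Finset.sum_le_sum fun v _ => Finset.sum_le_sum fun i _ => ?_)
  split_ifs
  exacts [hd _, le_rfl]

/-- Repeated truncation turns a weighted map into an unweighted one, each vertex `v` being
replaced by `1 + 2 * κ v` vertices. -/
theorem Heavy.exists_expansion {P : Type} {L : ℕ} {V : Type} [Fintype V] {M : CubicMap V}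
    {cls : V → P} {κ : V → ℕ} {d : V × Fin 3 → ℕ} (h : M.Heavy cls d L)
    (hd : ∀ v, Expandable κ d v) (hconn : M.ThreeConnected) (hsph : M.Spherical) :
    ∃ (W : Type) (_ : Fintype W) (N : CubicMap W) (cls' : W → P),
      N.ThreeConnected ∧ N.Spherical ∧ N.Heavy cls' (fun _ => 1) L ∧
      ∀ g : P → ℕ, ∑ w, g (cls' w) = ∑ v, (1 + 2 * κ v) * g (cls v) := by
  classical
  induction hn : ∑ v, κ v generalizing V with
  | zero =>
    have hκ : ∀ v, κ v = 0 := by simpa using hn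
    refine ⟨V, inferInstance, M, cls, hconn, hsph, h.mono ?_, by simp [hκ]⟩
    rintro ⟨v, i⟩
    rcases hd v with ⟨-, hv⟩ | ⟨c, -, hc⟩
    · exact hv i
    · rw [hκ] at hc
      omega
  | succ n ih =>
    obtain ⟨v₀, hv₀⟩ : ∃ v, κ v ≠ 0 := by
      by_contra! hcon
      simp [hcon] at hn
    obtain ⟨c, hdc, hκ⟩ := (hd v₀).resolve_left fun hv => hv₀ hv.1
    let a : Fin 3 → ℕ := fun k => if c k = 0 then 1 else 2
    let κ' : {u // u ≠ v₀} ⊕ Fin 3 → ℕ := Sum.elim (fun u => κ u) c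
    have ha : ∀ k, a k ≤ d (v₀, k) := by
      intro k
      simp only [a, hdc]
      split_ifs <;> omega
    obtain ⟨W, hW, N, cls', h1, h2, h3, h4⟩ := ih (κ := κ') (h.truncate a ha) (by
      rintro (⟨u, hu⟩ | k)
      · exact hd u
      · by_cases hk : c k = 0
        · refine Or.inl ⟨hk, fun i => ?_⟩
          fin_cases i <;> simp [truncWeight, a, hdc, hk]
        · refine Or.inr ⟨![c k - 1, 0, 0], fun i => ?_, ?_⟩
          · fin_cases i <;> simp [truncWeight, a, hdc, hk]
            omega
          · simp only [κ', Sum.elim_inr, Fin.sum_univ_three]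
            simp
            omega) (hconn.truncate) (hsph.truncate) (by
      have := sum_truncate κ' κ (fun _ => rfl)
      simp only [κ', Sum.elim_inr] at this ⊢
      omega)
    refine ⟨W, hW, N, cls', h1, h2, h3, fun g => ?_⟩
    rw [h4]
    have := sum_truncate (v₀ := v₀) (fun y => (1 + 2 * κ' y) * g (cls (contract v₀ y)))
      (fun v => (1 + 2 * κ v) * g (cls v)) (fun _ => rfl)
    have h5 : ∑ k, (1 + 2 * κ' (Sum.inr k)) * g (cls (contract v₀ (Sum.inr k))) =
        (1 + 2 * κ v₀) * g (cls v₀) := by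
      rw [hκ, Fin.sum_univ_three, Fin.sum_univ_three]
      simp only [κ', Sum.elim_inr, contract_inr]
      ring
    omega

end CubicMap

namespace RingMap

/-- The darts used by an even set in one sector, in terms of the edges `a q t y e` entering the
sector from the left and the radial edges `u v w z` of the sector. -/
def sectorBits (a q t y e u v w z : Bool) : Fin 8 → Fin 3 → Bool :=
  ![![a ^^ u, a, u],
    ![q ^^ u, u, q],
    ![q ^^ u ^^ v, q ^^ u, v],
    ![t ^^ v, v, t],
    ![t ^^ v ^^ w, t ^^ v, w],
    ![y ^^ w, w, y],
    ![y ^^ w ^^ z, y ^^ w, z],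
    ![e ^^ z, z, e]]

/-- The coefficient of `s` in the weight of a dart. -/
def dartSlope : Fin 8 → Fin 3 → ℕ :=
  ![![0, 0, 2], ![2, 0, 0], ![2, 0, 0], ![2, 0, 0], ![2, 0, 0], ![2, 0, 0], ![2, 0, 0], ![0, 2, 0]]

/-- The constant term in the weight of a dart. -/
def dartOffset : Fin 8 → Fin 3 → ℕ :=
  ![![2, 2, 2], ![0, 4, 2], ![2, 2, 2], ![2, 2, 2], ![2, 2, 2], ![2, 2, 2], ![0, 2, 4], ![2, 2, 2]]

/-- The total of the coefficients `c` of the darts in `b`. -/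
def total (c : Fin 8 → Fin 3 → ℕ) (b : Fin 8 → Fin 3 → Bool) : ℕ :=
  ∑ t, ∑ i, if b t i then c t i else 0

/-- A weight `α * s + β` is at least `8 * s + 22` for all `s ≥ 1`. -/
def Large (α β : ℕ) : Prop := 8 ≤ α ∧ 30 ≤ α + β

instance (α β : ℕ) : Decidable (Large α β) := inferInstanceAs (Decidable (_ ∧ _))

/-- The darts of a sector, when the darts of the sector to its left are `b`. -/
def nextBits (b : Fin 8 → Fin 3 → Bool) (u v w z : Bool) : Fin 8 → Fin 3 → Bool :=
  sectorBits (b 0 0) (b 2 0) (b 4 0) (b 6 0) (b 7 0) u v w z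

set_option maxRecDepth 100000 in
theorem large_window : ∀ u₁ v₁ w₁ z₁ : Bool, (u₁ || v₁ || w₁ || z₁) = true →
    Large (total dartSlope (sectorBits false false false false false u₁ v₁ w₁ z₁))
      (total dartOffset (sectorBits false false false false false u₁ v₁ w₁ z₁)) ∨
    ∀ u₂ v₂ w₂ z₂ : Bool,
    Large (total dartSlope (sectorBits false false false false false u₁ v₁ w₁ z₁) +
        total dartSlope (nextBits (sectorBits false false false false false u₁ v₁ w₁ z₁) u₂ v₂ w₂ z₂))
      (total dartOffset (sectorBits false false false false false u₁ v₁ w₁ z₁) +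
        total dartOffset (nextBits (sectorBits false false false false false u₁ v₁ w₁ z₁) u₂ v₂ w₂ z₂)) ∨
    ∀ u₃ v₃ w₃ z₃ : Bool,
    Large (total dartSlope (sectorBits false false false false false u₁ v₁ w₁ z₁) +
        total dartSlope (nextBits (sectorBits false false false false false u₁ v₁ w₁ z₁) u₂ v₂ w₂ z₂) +
        total dartSlope (nextBits
          (nextBits (sectorBits false false false false false u₁ v₁ w₁ z₁) u₂ v₂ w₂ z₂) u₃ v₃ w₃ z₃))
      (total dartOffset (sectorBits false false false false false u₁ v₁ w₁ z₁) +
        total dartOffset (nextBits (sectorBits false false false false false u₁ v₁ w₁ z₁) u₂ v₂ w₂ z₂) +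
        total dartOffset (nextBits
          (nextBits (sectorBits false false false false false u₁ v₁ w₁ z₁) u₂ v₂ w₂ z₂) u₃ v₃ w₃ z₃))
        := by
  decide +kernel

/-- No edge leads to the next sector. -/
def GapEmpty (b : Fin 8 → Fin 3 → Bool) : Prop :=
  (b 0 0 || b 2 0 || b 4 0 || b 6 0 || b 7 0) = false

instance (b : Fin 8 → Fin 3 → Bool) : Decidable (GapEmpty b) := inferInstanceAs (Decidable (_ = _))

set_option maxRecDepth 100000 in
theorem four_le_total : ∀ a q t y e u v w z : Bool, (a || q || t || y || e) = true →
    ¬ GapEmpty (sectorBits a q t y e u v w z) →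
    4 ≤ total dartSlope (sectorBits a q t y e u v w z) +
      total dartOffset (sectorBits a q t y e u v w z) := by
  decide +kernel

/-- The reverse of the dart `i` of the vertex of type `t` in sector `0`: its sector, the type of
its tail, and its position there. Each sector is a path of eight vertices, of types `0` to `7`.
The types `{0}`, `{1, 2}`, `{3, 4}`, `{5, 6}`, `{7}` form five concentric rings, and the positions
are right, left, down at types `0, 2, 4, 6` and right, up, left at types `1, 3, 5, 7`. -/
def oppTable : Fin 8 → Fin 3 → ℤ × Fin 8 × Fin 3 :=
  ![![(1, 0, 1), (-1, 0, 0), (0, 1, 1)],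
    ![(0, 2, 1), (0, 0, 2), (-1, 2, 0)],
    ![(1, 1, 2), (0, 1, 0), (0, 3, 1)],
    ![(0, 4, 1), (0, 2, 2), (-1, 4, 0)],
    ![(1, 3, 2), (0, 3, 0), (0, 5, 1)],
    ![(0, 6, 1), (0, 4, 2), (-1, 6, 0)],
    ![(1, 5, 2), (0, 5, 0), (0, 7, 1)],
    ![(1, 7, 2), (0, 6, 2), (-1, 7, 0)]]

/-- The dart of the ring map given by coordinates relative to the sector `j`. -/
def place {m : ℕ} (j : ZMod m) (y : ℤ × Fin 8 × Fin 3) : (ZMod m × Fin 8) × Fin 3 :=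
  ((j + y.1, y.2.1), y.2.2)

theorem intCast_ne_zero {m : ℕ} (hm : 3 ≤ m) {z : ℤ} (hz : z ≠ 0) (h1 : -2 ≤ z) (h2 : z ≤ 2) :
    (z : ZMod m) ≠ 0 := by
  rw [Ne, ZMod.intCast_zmod_eq_zero_iff_dvd]
  intro h
  rcases lt_or_gt_of_ne hz with h3 | h3
  · have := Int.le_of_dvd (by omega) ((Int.dvd_neg).mpr h)
    omega
  · have := Int.le_of_dvd h3 h
    omega

/-- The map with `m` sectors. -/
def ringMap (m : ℕ) (hm : 3 ≤ m) : CubicMap (ZMod m × Fin 8) where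
  opp x := place x.1.1 (oppTable x.1.2 x.2)
  opp_opp := by
    rintro ⟨⟨j, t⟩, i⟩
    obtain ⟨h1, h2⟩ := (by decide : ∀ t i, (oppTable t i).1 +
      (oppTable (oppTable t i).2.1 (oppTable t i).2.2).1 = 0 ∧
      (oppTable (oppTable t i).2.1 (oppTable t i).2.2).2 = (t, i)) t i
    simp only [place, h2, add_assoc]
    rw [← Int.cast_add, h1, Int.cast_zero, add_zero]
  loopless := by
    rintro ⟨⟨j, t⟩, i⟩ h
    simp only [place, Prod.mk.injEq, add_eq_left] at h
    obtain ⟨h1, h2, h3⟩ := (by decide : ∀ t i, (oppTable t i).2.1 = t →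
      (oppTable t i).1 ≠ 0 ∧ -2 ≤ (oppTable t i).1 ∧ (oppTable t i).1 ≤ 2) t i h.2
    exact intCast_ne_zero hm h1 h2 h3 h.1
  simple := by
    rintro ⟨j, t⟩ i k h
    simp only [place, Prod.mk.injEq, add_right_inj] at h
    by_contra hik
    obtain ⟨h1, h2, h3⟩ := (by decide : ∀ t i k, (oppTable t i).2.1 = (oppTable t k).2.1 → i ≠ k →
      (oppTable t i).1 - (oppTable t k).1 ≠ 0 ∧ -2 ≤ (oppTable t i).1 - (oppTable t k).1 ∧
      (oppTable t i).1 - (oppTable t k).1 ≤ 2) t i k h.2 hik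
    apply intCast_ne_zero hm h1 h2 h3
    rw [Int.cast_sub, h.1, sub_self]

variable {m : ℕ} (hm : 3 ≤ m)

theorem forall_zmod [NeZero m] {p : ZMod m → Prop} (j₀ : ZMod m) (h0 : p j₀)
    (h : ∀ j, p j → p (j + 1)) (j : ZMod m) : p j := by
  have key : ∀ n : ℕ, p (j₀ + n) := by
    intro n
    induction n with
    | zero => simpa using h0
    | succ n ih => simpa [add_assoc] using h _ ih
  have := key (j - j₀).val
  simpa using this

theorem threeConnected_ringMap [NeZero m] : (ringMap m hm).ThreeConnected := by
  intro p q f hf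
  have hedge : ∀ j t s t', (∃ i, (oppTable t i).1 = s ∧ (oppTable t i).2.1 = t') →
      (j, t) ≠ p → (j, t) ≠ q → (j + s, t') ≠ p → (j + s, t') ≠ q →
      (f (j, t) ↔ f (j + (s : ZMod m), t')) := by
    rintro j t _ _ ⟨i, rfl, rfl⟩ h1 h2 h3 h4
    exact hf (j, t) i h1 h2 h3 h4
  have hcol : ∀ j t n (h : t + n < 8), (∀ r : Fin 8, t ≤ r.val → r.val ≤ t + n →
      (j, r) ≠ p ∧ (j, r) ≠ q) → (f (j, ⟨t, by omega⟩) ↔ f (j, ⟨t + n, h⟩)) := by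
    intro j t n h hok
    induction n with
    | zero => rfl
    | succ n ih =>
      have h1 := hok ⟨t + n, by omega⟩ (by simp) (by simp)
      have h2 := hok ⟨t + (n + 1), by omega⟩ (by simp) (by simp)
      refine (ih (by omega) fun r hr hr' => hok r hr (by omega)).trans ?_
      have := hedge j ⟨t + n, by omega⟩ 0 ⟨t + (n + 1), by omega⟩ ?_ h1.1 h1.2
      · simp only [Int.cast_zero, add_zero] at this
        exact this h2.1 h2.2
      · exact (by decide : ∀ a b : Fin 8, a.val + 1 = b.val → ∃ i,
          (oppTable a i).1 = 0 ∧ (oppTable a i).2.1 = b) _ _ rfl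
  have hup : ∀ j (a b : Fin 8), a ≤ b → (∀ r, a ≤ r → r ≤ b → (j, r) ≠ p ∧ (j, r) ≠ q) →
      (f (j, a) ↔ f (j, b)) := by
    intro j a b hab hok
    obtain ⟨n, hn⟩ := Nat.exists_eq_add_of_le (Fin.le_def.mp hab)
    have := hcol j a.val n (by omega) (fun r hr hr' => hok r hr (Fin.le_def.mpr (by omega)))
    simpa only [← hn, Fin.eta] using this
  obtain ⟨t₀, c, hring⟩ : ∃ (t : Fin 8) (c : Prop),
      ∀ j, ((j, t) ≠ p ∧ (j, t) ≠ q) ∧ (f (j, t) ↔ c) := by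
    have hloop : ∀ t : Fin 8, (∃ i, (oppTable t i).1 = 1 ∧ (oppTable t i).2.1 = t) →
        p.2 ≠ t → q.2 ≠ t →
        ∃ (t : Fin 8) (c : Prop), ∀ j, ((j, t) ≠ p ∧ (j, t) ≠ q) ∧ (f (j, t) ↔ c) := by
      intro t ht hp hq
      have hok : ∀ j, (j, t) ≠ p ∧ (j, t) ≠ q := fun j =>
        ⟨fun h => hp (h ▸ rfl), fun h => hq (h ▸ rfl)⟩
      refine ⟨t, f (0, t), fun j => ⟨hok j, ?_⟩⟩
      refine forall_zmod (p := fun j => f (j, t) ↔ f (0, t)) 0 Iff.rfl (fun j hj => ?_) j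
      rw [← hj]
      have := hedge j t 1 t ht (hok _).1 (hok _).2
      simp only [Int.cast_one] at this
      exact (this (hok _).1 (hok _).2).symm
    by_cases h0 : p.2 ≠ 0 ∧ q.2 ≠ 0
    · exact hloop 0 ⟨0, rfl, rfl⟩ h0.1 h0.2
    by_cases h7 : p.2 ≠ 7 ∧ q.2 ≠ 7
    · exact hloop 7 ⟨0, rfl, rfl⟩ h7.1 h7.2
    have hok : ∀ j, ((j, (1 : Fin 8)) ≠ p ∧ (j, (1 : Fin 8)) ≠ q) ∧
        ((j, (2 : Fin 8)) ≠ p ∧ (j, (2 : Fin 8)) ≠ q) := by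
      obtain ⟨p₁, p⟩ := p
      obtain ⟨q₁, q⟩ := q
      simp only [ne_eq, Prod.mk.injEq, not_and] at h0 h7 ⊢
      have := (by decide : ∀ p q : Fin 8, ¬ (¬ p = 0 ∧ ¬ q = 0) → ¬ (¬ p = 7 ∧ ¬ q = 7) →
        (¬ 1 = p ∧ ¬ 1 = q) ∧ (¬ 2 = p ∧ ¬ 2 = q)) p q (by tauto) (by tauto)
      tauto
    refine ⟨1, f (0, 1), fun j => ⟨(hok j).1, ?_⟩⟩
    refine forall_zmod (p := fun j => f (j, 1) ↔ f (0, 1)) 0 Iff.rfl (fun j hj => ?_) j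
    rw [← hj]
    have h1 := hedge j 1 0 2 ⟨0, rfl, rfl⟩ (hok _).1.1 (hok _).1.2
    have h2 := hedge j 2 1 1 ⟨0, rfl, rfl⟩ (hok _).2.1 (hok _).2.2
    simp only [Int.cast_one, Int.cast_zero, add_zero] at h1 h2
    exact ((h1 (hok _).2.1 (hok _).2.2).trans (h2 (hok _).1.1 (hok _).1.2)).symm
  have hclean : ∀ j, j ≠ p.1 → j ≠ q.1 → ∀ t, f (j, t) ↔ c := by
    intro j hp hq t
    have hok : ∀ r, (j, r) ≠ p ∧ (j, r) ≠ q := fun r =>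
      ⟨fun h => hp (h ▸ rfl), fun h => hq (h ▸ rfl)⟩
    rw [← (hring j).2]
    rcases le_total t t₀ with h | h
    · exact hup j t t₀ h fun r _ _ => hok r
    · exact (hup j t₀ t h fun r _ _ => hok r).symm
  have hside : ∀ j t (s : ℤ), (∃ i, (oppTable t i).1 = s) → (j, t) ≠ p → (j, t) ≠ q →
      j + (s : ZMod m) ≠ p.1 → j + (s : ZMod m) ≠ q.1 → (f (j, t) ↔ c) := by
    rintro j t _ ⟨i, rfl⟩ h1 h2 h3 h4
    exact (hedge j t _ _ ⟨i, rfl, rfl⟩ h1 h2 (fun h => h3 (h ▸ rfl)) (fun h => h4 (h ▸ rfl))).trans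
      (hclean _ h3 h4 _)
  have hone : ∀ j (a : Fin 8), (∀ t, t ≠ a → (j, t) ≠ p ∧ (j, t) ≠ q) →
      (∃ s : ℤ, (s = 1 ∨ s = -1) ∧ j + (s : ZMod m) ≠ p.1 ∧ j + (s : ZMod m) ≠ q.1) →
      ∀ t, t ≠ a → (f (j, t) ↔ c) := by
    rintro j a hok ⟨s, hs, hs1, hs2⟩ t hta
    rcases lt_or_gt_of_ne hta with h | h
    · have h0 := hok 0 (ne_of_lt (lt_of_le_of_lt (Fin.zero_le t) h))
      rw [← hup j 0 t (Fin.zero_le t) fun r _ hr => hok r (ne_of_lt (lt_of_le_of_lt hr h))]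
      refine hside j 0 s ?_ h0.1 h0.2 hs1 hs2
      rcases hs with rfl | rfl <;> decide
    · have h7 := hok 7 (ne_of_gt (lt_of_lt_of_le h (Fin.le_last t)))
      rw [hup j t 7 (Fin.le_last t) fun r hr _ => hok r (ne_of_gt (lt_of_lt_of_le h hr))]
      refine hside j 7 s ?_ h7.1 h7.2 hs1 hs2
      rcases hs with rfl | rfl <;> decide
  have hstep : ∀ (j : ZMod m) (s : ℤ), s = 1 ∨ s = -1 → j + (s : ZMod m) ≠ j := by
    intro j s hs h
    exact intCast_ne_zero hm (by omega) (by omega) (by omega) (add_eq_left.mp h)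
  have hother : ∀ j k : ZMod m, ∃ s : ℤ, (s = 1 ∨ s = -1) ∧ j + (s : ZMod m) ≠ j ∧
      j + (s : ZMod m) ≠ k := by
    intro j k
    by_cases h : j + ((1 : ℤ) : ZMod m) = k
    · refine ⟨-1, Or.inr rfl, hstep _ _ (Or.inr rfl), fun h' => ?_⟩
      apply intCast_ne_zero hm (z := 2) (by omega) (by omega) (by omega)
      have := h.trans h'.symm
      push_cast at this ⊢
      linear_combination this
    · exact ⟨1, Or.inl rfl, hstep _ _ (Or.inl rfl), h⟩
  have hall : ∀ v, v ≠ p → v ≠ q → (f v ↔ c) := by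
    rintro ⟨j, t⟩ hp hq
    by_cases h1 : j = p.1 <;> by_cases h2 : j = q.1
    · obtain ⟨i, hi⟩ := (by decide : ∀ t, ∃ i, (oppTable t i).1 = 1 ∨ (oppTable t i).1 = -1) t
      have := hstep j _ hi
      exact hside j t _ ⟨i, rfl⟩ hp hq (h1 ▸ this) (h2 ▸ this)
    · refine hone j p.2 (fun r hr => ⟨fun h => hr (h ▸ rfl), fun h => h2 (h ▸ rfl)⟩)
        (h1 ▸ hother p.1 q.1) t (fun h => hp (Prod.ext h1 h))
    · obtain ⟨s, hs, hs1, hs2⟩ := hother q.1 p.1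
      refine hone j q.2 (fun r hr => ⟨fun h => h1 (h ▸ rfl), fun h => hr (h ▸ rfl)⟩)
        ⟨s, hs, h2 ▸ hs2, h2 ▸ hs1⟩ t (fun h => hq (Prod.ext h2 h))
    · exact hclean j h1 h2 t
  intro v w h1 h2 h3 h4
  rw [hall v h1 h2, hall w h3 h4]

/-- The face of each dart of sector `0`: a bounded face has a sector and one of four rings of
faces, and there are two outer faces. -/
def faceTable : Fin 8 → Fin 3 → ℤ × (Fin 4 ⊕ Fin 2) :=
  ![![(0, .inl 0), (0, .inr 0), (-1, .inl 0)],
    ![(-1, .inl 1), (0, .inl 0), (-1, .inl 0)],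
    ![(0, .inl 1), (0, .inl 0), (-1, .inl 1)],
    ![(-1, .inl 2), (0, .inl 1), (-1, .inl 1)],
    ![(0, .inl 2), (0, .inl 1), (-1, .inl 2)],
    ![(-1, .inl 3), (0, .inl 2), (-1, .inl 2)],
    ![(0, .inl 3), (0, .inl 2), (-1, .inl 3)],
    ![(0, .inr 1), (0, .inl 3), (-1, .inl 3)]]

/-- The face permutation of the infinite cover of the ring maps. -/
def coverFace (y : ℤ × Fin 8 × Fin 3) : ℤ × Fin 8 × Fin 3 :=
  (y.1 + (oppTable y.2.1 y.2.2).1, (oppTable y.2.1 y.2.2).2.1, (oppTable y.2.1 y.2.2).2.2 + 1)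

theorem face_place (j : ZMod m) (y : ℤ × Fin 8 × Fin 3) :
    (ringMap m hm).face (place j y) = place j (coverFace y) := by
  simp [CubicMap.face, ringMap, place, coverFace, add_assoc]

theorem eqvGen_iterate_face {V : Type} (M : CubicMap V) (n : ℕ) (x : V × Fin 3) :
    Relation.EqvGen (fun a b => M.face a = b) x (M.face^[n] x) := by
  induction n with
  | zero => exact Relation.EqvGen.refl _
  | succ n ih =>
    rw [Function.iterate_succ_apply']
    exact ih.trans _ _ _ (Relation.EqvGen.rel _ _ rfl)

/-- A dart on each bounded face. -/
def faceRep (z : ZMod m × Fin 4) : (ZMod m × Fin 8) × Fin 3 := ((z.1, ![0, 2, 4, 6] z.2), 0)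

/-- A dart in sector `0` on each outer face. -/
def capRep : Fin 2 → Fin 8 × Fin 3 := ![(0, 1), (7, 0)]

/-- The face on which a dart lies. -/
def faceLabel (x : (ZMod m × Fin 8) × Fin 3) : (ZMod m × Fin 4) ⊕ Fin 2 :=
  Sum.map (fun k => (x.1.1 + ((faceTable x.1.2 x.2).1 : ZMod m), k)) id (faceTable x.1.2 x.2).2

theorem faceLabel_faceRep (z : ZMod m × Fin 4) : faceLabel (faceRep z) = .inl z := by
  obtain ⟨j, k⟩ := z
  fin_cases k <;> simp [faceLabel, faceRep, faceTable]

theorem faceLabel_capRep (j : ZMod m) (c : Fin 2) :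
    faceLabel ((j, (capRep c).1), (capRep c).2) = .inr c := by
  fin_cases c <;> simp [faceLabel, capRep, faceTable]

theorem eqvGen_faceRep {x : (ZMod m × Fin 8) × Fin 3} {z : ZMod m × Fin 4}
    (h : faceLabel x = .inl z) :
    Relation.EqvGen (fun a b => (ringMap m hm).face a = b) (faceRep z) x := by
  obtain ⟨⟨j, t⟩, i⟩ := x
  obtain ⟨k, hk⟩ : ∃ k, (faceTable t i).2 = .inl k := by
    rcases hk : (faceTable t i).2 with k | c
    · exact ⟨k, rfl⟩
    · simp [faceLabel, hk] at h
  obtain ⟨n, -, hn⟩ := (by decide : ∀ t i k, (faceTable t i).2 = .inl k → ∃ n < 6,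
    coverFace^[n] ((faceTable t i).1, (![0, 2, 4, 6] : Fin 4 → Fin 8) k, 0) = (0, t, i)) t i k hk
  have hz : place j ((faceTable t i).1, (![0, 2, 4, 6] : Fin 4 → Fin 8) k, 0) = faceRep z := by
    simp only [faceLabel, hk, Sum.map_inl, Sum.inl.injEq] at h
    rw [← h]
    rfl
  have hx : place j (0, t, i) = ((j, t), i) := by simp [place]
  rw [← hz, ← hx, ← hn]
  have hs : Function.Semiconj (place j) coverFace (ringMap m hm).face :=
    fun y => (face_place hm j y).symm
  rw [(hs.iterate_right n).eq]
  exact eqvGen_iterate_face _ _ _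

theorem eqvGen_capRep [NeZero m] {x : (ZMod m × Fin 8) × Fin 3} {c : Fin 2}
    (h : faceLabel x = .inr c) :
    Relation.EqvGen (fun a b => (ringMap m hm).face a = b)
      ((0, (capRep c).1), (capRep c).2) x := by
  obtain ⟨⟨j, t⟩, i⟩ := x
  have hc : (faceTable t i).2 = .inr c := by
    rcases hk : (faceTable t i).2 with k | c'
    · simp [faceLabel, hk] at h
    · simpa [faceLabel, hk] using h
  obtain ⟨rfl, rfl⟩ := (by decide : ∀ t i c, (faceTable t i).2 = .inr c →
    (capRep c).1 = t ∧ (capRep c).2 = i) t i c hc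
  refine forall_zmod (p := fun j => Relation.EqvGen (fun a b => (ringMap m hm).face a = b)
    ((0, (capRep c).1), (capRep c).2) ((j, (capRep c).1), (capRep c).2)) 0
    (Relation.EqvGen.refl _) (fun j hj => hj.trans _ _ _ ?_) j
  fin_cases c
  · exact Relation.EqvGen.symm _ _ (Relation.EqvGen.rel _ _
      (by simp [CubicMap.face, ringMap, place, oppTable, capRep]))
  · exact Relation.EqvGen.rel _ _ (by
      simp [CubicMap.face, ringMap, place, oppTable, capRep])

theorem spherical_ringMap [NeZero m] : (ringMap m hm).Spherical := by
  refine ⟨(ZMod m × Fin 4) ⊕ Fin 2, inferInstance, faceLabel, ?_, ?_, ?_, ?_⟩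
  · rintro (z | c)
    · exact ⟨_, faceLabel_faceRep z⟩
    · exact ⟨_, faceLabel_capRep 0 c⟩
  · rintro ⟨⟨j, t⟩, i⟩
    obtain ⟨h1, h2⟩ := (by decide : ∀ t i,
      (faceTable (oppTable t i).2.1 ((oppTable t i).2.2 + 1)).2 = (faceTable t i).2 ∧
      ((faceTable t i).2.isLeft = true → (oppTable t i).1 +
        (faceTable (oppTable t i).2.1 ((oppTable t i).2.2 + 1)).1 = (faceTable t i).1)) t i
    simp only [faceLabel, CubicMap.face, ringMap, place, h1]
    rcases hk : (faceTable t i).2 with k | c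
    · have := h2 (by simp [hk])
      rw [← this]
      simp [add_assoc]
    · rfl
  · intro x y hxy
    rcases hz : faceLabel y with z | c
    · rw [hz] at hxy
      exact ((eqvGen_faceRep hm hxy).symm _ _).trans _ _ _ (eqvGen_faceRep hm hz)
    · rw [hz] at hxy
      exact ((eqvGen_capRep hm hxy).symm _ _).trans _ _ _ (eqvGen_capRep hm hz)
  · simp [ZMod.card]
    ring

/-- The dart weights of the ring maps. -/
def ringWeight (s : ℕ) (x : (ZMod m × Fin 8) × Fin 3) : ℕ :=
  dartSlope x.1.2 x.2 * s + dartOffset x.1.2 x.2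

/-- The darts of `S` in the sector `j`. -/
def bitsAt (S : (ZMod m × Fin 8) × Fin 3 → Bool) (j : ZMod m) (t : Fin 8) (i : Fin 3) : Bool :=
  S ((j, t), i)

theorem sum_sector (S : (ZMod m × Fin 8) × Fin 3 → Bool) (s : ℕ) (j : ZMod m) :
    (∑ t, ∑ i, if S ((j, t), i) then ringWeight s ((j, t), i) else 0) =
      total dartSlope (bitsAt S j) * s + total dartOffset (bitsAt S j) := by
  simp only [total, Finset.sum_mul, ← Finset.sum_add_distrib]
  refine Finset.sum_congr rfl fun t _ => Finset.sum_congr rfl fun i _ => ?_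
  change (if bitsAt S j t i then dartSlope t i * s + dartOffset t i else 0) = _
  split_ifs <;> simp

theorem bitsAt_succ {S : (ZMod m × Fin 8) × Fin 3 → Bool} (hS : (ringMap m hm).IsEvenSet S)
    (j : ZMod m) : bitsAt S (j + 1) = nextBits (bitsAt S j) (bitsAt S (j + 1) 0 2)
      (bitsAt S (j + 1) 2 2) (bitsAt S (j + 1) 4 2) (bitsAt S (j + 1) 6 2) := by
  have hp : ∀ t, bitsAt S (j + 1) t 0 = (bitsAt S (j + 1) t 1 ^^ bitsAt S (j + 1) t 2) := by
    intro t
    have := hS.2 (j + 1, t)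
    simpa [bitsAt] using this
  have hl : ∀ t i t' i', oppTable t i = (1, t', i') → bitsAt S (j + 1) t' i' = bitsAt S j t i := by
    intro t i t' i' h
    have := hS.1 ((j, t), i)
    simpa [bitsAt, ringMap, place, h] using this
  have hr : ∀ t i t' i', oppTable t i = (0, t', i') →
      bitsAt S (j + 1) t' i' = bitsAt S (j + 1) t i := by
    intro t i t' i' h
    have := hS.1 ((j + 1, t), i)
    simpa [bitsAt, ringMap, place, h] using this
  have l0 := hl 0 0 0 1 rfl
  have l1 := hl 2 0 1 2 rfl
  have l2 := hl 4 0 3 2 rfl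
  have l3 := hl 6 0 5 2 rfl
  have l4 := hl 7 0 7 2 rfl
  have r1 := hr 0 2 1 1 rfl
  have r2 := hr 1 0 2 1 rfl
  have r3 := hr 2 2 3 1 rfl
  have r4 := hr 3 0 4 1 rfl
  have r5 := hr 4 2 5 1 rfl
  have r6 := hr 5 0 6 1 rfl
  have r7 := hr 6 2 7 1 rfl
  funext t i
  fin_cases t <;> fin_cases i <;>
    simp [nextBits, sectorBits, hp, l0, l1, l2, l3, l4, r1, r2, r3, r4, r5, r6, r7, Bool.xor_comm]

theorem heavy_ringMap [NeZero m] {s : ℕ} (hs : 1 ≤ s) (hms : 2 * s + 6 ≤ m) :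
    (ringMap m hm).Heavy id (ringWeight s) (8 * s + 22) := by
  rintro S hS ⟨x₀, hx₀, -⟩
  rw [Fintype.sum_prod_type]
  simp only [sum_sector]
  have hnext := bitsAt_succ hm hS
  by_cases hgap : ∃ j, GapEmpty (bitsAt S j)
  · obtain ⟨j, hj, hne⟩ : ∃ j, GapEmpty (bitsAt S j) ∧ ∃ t i, bitsAt S (j + 1) t i = true := by
      by_contra! hcon
      obtain ⟨j₀, hj₀⟩ := hgap
      have hall : ∀ j, GapEmpty (bitsAt S j) := forall_zmod j₀ hj₀ fun j hj => by
        simp [GapEmpty, hcon j hj]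
      have := hcon (x₀.1.1 - 1) (hall _) x₀.1.2 x₀.2
      simp only [bitsAt, sub_add_cancel, Prod.mk.eta] at this
      exact this hx₀
    have h1 := hnext j
    have h2 := hnext (j + 1)
    have h3 := hnext (j + 1 + 1)
    have h0 : ∀ u v w z, nextBits (bitsAt S j) u v w z =
        sectorBits false false false false false u v w z := by
      intro u v w z
      simp only [GapEmpty, Bool.or_eq_false_iff] at hj
      simp [nextBits, hj]
    rw [h0] at h1
    have hthree : (total dartSlope (bitsAt S (j + 1)) * s + total dartOffset (bitsAt S (j + 1))) +
        (total dartSlope (bitsAt S (j + 1 + 1)) * s + total dartOffset (bitsAt S (j + 1 + 1))) +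
        (total dartSlope (bitsAt S (j + 1 + 1 + 1)) * s +
          total dartOffset (bitsAt S (j + 1 + 1 + 1))) ≤
        ∑ j, (total dartSlope (bitsAt S j) * s + total dartOffset (bitsAt S j)) := by
      have hinj : ∀ z : ℤ, z ≠ 0 → -2 ≤ z → z ≤ 2 → (z : ZMod m) ≠ 0 :=
        fun z => intCast_ne_zero hm
      have n1 : (1 : ZMod m) ≠ 0 := by simpa using hinj 1
      have n2 : (1 + 1 : ZMod m) ≠ 0 := by simpa [one_add_one_eq_two] using hinj 2
      have := Finset.sum_le_univ_sum_of_nonneg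
        (s := {j + 1, j + 1 + 1, j + 1 + 1 + 1})
        (f := fun j => total dartSlope (bitsAt S j) * s + total dartOffset (bitsAt S j))
        (fun _ => Nat.zero_le _)
      rw [Finset.sum_insert, Finset.sum_pair] at this
      · omega
      · simp [n1]
      · simp [n1, n2, add_assoc]
    refine le_trans ?_ hthree
    have hlarge : ∀ α β, Large α β → 8 * s + 22 ≤ α * s + β := by
      rintro α β ⟨hα, hβ⟩
      obtain ⟨γ, rfl⟩ := Nat.exists_eq_add_of_le hα
      have : γ ≤ γ * s := Nat.le_mul_of_pos_right _ hs
      linarith [add_mul 8 γ s]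
    have hwin := large_window (bitsAt S (j + 1) 0 2) (bitsAt S (j + 1) 2 2)
      (bitsAt S (j + 1) 4 2) (bitsAt S (j + 1) 6 2) (by
        by_contra hcon
        simp only [Bool.not_eq_true, Bool.or_eq_false_iff] at hcon
        obtain ⟨⟨⟨e1, e2⟩, e3⟩, e4⟩ := hcon
        rw [e1, e2, e3, e4] at h1
        obtain ⟨t, i, hti⟩ := hne
        rw [h1] at hti
        exact (by decide : ∀ t i, ¬ sectorBits false false false false false
          false false false false t i = true) t i hti)
    rw [← h1] at hwin
    rcases hwin with hw | hwin
    · have := hlarge _ _ hw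
      omega
    have hwin := hwin (bitsAt S (j + 1 + 1) 0 2) (bitsAt S (j + 1 + 1) 2 2)
      (bitsAt S (j + 1 + 1) 4 2) (bitsAt S (j + 1 + 1) 6 2)
    rw [← h2] at hwin
    rcases hwin with hw | hwin
    · have := hlarge _ _ hw
      rw [add_mul] at this
      omega
    have hw := hwin (bitsAt S (j + 1 + 1 + 1) 0 2) (bitsAt S (j + 1 + 1 + 1) 2 2)
      (bitsAt S (j + 1 + 1 + 1) 4 2) (bitsAt S (j + 1 + 1 + 1) 6 2)
    rw [← h3] at hw
    have := hlarge _ _ hw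
    rw [add_mul, add_mul] at this
    omega
  · push Not at hgap
    have hfour : ∀ j, 4 ≤ total dartSlope (bitsAt S j) * s + total dartOffset (bitsAt S j) := by
      intro j
      obtain ⟨k, rfl⟩ : ∃ k, j = k + 1 := ⟨j - 1, by simp⟩
      have h1 := hgap k
      have h2 := hgap (k + 1)
      rw [hnext] at h2
      simp only [GapEmpty, Bool.not_eq_false] at h1
      have := four_le_total _ _ _ _ _ _ _ _ _ h1 h2
      change 4 ≤ total dartSlope (nextBits _ _ _ _ _) + total dartOffset (nextBits _ _ _ _ _) at this
      rw [← hnext] at this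
      have h3 := Nat.le_mul_of_pos_right (total dartSlope (bitsAt S (k + 1))) hs
      omega
    have := Finset.sum_le_sum fun j (_ : j ∈ (Finset.univ : Finset (ZMod m))) => hfour j
    rw [Finset.sum_const, Finset.card_univ, ZMod.card, smul_eq_mul] at this
    omega

theorem expandable_ringWeight {s : ℕ} (hs : 1 ≤ s) (v : ZMod m × Fin 8) :
    CubicMap.Expandable (fun _ => 1 + s) (ringWeight s) v := by
  obtain ⟨s, rfl⟩ := Nat.exists_eq_add_of_le hs
  obtain ⟨j, t⟩ := v
  refine Or.inr ⟨fun i => (dartSlope t i * (1 + s) + dartOffset t i - 2) / 2, ?_, ?_⟩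
  · intro i
    fin_cases t <;> fin_cases i <;> simp [ringWeight, dartSlope, dartOffset] <;> omega
  · rw [Fin.sum_univ_three]
    fin_cases t <;> simp [dartSlope, dartOffset] <;> omega

end RingMap

/-- For every `k = 2 * s + 4` with `s ≥ 1` and every `m ≥ 2 * s + 6` there is a graph with the
required properties on `8 * m * (2 * s + 3)` vertices. -/
theorem exists_graph {s m : ℕ} (hs : 1 ≤ s) (hm : 2 * s + 6 ≤ m) :
    ∃ G : SimpleGraph (Fin (8 * m * (2 * s + 3))),
      IsThreeConnected G ∧ IsCubic G ∧ IsPlanar G ∧ CircumferenceAtLeast G (2 * s + 4) ∧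
      ∀ ℓ ∈ CycleLengths G, ¬(2 * s + 4 ≤ ℓ ∧ ℓ ≤ 2 * (2 * s + 4) + 2) := by
  classical
  have : NeZero m := ⟨by omega⟩
  have hm3 : 3 ≤ m := by omega
  obtain ⟨W, _, N, cls, hconn, hsph, hheavy, hcount⟩ :=
    (RingMap.heavy_ringMap hm3 hs hm).exists_expansion (RingMap.expandable_ringWeight hs)
      (RingMap.threeConnected_ringMap hm3) (RingMap.spherical_ringMap hm3)
  have hcard : Fintype.card W = 8 * m * (2 * s + 3) := by
    have := hcount fun _ => 1
    simp [ZMod.card] at this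
    rw [this]
    ring
  have hclass : ∀ p, {w | cls w = p}.ncard = 2 * s + 3 := by
    intro p
    have := hcount fun p' => if p' = p then 1 else 0
    simp at this
    rw [Set.ncard_eq_toFinset_card']
    simp [this]
    ring
  have hV : 3 < Fintype.card W := by
    rw [hcard]
    nlinarith
  have hsurj : ∀ p, ∃ w, cls w = p := by
    intro p
    have : {w | cls w = p}.Nonempty := by
      rw [← Set.ncard_pos, hclass]
      omega
    exact this
  let e : Fin (8 * m * (2 * s + 3)) ≃ W := (Fintype.equivFinOfCardEq hcard).symm
  refine ⟨N.graph e, hconn.isThreeConnected_graph e hV, N.isCubic_graph e,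
    ⟨hconn.connected_graph e hV, N.embedding e, N.isSpherical_embedding e hsph⟩, ?_, ?_⟩
  · obtain ⟨v, hv⟩ := hsurj (0, 0)
    obtain ⟨w, hw⟩ := hsurj (0, 1)
    obtain ⟨u, c, hc, hlen⟩ := hheavy.exists_isCycle e hconn hV ⟨v, w, by simp [hv, hw]⟩
    exact ⟨_, ⟨u, c, hc, rfl⟩, by omega⟩
  · rintro _ ⟨u, c, hc, rfl⟩ ⟨h1, h2⟩
    rcases hheavy.length_le_or_le_length e (fun p => (hclass p).le) hc with h | h <;> omega

/-- For every even integer `k ≥ 6` there is an infinite family of pairwise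
non-isomorphic 3-connected cubic planar graphs of circumference at least `k`
whose cycle spectrum contains no element of `[k, 2k+2]`. -/
theorem statement0 (k : ℕ) (hk : Even k) (hk6 : 6 ≤ k) :
    ∃ Gs : ℕ → Σ m : ℕ, SimpleGraph (Fin m),
      (∀ i j : ℕ, i ≠ j → IsEmpty ((Gs i).2 ≃g (Gs j).2)) ∧
      ∀ i : ℕ,
        IsThreeConnected (Gs i).2 ∧ IsCubic (Gs i).2 ∧ IsPlanar (Gs i).2 ∧
        CircumferenceAtLeast (Gs i).2 k ∧
        ∀ ℓ ∈ CycleLengths (Gs i).2, ¬(k ≤ ℓ ∧ ℓ ≤ 2 * k + 2) := by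
  obtain ⟨s, hs, rfl⟩ : ∃ s, 1 ≤ s ∧ k = 2 * s + 4 := by
    obtain ⟨r, rfl⟩ := hk
    exact ⟨r - 2, by omega, by omega⟩
  choose G hG using fun i : ℕ => exists_graph (m := 2 * s + 6 + i) hs (by omega)
  refine ⟨fun i => ⟨_, G i⟩, fun i j hij => ⟨fun φ => hij ?_⟩, hG⟩
  have h1 := Fintype.card_congr φ.toEquiv
  simp only [Fintype.card_fin] at h1
  have h2 := Nat.eq_of_mul_eq_mul_right (by omega) h1
  omega
end

section
/- For every even integer k ≥ 6, there exists a 3-connected cubic planar graph G of circumference at least k such that G contains no cycle whose length ℓ satisfies k ≤ ℓ ≤ 2k+2. In particular, Merker's conjecture — that every 3-connected cubic planar graph of circumference at least k has a cycle of length in [k, 2k+2] — is false for every even k ≥ 6. -/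
open SimpleGraph

section Transfer

variable {V U : Type*} {G : SimpleGraph V} {G' : SimpleGraph U}

theorem cycleLengths_subset_of_iso (φ : G ≃g G') : CycleLengths G ⊆ CycleLengths G' := by
  rintro n ⟨v, w, hw, rfl⟩
  exact ⟨φ v, w.map φ.toHom, (Walk.isCycle_map_iff_of_injective φ.injective).2 hw, by simp⟩

theorem cycleLengths_eq_of_iso (φ : G ≃g G') : CycleLengths G = CycleLengths G' :=
  (cycleLengths_subset_of_iso φ).antisymm (cycleLengths_subset_of_iso φ.symm)

/-- The bijection between darts induced by a graph isomorphism. -/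
def dartCongr (φ : G ≃g G') : G.Dart ≃ G'.Dart where
  toFun d := ⟨(φ d.fst, φ d.snd), φ.map_rel_iff.2 d.adj⟩
  invFun d := ⟨(φ.symm d.fst, φ.symm d.snd), φ.symm.map_rel_iff.2 d.adj⟩
  left_inv d := by ext <;> simp
  right_inv d := by ext <;> simp

theorem IsCubic.of_iso (φ : G ≃g G') (h : IsCubic G) : IsCubic G' := by
  intro v
  rw [← h (φ.symm v), ← Set.ncard_image_of_injective _ φ.injective]
  congr 1
  ext u
  simp only [Set.mem_image, mem_neighborSet]
  constructor
  · exact fun hu => ⟨φ.symm u, φ.symm.map_rel_iff.2 hu, by simp⟩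
  · rintro ⟨u, hu, rfl⟩
    simpa using φ.map_rel_iff.2 hu

theorem IsThreeConnected.of_iso (φ : G ≃g G') (h : IsThreeConnected G) :
    IsThreeConnected G' := by
  refine ⟨?_, fun s hs hcard => ?_⟩
  · have := h.1
    rwa [Set.ncard_univ, Nat.card_congr φ.toEquiv, ← Set.ncard_univ] at this
  · have hs' : φ ⁻¹' s = φ.symm '' s := by
      ext x
      simp only [Set.mem_preimage, Set.mem_image]
      exact ⟨fun hx => ⟨_, hx, by simp⟩, by rintro ⟨y, hy, rfl⟩; simpa using hy⟩
    have hc := h.2 (φ ⁻¹' s) (hs' ▸ hs.image _)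
      (by rwa [hs', Set.ncard_image_of_injective _ φ.symm.injective])
    let ψ : G.induce (φ ⁻¹' s)ᶜ ≃g G'.induce sᶜ :=
      { toEquiv := φ.toEquiv.subtypeEquiv (fun a => Iff.rfl)
        map_rel_iff' := φ.map_rel_iff }
    exact ψ.connected_iff.1 hc

theorem IsPlanar.of_iso (φ : G ≃g G') (h : IsPlanar G) : IsPlanar G' := by
  obtain ⟨hc, E, hE⟩ := h
  refine ⟨φ.connected_iff.1 hc, ?_⟩
  set δ := dartCongr φ with hδ
  have hpow : ∀ (f : Equiv.Perm G.Dart) (n : ℤ) (d : G.Dart),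
      (δ.permCongr f ^ n) (δ d) = δ ((f ^ n) d) := by
    intro f n d
    have : δ.permCongr f ^ n = δ.permCongr (f ^ n) :=
      (map_zpow δ.permCongrHom f n).symm
    rw [this]
    simp
  let E' : PlaneEmbedding G' :=
    { rot := δ.permCongr E.rot
      rot_tail := by
        intro d
        obtain ⟨d, rfl⟩ := δ.surjective d
        have := E.rot_tail d
        simp only [Equiv.permCongr_apply, Equiv.symm_apply_apply]
        exact congrArg φ this
      rot_orbit := by
        intro d e hde
        obtain ⟨d, rfl⟩ := δ.surjective d
        obtain ⟨e, rfl⟩ := δ.surjective e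
        obtain ⟨n, hn⟩ := E.rot_orbit d e (φ.injective hde)
        refine ⟨n, ?_⟩
        have := hpow E.rot n d
        rw [zpow_natCast, zpow_natCast, hn] at this
        exact this }
  have hface : E'.facePerm = δ.permCongr E.facePerm := by
    ext1 d
    obtain ⟨d, rfl⟩ := δ.surjective d
    simp only [PlaneEmbedding.facePerm, Equiv.permCongr_apply, Equiv.symm_apply_apply,
      Equiv.trans_apply, E']
    rw [show (dartReversal G') (δ d) = δ (dartReversal G d) from rfl, Equiv.symm_apply_apply]
  have hof : ∀ d, E'.faceOf (δ d) = δ '' E.faceOf d := by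
    intro d
    ext e
    obtain ⟨e, rfl⟩ := δ.surjective e
    simp only [PlaneEmbedding.faceOf, Set.mem_ofPred_eq, hface, hpow, δ.injective.mem_set_image,
      δ.injective.eq_iff]
  have hfaces : E'.faces = (fun s => δ '' s) '' E.faces := by
    ext s
    simp only [PlaneEmbedding.faces, Set.mem_ofPred_eq, Set.mem_image]
    constructor
    · rintro ⟨d, rfl⟩
      obtain ⟨d, rfl⟩ := δ.surjective d
      exact ⟨_, ⟨d, rfl⟩, (hof d).symm⟩
    · rintro ⟨_, ⟨d, rfl⟩, rfl⟩
      exact ⟨δ d, (hof d).symm⟩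
  refine ⟨E', ?_⟩
  unfold PlaneEmbedding.IsSpherical at hE ⊢
  have hv : (Set.univ : Set U).ncard = (Set.univ : Set V).ncard := by
    rw [Set.ncard_univ, Set.ncard_univ, Nat.card_congr φ.toEquiv]
  have he : G'.edgeSet.ncard = G.edgeSet.ncard := (Nat.card_congr φ.mapEdgeSet).symm
  rw [hv, he, hfaces, Set.ncard_image_of_injective _ δ.injective.image_injective, hE]

end Transfer

section PlanarCriterion

open Relation

/-- A connected graph whose darts are modelled by a type `X` with a reversal and a rotation of
order three is planar as soon as the faces, enumerated by `L`, satisfy Euler's formula. -/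
theorem isPlanar_of_darts {V X L : Type*} [Finite V] [Finite X] {G : SimpleGraph V}
    (hG : G.Connected)
    (tail : X → V) (rev rot : X → X) (rev_rev : ∀ a, rev (rev a) = a)
    (rot_rot_rot : ∀ a, rot (rot (rot a)) = a) (tail_rot : ∀ a, tail (rot a) = tail a)
    (adj_iff : ∀ u v, G.Adj u v ↔ ∃ a, tail a = u ∧ tail (rev a) = v)
    (dart_inj : ∀ a b, tail a = tail b → tail (rev a) = tail (rev b) → a = b)
    (orbit : ∀ a b, tail a = tail b → b = a ∨ b = rot a ∨ b = rot (rot a))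
    (label : X → L) (canon : L → X) (label_face : ∀ a, label (rot (rev a)) = label a)
    (label_canon : ∀ l, label (canon l) = l)
    (reach : ∀ a, ReflTransGen (fun a b => rot (rev a) = b) a (canon (label a)))
    (euler : 2 * (Nat.card V + Nat.card L) = Nat.card X + 4) : IsPlanar G := by
  classical
  let δ : X ≃ G.Dart := Equiv.ofBijective
    (fun a => ⟨(tail a, tail (rev a)), (adj_iff _ _).2 ⟨a, rfl, rfl⟩⟩) (by
      constructor
      · intro a b hab
        have h := congrArg Dart.toProd hab
        exact dart_inj a b (congrArg Prod.fst h) (congrArg Prod.snd h)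
      · intro d
        obtain ⟨a, h1, h2⟩ := (adj_iff _ _).1 d.adj
        exact ⟨a, Dart.ext _ _ (Prod.ext h1 h2)⟩)
  have hδ1 : ∀ a, (δ a).toProd.1 = tail a := fun a => rfl
  have hδsymm : ∀ a, (δ a).symm = δ (rev a) := by
    intro a
    refine Dart.ext _ _ (Prod.ext rfl ?_)
    change tail a = tail (rev (rev a))
    rw [rev_rev]
  let σ : Equiv.Perm X := ⟨rot, fun a => rot (rot a), rot_rot_rot, rot_rot_rot⟩
  let E : PlaneEmbedding G :=
    { rot := δ.permCongr σ
      rot_tail := by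
        intro d
        obtain ⟨a, rfl⟩ := δ.surjective d
        simp only [Equiv.permCongr_apply, Equiv.symm_apply_apply]
        exact tail_rot a
      rot_orbit := by
        intro d e hde
        obtain ⟨a, rfl⟩ := δ.surjective d
        obtain ⟨b, rfl⟩ := δ.surjective e
        have h1 : ∀ c, δ.permCongr σ (δ c) = δ (rot c) := by
          intro c
          simp [Equiv.permCongr_apply, σ]
        rcases orbit a b hde with rfl | rfl | rfl
        · exact ⟨0, rfl⟩
        · exact ⟨1, by rw [pow_one, h1]⟩
        · exact ⟨2, by rw [pow_two, Equiv.Perm.mul_apply, h1, h1]⟩ }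
  have hface : ∀ a, E.facePerm (δ a) = δ (rot (rev a)) := by
    intro a
    change E.rot ((δ a).symm) = _
    rw [hδsymm]
    simp [E, Equiv.permCongr_apply, σ]
  have hlab : ∀ a b, δ b ∈ E.faceOf (δ a) → label b = label a := by
    have hnat : ∀ (n : ℕ) a b, (E.facePerm ^ n) (δ a) = δ b → label b = label a := by
      intro n
      induction n with
      | zero =>
        intro a b h
        rw [δ.injective h]
      | succ n ih =>
        intro a b h
        rw [pow_succ, Equiv.Perm.mul_apply, hface] at h
        rw [ih _ _ h, label_face]
    rintro a b ⟨n, hn⟩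
    obtain ⟨n, rfl | rfl⟩ := n.eq_nat_or_neg
    · exact hnat n a b (by simpa using hn)
    · refine (hnat n b a ?_).symm
      rw [← hn, zpow_neg, zpow_natCast, ← Equiv.Perm.mul_apply, mul_inv_cancel, Equiv.Perm.one_apply]
  have hsame : ∀ a b, E.facePerm (δ a) = δ b → E.faceOf (δ a) = E.faceOf (δ b) := by
    intro a b h
    ext e
    constructor
    · rintro ⟨n, hn⟩
      refine ⟨n - 1, ?_⟩
      rw [← h, ← hn, ← Equiv.Perm.mul_apply, ← zpow_add_one, sub_add_cancel]
    · rintro ⟨n, hn⟩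
      refine ⟨n + 1, ?_⟩
      rw [zpow_add_one, Equiv.Perm.mul_apply, h, hn]
  have hcanon : ∀ a, E.faceOf (δ a) = E.faceOf (δ (canon (label a))) := by
    intro a
    have h := reach a
    generalize canon (label a) = c at h ⊢
    induction h with
    | refl => rfl
    | tail _ hbc ih => exact ih.trans (hsame _ _ (by rw [hface, hbc]))
  have hfaces : E.faces = Set.range (fun l => E.faceOf (δ (canon l))) := by
    ext s
    constructor
    · rintro ⟨d, rfl⟩
      obtain ⟨a, rfl⟩ := δ.surjective d
      exact ⟨label a, (hcanon a).symm⟩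
    · rintro ⟨l, rfl⟩
      exact ⟨_, rfl⟩
  have hinj : Function.Injective (fun l => E.faceOf (δ (canon l))) := by
    intro l l' h
    have : δ (canon l) ∈ E.faceOf (δ (canon l')) := by
      rw [← show E.faceOf (δ (canon l)) = E.faceOf (δ (canon l')) from h]
      exact ⟨0, rfl⟩
    have := hlab _ _ this
    rwa [label_canon, label_canon] at this
  have hF : E.faces.ncard = Nat.card L := by
    rw [hfaces, ← Set.image_univ, Set.ncard_image_of_injective _ hinj, Set.ncard_univ]
  have hD : Nat.card X = 2 * G.edgeSet.ncard := by
    have := Fintype.ofFinite V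
    rw [Nat.card_congr δ, Nat.card_eq_fintype_card, G.dart_card_eq_twice_card_edges,
      ← coe_edgeFinset, Set.ncard_coe_finset]
  refine ⟨hG, E, ?_⟩
  unfold PlaneEmbedding.IsSpherical
  rw [hF, Set.ncard_univ]
  omega

end PlanarCriterion

section Inflation

open Relation

/-- The three directions in which one can leave a vertex of an inflated map. -/
inductive Direction
  | fwd
  | bwd
  | cross
  deriving DecidableEq

instance : Fintype Direction := ⟨{.fwd, .bwd, .cross}, by rintro (_ | _ | _) <;> simp⟩

/-- A loopless cubic map without multiple edges on the vertex set `W`: the darts at `w` are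
`(w, 0)`, `(w, 1)`, `(w, 2)` in counterclockwise order, and `opp` reverses darts. -/
structure CubicMap_s1 (W : Type) where
  opp : W × Fin 3 → W × Fin 3
  opp_opp : ∀ d, opp (opp d) = d
  opp_fst_ne : ∀ d, (opp d).1 ≠ d.1
  opp_fst_inj : ∀ w i j, (opp (w, i)).1 = (opp (w, j)).1 → i = j

variable {W : Type}

/-- The next dart at the same vertex. -/
def rotl (d : W × Fin 3) : W × Fin 3 := (d.1, d.2 + 1)

/-- The previous dart at the same vertex. -/
def rotr (d : W × Fin 3) : W × Fin 3 := (d.1, d.2 + 2)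

@[simp] theorem rotl_fst (d : W × Fin 3) : (rotl d).1 = d.1 := rfl

@[simp] theorem rotr_fst (d : W × Fin 3) : (rotr d).1 = d.1 := rfl

@[simp] theorem rotl_rotr (d : W × Fin 3) : rotl (rotr d) = d :=
  Prod.ext rfl ((by decide : ∀ i : Fin 3, i + 2 + 1 = i) d.2)

@[simp] theorem rotr_rotl (d : W × Fin 3) : rotr (rotl d) = d :=
  Prod.ext rfl ((by decide : ∀ i : Fin 3, i + 1 + 2 = i) d.2)

theorem rotl_ne (d : W × Fin 3) : rotl d ≠ d := fun h =>
  (by decide : ∀ i : Fin 3, i + 1 ≠ i) d.2 (congrArg Prod.snd h)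

theorem rotr_ne (d : W × Fin 3) : rotr d ≠ d := fun h =>
  (by decide : ∀ i : Fin 3, i + 2 ≠ i) d.2 (congrArg Prod.snd h)

theorem rotl_ne_rotr (d : W × Fin 3) : rotl d ≠ rotr d := fun h =>
  (by decide : ∀ i : Fin 3, i + 1 ≠ i + 2) d.2 (congrArg Prod.snd h)

/-- Vertices of the inflation of a cubic map: every dart `d` becomes the tip (position `0`) of a
ladder with `x d` rungs, the `j`-th rung joining the positions `j` and `-j`. -/
@[ext] structure InflVert (x : W × Fin 3 → ℕ) where
  dart : W × Fin 3
  pos : ℤ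
  lo : -(x dart : ℤ) ≤ pos
  hi : pos ≤ x dart

namespace InflVert

variable {x : W × Fin 3 → ℕ}

/-- The tip of the ladder of a dart. -/
def tip (x : W × Fin 3 → ℕ) (d : W × Fin 3) : InflVert x := ⟨d, 0, by simp, by simp⟩

/-- The next vertex on the boundary cycle of the inflated vertex. -/
def next (v : InflVert x) : InflVert x :=
  if h : v.pos < x v.dart then ⟨v.dart, v.pos + 1, by have := v.lo; omega, by omega⟩
  else ⟨rotl v.dart, -x (rotl v.dart), le_rfl, by omega⟩

/-- The previous vertex on the boundary cycle of the inflated vertex. -/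
def prev (v : InflVert x) : InflVert x :=
  if h : -(x v.dart : ℤ) < v.pos then ⟨v.dart, v.pos - 1, by omega, by have := v.hi; omega⟩
  else ⟨rotr v.dart, x (rotr v.dart), by omega, le_rfl⟩

/-- The third neighbour of a vertex: the other end of its rung, or the opposite tip. -/
def mate (M : CubicMap_s1 W) (v : InflVert x) : InflVert x :=
  if v.pos = 0 then tip x (M.opp v.dart)
  else ⟨v.dart, -v.pos, by have := v.hi; omega, by have := v.lo; omega⟩

theorem next_of_lt (v : InflVert x) (h : v.pos < x v.dart) :
    v.next.dart = v.dart ∧ v.next.pos = v.pos + 1 := by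
  simp [next, h]

theorem next_of_not_lt (v : InflVert x) (h : ¬ v.pos < x v.dart) :
    v.next.dart = rotl v.dart ∧ v.next.pos = -x (rotl v.dart) := by
  simp [next, h]

theorem prev_of_lt (v : InflVert x) (h : -(x v.dart : ℤ) < v.pos) :
    v.prev.dart = v.dart ∧ v.prev.pos = v.pos - 1 := by
  simp [prev, h]

theorem prev_of_not_lt (v : InflVert x) (h : ¬ -(x v.dart : ℤ) < v.pos) :
    v.prev.dart = rotr v.dart ∧ v.prev.pos = x (rotr v.dart) := by
  simp [prev, h]

theorem mate_of_zero (M : CubicMap_s1 W) (v : InflVert x) (h : v.pos = 0) :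
    (v.mate M).dart = M.opp v.dart ∧ (v.mate M).pos = 0 := by
  simp [mate, h, tip]

theorem mate_of_ne (M : CubicMap_s1 W) (v : InflVert x) (h : v.pos ≠ 0) :
    (v.mate M).dart = v.dart ∧ (v.mate M).pos = -v.pos := by
  simp [mate, h]

theorem prev_next (v : InflVert x) : v.next.prev = v := by
  by_cases h : v.pos < x v.dart
  · obtain ⟨h1, h2⟩ := v.next_of_lt h
    obtain ⟨h3, h4⟩ := v.next.prev_of_lt (by rw [h1, h2]; have := v.lo; omega)
    exact InflVert.ext (h3.trans h1) (by omega)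
  · obtain ⟨h1, h2⟩ := v.next_of_not_lt h
    obtain ⟨h3, h4⟩ := v.next.prev_of_not_lt (by rw [h1, h2]; omega)
    rw [h1, rotr_rotl] at h3 h4
    exact InflVert.ext h3 (by have := v.hi; omega)

theorem next_prev (v : InflVert x) : v.prev.next = v := by
  by_cases h : -(x v.dart : ℤ) < v.pos
  · obtain ⟨h1, h2⟩ := v.prev_of_lt h
    obtain ⟨h3, h4⟩ := v.prev.next_of_lt (by rw [h1, h2]; have := v.hi; omega)
    exact InflVert.ext (h3.trans h1) (by omega)
  · obtain ⟨h1, h2⟩ := v.prev_of_not_lt h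
    obtain ⟨h3, h4⟩ := v.prev.next_of_not_lt (by rw [h1, h2]; omega)
    rw [h1, rotl_rotr] at h3 h4
    exact InflVert.ext h3 (by have := v.lo; omega)

theorem mate_mate (M : CubicMap_s1 W) (v : InflVert x) : (v.mate M).mate M = v := by
  by_cases h : v.pos = 0
  · obtain ⟨h1, h2⟩ := v.mate_of_zero M h
    obtain ⟨h3, h4⟩ := (v.mate M).mate_of_zero M h2
    rw [h1, M.opp_opp] at h3
    exact InflVert.ext h3 (by omega)
  · obtain ⟨h1, h2⟩ := v.mate_of_ne M h
    obtain ⟨h3, h4⟩ := (v.mate M).mate_of_ne M (by omega)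
    exact InflVert.ext (h3.trans h1) (by omega)

theorem next_fst (v : InflVert x) : v.next.dart.1 = v.dart.1 := by
  by_cases h : v.pos < x v.dart
  · rw [(v.next_of_lt h).1]
  · rw [(v.next_of_not_lt h).1, rotl_fst]

theorem prev_fst (v : InflVert x) : v.prev.dart.1 = v.dart.1 := by
  rw [← v.prev.next_fst, next_prev]

theorem next_ne (v : InflVert x) : v.next ≠ v := by
  intro he
  by_cases h : v.pos < x v.dart
  · have := (v.next_of_lt h).2
    rw [he] at this
    omega
  · have := (v.next_of_not_lt h).1
    rw [he] at this
    exact rotl_ne _ this.symm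

theorem next_ne_prev (v : InflVert x) : v.next ≠ v.prev := by
  intro he
  by_cases h : v.pos < x v.dart
  · by_cases h' : -(x v.dart : ℤ) < v.pos
    · have h1 := (v.next_of_lt h).2
      have h2 := (v.prev_of_lt h').2
      rw [he] at h1
      omega
    · have h1 := (v.next_of_lt h).1
      have h2 := (v.prev_of_not_lt h').1
      rw [he, h2] at h1
      exact rotr_ne _ h1
  · have h1 := (v.next_of_not_lt h).1
    by_cases h' : -(x v.dart : ℤ) < v.pos
    · have h2 := (v.prev_of_lt h').1
      rw [he, h2] at h1
      exact rotl_ne _ h1.symm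
    · have h2 := (v.prev_of_not_lt h').1
      rw [he, h2] at h1
      exact rotl_ne_rotr _ h1.symm

theorem next_ne_mate (M : CubicMap_s1 W) (v : InflVert x) : v.next ≠ v.mate M := by
  intro he
  by_cases h0 : v.pos = 0
  · have h1 := v.next_fst
    rw [he, (v.mate_of_zero M h0).1] at h1
    exact M.opp_fst_ne _ h1
  · obtain ⟨h1, h2⟩ := v.mate_of_ne M h0
    by_cases h : v.pos < x v.dart
    · have h3 := (v.next_of_lt h).2
      rw [he] at h3
      omega
    · have h3 := (v.next_of_not_lt h).1
      rw [he, h1] at h3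
      exact rotl_ne _ h3.symm

theorem prev_ne_mate (M : CubicMap_s1 W) (v : InflVert x) : v.prev ≠ v.mate M := by
  intro he
  have h : (v.mate M).next = v := by rw [← he, next_prev]
  apply (v.mate M).next_ne_mate M
  rw [h, mate_mate]

theorem mate_ne (M : CubicMap_s1 W) (v : InflVert x) : v.mate M ≠ v := by
  intro he
  by_cases h0 : v.pos = 0
  · have := (v.mate_of_zero M h0).1
    rw [he] at this
    exact M.opp_fst_ne v.dart (by rw [← this])
  · have := (v.mate_of_ne M h0).2
    rw [he] at this
    omega

/-- The vertex reached from `v` in a given direction. -/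
def step (M : CubicMap_s1 W) (v : InflVert x) : Direction → InflVert x
  | .fwd => v.next
  | .bwd => v.prev
  | .cross => v.mate M

theorem step_injective (M : CubicMap_s1 W) (v : InflVert x) : Function.Injective (v.step M) := by
  intro a b h
  have h1 := v.next_ne_prev
  have h2 := v.next_ne_mate M
  have h3 := v.prev_ne_mate M
  cases a <;> cases b <;> first | rfl | exact absurd h (by assumption) |
    exact absurd h.symm (by assumption)

/-- Reversal of the direction under a step. -/
def revDir : Direction → Direction
  | .fwd => .bwd
  | .bwd => .fwd
  | .cross => .cross

theorem step_step (M : CubicMap_s1 W) (v : InflVert x) (a : Direction) :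
    (v.step M a).step M (revDir a) = v := by
  cases a
  · exact v.prev_next
  · exact v.next_prev
  · exact v.mate_mate M

theorem step_ne (M : CubicMap_s1 W) (v : InflVert x) (a : Direction) : v.step M a ≠ v := by
  cases a
  · exact v.next_ne
  · exact fun h => v.prev.next_ne (v.next_prev.trans h.symm)
  · exact v.mate_ne M

end InflVert

open InflVert

/-- The inflation of a cubic map: every vertex is replaced by a cycle with nested chords. -/
def inflation (M : CubicMap_s1 W) (x : W × Fin 3 → ℕ) : SimpleGraph (InflVert x) where
  Adj u v := ∃ a, u.step M a = v
  symm := ⟨by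
    rintro u v ⟨a, rfl⟩
    exact ⟨revDir a, u.step_step M a⟩⟩
  loopless := ⟨by
    rintro u ⟨a, h⟩
    exact u.step_ne M a h⟩

variable (M : CubicMap_s1 W) (x : W × Fin 3 → ℕ)

theorem inflation_adj_next (v : InflVert x) : (inflation M x).Adj v v.next := ⟨.fwd, rfl⟩

theorem inflation_adj_mate (v : InflVert x) : (inflation M x).Adj v (v.mate M) := ⟨.cross, rfl⟩

theorem inflation_isCubic : IsCubic (inflation M x) := by
  intro v
  have : (inflation M x).neighborSet v = Set.range (v.step M) := by
    ext u
    rfl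
  rw [this, ← Set.image_univ, Set.ncard_image_of_injective _ (v.step_injective M),
    Set.ncard_univ, Nat.card_eq_fintype_card]
  rfl

instance [Finite W] : Finite (InflVert x) := by
  have := Fintype.ofFinite W
  let f : InflVert x → Σ d : W × Fin 3, Finset.Icc (-(x d : ℤ)) (x d) :=
    fun v => ⟨v.dart, v.pos, Finset.mem_Icc.2 ⟨v.lo, v.hi⟩⟩
  refine Finite.of_injective f ?_
  rintro ⟨d, p, _, _⟩ ⟨d', p', _, _⟩ h
  simp only [f, Sigma.mk.injEq] at h
  obtain ⟨rfl, h⟩ := h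
  simp only [heq_eq_eq, Subtype.mk.injEq] at h
  subst h
  rfl

/-- The rungs of an inflation, represented by their ends at positive positions. -/
abbrev Rung : Type := {v : InflVert x // 0 < v.pos}

theorem card_inflVert (M : CubicMap_s1 W) [Finite W] :
    Nat.card (InflVert x) = 2 * Nat.card (Rung x) + 3 * Nat.card W := by
  let f : (Rung x ⊕ Rung x) ⊕ (W × Fin 3) → InflVert x :=
    Sum.elim (Sum.elim (fun v => v.1) (fun v => v.1.mate M)) (tip x)
  have hm : ∀ v : Rung x, (v.1.mate M).pos < 0 := fun v => by
    have := (v.1.mate_of_ne M v.2.ne').2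
    have := v.2
    omega
  have hf : Function.Bijective f := by
    constructor
    · have ht : ∀ d, (tip x d).pos = 0 := fun d => rfl
      rintro ((a | a) | a) ((b | b) | b) h <;> simp only [f, Sum.elim_inl, Sum.elim_inr] at h
      · rw [Subtype.ext h]
      · have h1 := a.2
        have h2 := hm b
        rw [h] at h1
        omega
      · have h1 := a.2
        have h2 := ht b
        rw [h] at h1
        omega
      · have h1 := b.2
        have h2 := hm a
        rw [h] at h2
        omega
      · rw [Subtype.ext (by rw [← a.1.mate_mate M, h, mate_mate] : a.1 = b.1)]
      · have h1 := hm a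
        have h2 := ht b
        rw [h] at h1
        omega
      · have h1 := b.2
        have h2 := ht a
        rw [h] at h2
        omega
      · have h1 := hm b
        have h2 := ht a
        rw [h] at h2
        omega
      · rw [show a = b from congrArg InflVert.dart h]
    · intro v
      rcases lt_trichotomy v.pos 0 with h | h | h
      · exact ⟨.inl (.inr ⟨v.mate M, by have := (v.mate_of_ne M h.ne).2; omega⟩), v.mate_mate M⟩
      · exact ⟨.inr v.dart, InflVert.ext rfl h.symm⟩
      · exact ⟨.inl (.inl ⟨v, h⟩), rfl⟩
  rw [← Nat.card_congr (Equiv.ofBijective f hf), Nat.card_sum, Nat.card_sum, Nat.card_prod,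
    Nat.card_fin]
  ring

end Inflation

section InflationPlanar

open Relation InflVert

variable {W : Type} (M : CubicMap_s1 W) (x : W × Fin 3 → ℕ)

/-- Reversal of darts of an inflation. -/
def inflRev (a : InflVert x × Direction) : InflVert x × Direction :=
  (a.1.step M a.2, revDir a.2)

variable {x} in
/-- The rotation of darts of an inflation; chords of the boundary cycles are drawn inside. -/
def inflRot (a : InflVert x × Direction) : InflVert x × Direction :=
  (a.1, if a.1.pos = 0 then
      match a.2 with
      | .fwd => .bwd
      | .bwd => .cross
      | .cross => .fwd
    else
      match a.2 with
      | .fwd => .cross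
      | .cross => .bwd
      | .bwd => .fwd)

variable {x} in
/-- The faces of an inflation: one for every rung, one inside every inflated vertex, and one for
every face (in `F`) of the original map. -/
def inflLabel {F : Type} (lab : W × Fin 3 → F) (a : InflVert x × Direction) : Rung x ⊕ W ⊕ F :=
  match a.2 with
  | .fwd => .inr (.inr (if 0 ≤ a.1.pos then lab a.1.dart else lab (M.opp a.1.dart)))
  | .bwd =>
    if h : 0 < a.1.pos then .inl ⟨a.1, h⟩
    else if h' : -(x a.1.dart : ℤ) < a.1.pos then
      .inl ⟨⟨a.1.dart, 1 - a.1.pos, by omega, by omega⟩, by dsimp only; omega⟩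
    else .inr (.inl a.1.dart.1)
  | .cross =>
    if h : a.1.pos = 0 then .inr (.inr (lab (M.opp a.1.dart)))
    else if h' : a.1.pos < 0 then
      .inl ⟨⟨a.1.dart, -a.1.pos, by omega, by have := a.1.lo; omega⟩, by dsimp only; omega⟩
    else if h'' : a.1.pos < x a.1.dart then
      .inl ⟨⟨a.1.dart, a.1.pos + 1, by omega, by omega⟩, by dsimp only; omega⟩
    else .inr (.inl a.1.dart.1)

/-- A representative dart of every face of an inflation. -/
def inflCanon {F : Type} (cn : F → W × Fin 3) : Rung x ⊕ W ⊕ F → InflVert x × Direction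
  | .inl v => (v.1, .bwd)
  | .inr (.inl w) => (⟨(w, 0), -x (w, 0), le_rfl, by omega⟩, .bwd)
  | .inr (.inr f) => (tip x (cn f), .fwd)

theorem inflRot_inflRev_fwd (v : InflVert x) :
    inflRot (inflRev M x (v, .fwd)) = (v.next, if v.next.pos = 0 then .cross else .fwd) := rfl

theorem inflRot_inflRev_bwd (v : InflVert x) :
    inflRot (inflRev M x (v, .bwd)) = (v.prev, if v.prev.pos = 0 then .bwd else .cross) := rfl

theorem inflRot_inflRev_cross (v : InflVert x) :
    inflRot (inflRev M x (v, .cross)) =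
      (v.mate M, if (v.mate M).pos = 0 then .fwd else .bwd) := rfl

theorem inflLabel_inflRot_inflRev {F : Type} (lab : W × Fin 3 → F)
    (lab_face : ∀ d, lab (M.opp (rotl d)) = lab d) (a : InflVert x × Direction) :
    inflLabel M lab (inflRot (inflRev M x a)) = inflLabel M lab a := by
  obtain ⟨v, _ | _ | _⟩ := a
  · rw [inflRot_inflRev_fwd]
    have hlo := v.lo
    by_cases h : v.pos < x v.dart
    · obtain ⟨h1, h2⟩ := v.next_of_lt h
      by_cases h0 : v.next.pos = 0
      · have : ¬ 0 ≤ v.pos := by omega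
        simp [inflLabel, h0, h1, this]
      · by_cases h3 : 0 ≤ v.pos
        · have : 0 ≤ v.next.pos := by omega
          simp [inflLabel, h0, h1, this, h3]
        · have : ¬ 0 ≤ v.next.pos := by omega
          simp only [inflLabel, h0, h1, this, h3, if_false]
    · obtain ⟨h1, h2⟩ := v.next_of_not_lt h
      have h3 : 0 ≤ v.pos := by omega
      by_cases h0 : v.next.pos = 0
      · simp [inflLabel, h0, h1, h3, lab_face]
      · have : ¬ 0 ≤ v.next.pos := by omega
        simp only [inflLabel, h0, h1, this, h3, lab_face, if_false, if_true]
  · rw [inflRot_inflRev_bwd]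
    have hhi := v.hi
    by_cases h : -(x v.dart : ℤ) < v.pos
    · obtain ⟨h1, h2⟩ := v.prev_of_lt h
      by_cases h0 : v.prev.pos = 0
      · have h3 : 0 < v.pos := by omega
        have h4 : 0 < x v.dart := by omega
        have h5 : v.pos = 1 := by omega
        simp [inflLabel, h0, h1, h3, h4]
        exact InflVert.ext rfl h5.symm
      · by_cases h3 : 0 < v.pos
        · have h4 : ¬ v.prev.pos < 0 := by omega
          have h5 : v.prev.pos < x v.prev.dart := by rw [h1]; omega
          simp only [inflLabel, h0, h4, h5, h3, dif_pos, dif_neg, if_false, not_false_eq_true]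
          exact congrArg _ (Subtype.ext (InflVert.ext h1 (by simp only; omega)))
        · have h4 : v.prev.pos < 0 := by omega
          simp only [inflLabel, h0, h4, h, h3, dif_pos, dif_neg, if_false, not_false_eq_true]
          exact congrArg _ (Subtype.ext (InflVert.ext h1 (by simp only; omega)))
    · obtain ⟨h1, h2⟩ := v.prev_of_not_lt h
      have h3 : ¬ 0 < v.pos := by omega
      by_cases h0 : v.prev.pos = 0
      · have h4 : x (rotr v.dart) = 0 := by omega
        simp [inflLabel, h0, h1, h3, h4, h]
      · have h4 : ¬ v.prev.pos < 0 := by omega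
        have h5 : ¬ v.prev.pos < x v.prev.dart := by rw [h1]; omega
        simp only [inflLabel, h0, h4, h5, h3, h, dif_neg, if_false, not_false_eq_true]
        rw [h1, rotr_fst]
  · rw [inflRot_inflRev_cross]
    have hlo := v.lo
    have hhi := v.hi
    by_cases h : v.pos = 0
    · obtain ⟨h1, h2⟩ := v.mate_of_zero M h
      simp [inflLabel, h, h1, h2]
    · obtain ⟨h1, h2⟩ := v.mate_of_ne M h
      have h0 : (v.mate M).pos ≠ 0 := by omega
      by_cases h3 : v.pos < 0
      · have h4 : 0 < (v.mate M).pos := by omega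
        simp only [inflLabel, h0, h4, h, h3, dif_pos, dif_neg, if_false, not_false_eq_true]
        exact congrArg _ (Subtype.ext (InflVert.ext h1 (by simp only; omega)))
      · have h4 : ¬ 0 < (v.mate M).pos := by omega
        by_cases h5 : v.pos < x v.dart
        · have h6 : -(x (v.mate M).dart : ℤ) < (v.mate M).pos := by rw [h1]; omega
          simp only [inflLabel, h0, h4, h, h3, h5, h6, dif_pos, dif_neg, if_false,
            not_false_eq_true]
          exact congrArg _ (Subtype.ext (InflVert.ext h1 (by simp only; omega)))
        · have h6 : ¬ -(x (v.mate M).dart : ℤ) < (v.mate M).pos := by rw [h1]; omega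
          simp only [inflLabel, h0, h4, h, h3, h5, h6, dif_neg, if_false, not_false_eq_true]
          rw [h1]

/-- Darts `a` and `b` such that `b` is met when following the face of `a`. -/
abbrev FaceReach : InflVert x × Direction → InflVert x × Direction → Prop :=
  ReflTransGen (fun a b => inflRot (inflRev M x a) = b)

theorem faceReach_cross_tip (d : W × Fin 3) :
    FaceReach M x (tip x d, .cross) (tip x (M.opp d), .fwd) := by
  refine .single ?_
  rw [inflRot_inflRev_cross]
  have h := (tip x d).mate_of_zero M rfl
  rw [if_pos h.2]
  exact Prod.ext (InflVert.ext h.1 h.2) rfl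

theorem faceReach_of_neg (n : ℕ) : ∀ v : InflVert x, v.pos = -(n + 1 : ℕ) →
    FaceReach M x (v, .fwd) (tip x (M.opp v.dart), .fwd) := by
  induction n with
  | zero =>
    intro v hv
    obtain ⟨h1, h2⟩ := v.next_of_lt (by omega)
    refine .head (inflRot_inflRev_fwd M x v) ?_
    rw [if_pos (by omega)]
    have : v.next = tip x v.dart := InflVert.ext h1 (by rw [h2, hv]; rfl)
    rw [this]
    exact faceReach_cross_tip M x _
  | succ n ih =>
    intro v hv
    obtain ⟨h1, h2⟩ := v.next_of_lt (by omega)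
    refine .head (inflRot_inflRev_fwd M x v) ?_
    rw [if_neg (by omega), ← h1]
    exact ih _ (by omega)

theorem faceReach_of_nonneg (n : ℕ) : ∀ v : InflVert x, 0 ≤ v.pos → v.pos + n = x v.dart →
    FaceReach M x (v, .fwd) (tip x (M.opp (rotl v.dart)), .fwd) := by
  induction n with
  | zero =>
    intro v hv hn
    obtain ⟨h1, h2⟩ := v.next_of_not_lt (by omega)
    refine .head (inflRot_inflRev_fwd M x v) ?_
    by_cases h0 : v.next.pos = 0
    · rw [if_pos h0]
      have : v.next = tip x (rotl v.dart) := InflVert.ext h1 h0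
      rw [this]
      exact faceReach_cross_tip M x _
    · rw [if_neg h0, ← h1]
      obtain ⟨k, hk⟩ : ∃ k, x (rotl v.dart) = k + 1 := Nat.exists_eq_succ_of_ne_zero (by omega)
      exact faceReach_of_neg M x k _ (by omega)
  | succ n ih =>
    intro v hv hn
    obtain ⟨h1, h2⟩ := v.next_of_lt (by omega)
    refine .head (inflRot_inflRev_fwd M x v) ?_
    rw [if_neg (by omega), ← h1]
    exact ih _ (by omega) (by rw [h1]; omega)

/-- The first vertex of the ladder of a dart. -/
def bottom (d : W × Fin 3) : InflVert x := ⟨d, -x d, le_rfl, by omega⟩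

theorem faceReach_cross_top (v : InflVert x) (h0 : 0 < v.pos) (h : v.pos = x v.dart) :
    FaceReach M x (v, .cross) (bottom x v.dart, .bwd) := by
  obtain ⟨h1, h2⟩ := v.mate_of_ne M h0.ne'
  refine .single ?_
  rw [inflRot_inflRev_cross, if_neg (by omega)]
  exact Prod.ext (InflVert.ext h1 (by rw [h2, h]; rfl)) rfl

theorem faceReach_bottom (d : W × Fin 3) :
    FaceReach M x (bottom x d, .bwd) (bottom x (rotr d), .bwd) := by
  obtain ⟨h1, h2⟩ := (bottom x d).prev_of_not_lt (by simp [bottom])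
  refine .head (inflRot_inflRev_bwd M x _) ?_
  change (bottom x d).prev.dart = rotr d at h1
  change (bottom x d).prev.pos = x (rotr d) at h2
  by_cases h0 : (bottom x d).prev.pos = 0
  · rw [if_pos h0]
    have : (bottom x d).prev = bottom x (rotr d) :=
      InflVert.ext h1 (by
        change _ = -(x (rotr d) : ℤ)
        omega)
    rw [this]
  · rw [if_neg h0, ← h1]
    exact faceReach_cross_top M x _ (by omega) (by rw [h1]; omega)

theorem faceReach_bottom_zero (d : W × Fin 3) :
    FaceReach M x (bottom x d, .bwd) (bottom x (d.1, 0), .bwd) := by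
  obtain ⟨w, i⟩ := d
  have h0 := faceReach_bottom M x (w, 1)
  have h1 := faceReach_bottom M x (w, 2)
  have h2 := faceReach_bottom M x (w, 0)
  have e1 : rotr (w, (1 : Fin 3)) = (w, 0) := rfl
  have e2 : rotr (w, (2 : Fin 3)) = (w, 1) := rfl
  rw [e1] at h0
  rw [e2] at h1
  match i with
  | 0 => exact .refl
  | 1 => exact h0
  | 2 => exact h1.trans h0

theorem faceReach_bwd_of_pos (v : InflVert x) (n : ℕ) (hn : v.pos = n + 2) :
    ∀ u : InflVert x, u.dart = v.dart → u.pos = v.pos - 1 →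
      FaceReach M x (u, .cross) (v, .bwd) := by
  intro u hd hp
  obtain ⟨h1, h2⟩ := u.mate_of_ne M (by omega)
  refine .head (inflRot_inflRev_cross M x u) ?_
  rw [if_neg (by omega)]
  have hhi := v.hi
  obtain ⟨h3, h4⟩ := (u.mate M).prev_of_lt (by rw [h1, hd]; omega)
  refine .head (inflRot_inflRev_bwd M x _) ?_
  rw [if_neg (by omega)]
  obtain ⟨h5, h6⟩ := (u.mate M).prev.mate_of_ne M (by omega)
  refine .single ?_
  rw [inflRot_inflRev_cross, if_neg (by omega)]
  exact Prod.ext (InflVert.ext (by rw [h5, h3, h1, hd]) (by simp only; omega)) rfl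

theorem faceReach_cross_of_neg (u v : InflVert x) (hd : u.dart = v.dart) (hp : u.pos = -v.pos)
    (hv : 0 < v.pos) : FaceReach M x (u, .cross) (v, .bwd) := by
  obtain ⟨h1, h2⟩ := u.mate_of_ne M (by omega)
  refine .single ?_
  rw [inflRot_inflRev_cross, if_neg (by omega)]
  exact Prod.ext (InflVert.ext (h1.trans hd) (by simp only; omega)) rfl

theorem faceReach_bwd_of_nonpos (u v : InflVert x) (hd : u.dart = v.dart)
    (hp : u.pos = 1 - v.pos) (hv : 0 < v.pos) : FaceReach M x (u, .bwd) (v, .bwd) := by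
  have hhi := v.hi
  obtain ⟨h1, h2⟩ := u.prev_of_lt (by rw [hd]; omega)
  refine .head (inflRot_inflRev_bwd M x _) ?_
  rw [if_neg (by omega)]
  exact faceReach_cross_of_neg M x _ _ (h1.trans hd) (by omega) hv

theorem faceReach_inflCanon {F : Type} (lab : W × Fin 3 → F) (cn : F → W × Fin 3)
    (lab_face : ∀ d, lab (M.opp (rotl d)) = lab d)
    (reach : ∀ d, ReflTransGen (fun a b => M.opp (rotl a) = b) d (cn (lab d)))
    (a : InflVert x × Direction) :
    FaceReach M x a (inflCanon x cn (inflLabel M lab a)) := by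
  have htip : ∀ d, FaceReach M x (tip x d, .fwd) (tip x (cn (lab d)), .fwd) := by
    intro d
    refine ReflTransGen.lift' (fun d => (tip x d, Direction.fwd)) ?_ _ _ (reach d)
    rintro a _ rfl
    exact faceReach_of_nonneg M x (x a) (tip x a) le_rfl (by simp [tip])
  obtain ⟨v, _ | _ | _⟩ := a
  · by_cases h : 0 ≤ v.pos
    · have h1 := faceReach_of_nonneg M x (x v.dart - v.pos).toNat v h (by have := v.hi; omega)
      have h2 := htip (M.opp (rotl v.dart))
      rw [lab_face] at h2
      simpa [inflLabel, inflCanon, h] using h1.trans h2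
    · have h1 := faceReach_of_neg M x (-v.pos - 1).toNat v (by omega)
      have h2 := htip (M.opp v.dart)
      simpa only [inflLabel, inflCanon, h, if_false] using h1.trans h2
  · by_cases h : 0 < v.pos
    · simp only [inflLabel, h, dif_pos, inflCanon]
      exact .refl
    · by_cases h' : -(x v.dart : ℤ) < v.pos
      · simp only [inflLabel, h, h', dif_pos, dif_neg, inflCanon, not_false_eq_true]
        exact faceReach_bwd_of_nonpos M x _ _ rfl (by simp only; omega) (by simp only; omega)
      · simp only [inflLabel, h, h', dif_neg, inflCanon, not_false_eq_true]
        have : v = bottom x v.dart := InflVert.ext rfl (by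
          have := v.lo
          simp only [bottom]
          omega)
        have h1 := faceReach_bottom_zero M x v.dart
        rwa [← this] at h1
  · by_cases h : v.pos = 0
    · simp only [inflLabel, h, dif_pos, inflCanon]
      have : v = tip x v.dart := InflVert.ext rfl h
      have h1 := faceReach_cross_tip M x v.dart
      rw [← this] at h1
      exact h1.trans (htip _)
    · by_cases h' : v.pos < 0
      · simp only [inflLabel, h, h', dif_pos, dif_neg, inflCanon, not_false_eq_true]
        exact faceReach_cross_of_neg M x _ _ rfl (by simp only; omega) (by simp only; omega)
      · by_cases h'' : v.pos < x v.dart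
        · simp only [inflLabel, h, h', h'', dif_pos, dif_neg, inflCanon, not_false_eq_true]
          exact faceReach_bwd_of_pos M x _ (v.pos - 1).toNat (by simp only; omega) _ rfl
            (by simp only; omega)
        · simp only [inflLabel, h, h', h'', dif_neg, inflCanon, not_false_eq_true]
          exact (faceReach_cross_top M x v (by omega) (by have := v.hi; omega)).trans
            (faceReach_bottom_zero M x v.dart)

theorem inflation_isPlanar [Finite W] {F : Type} [Finite F] (lab : W × Fin 3 → F)
    (cn : F → W × Fin 3) (lab_face : ∀ d, lab (M.opp (rotl d)) = lab d)
    (lab_cn : ∀ f, lab (cn f) = f)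
    (reach : ∀ d, ReflTransGen (fun a b => M.opp (rotl a) = b) d (cn (lab d)))
    (euler : 2 * Nat.card F = Nat.card W + 4) (hG : (inflation M x).Connected) :
    IsPlanar (inflation M x) := by
  have : Finite (Rung x) := Subtype.finite
  refine isPlanar_of_darts hG (X := InflVert x × Direction) Prod.fst (inflRev M x) inflRot
    ?_ ?_ (fun _ => rfl) ?_ ?_ ?_ (inflLabel M lab) (inflCanon x cn)
    (inflLabel_inflRot_inflRev M x lab lab_face) ?_ (faceReach_inflCanon M x lab cn lab_face reach)
    ?_
  · rintro ⟨v, a⟩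
    refine Prod.ext (v.step_step M a) ?_
    cases a <;> rfl
  · rintro ⟨v, a⟩
    refine Prod.ext rfl ?_
    by_cases h : v.pos = 0 <;> cases a <;> simp [inflRot, h]
  · intro u v
    constructor
    · rintro ⟨a, h⟩
      exact ⟨(u, a), rfl, h⟩
    · rintro ⟨⟨_, a⟩, rfl, h⟩
      exact ⟨a, h⟩
  · rintro ⟨v, a⟩ ⟨_, b⟩ rfl h
    exact Prod.ext rfl (v.step_injective M h)
  · rintro ⟨v, a⟩ ⟨_, b⟩ rfl
    by_cases h : v.pos = 0 <;> cases a <;> cases b <;> simp [inflRot, h]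
  · rintro (⟨v, hv⟩ | w | f)
    · simp [inflCanon, inflLabel, hv]
    · simp [inflCanon, inflLabel]
    · simp [inflCanon, inflLabel, tip, lab_cn]
  · rw [Nat.card_sum, Nat.card_sum, Nat.card_prod, card_inflVert x M,
      Nat.card_eq_fintype_card (α := Direction), show Fintype.card Direction = 3 from rfl]
    omega

end InflationPlanar

section Linked

open Relation

variable {V : Type*} (G : SimpleGraph V) (s : Set V)

/-- Two vertices are linked when a path avoiding `s` joins them. -/
def Linked : V → V → Prop := ReflTransGen (fun a b => G.Adj a b ∧ a ∉ s ∧ b ∉ s)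

variable {G s}

theorem Linked.refl (a : V) : Linked G s a a := ReflTransGen.refl

theorem Linked.trans {a b c : V} (h : Linked G s a b) (h' : Linked G s b c) : Linked G s a c :=
  ReflTransGen.trans h h'

theorem Linked.symm {a b : V} (h : Linked G s a b) : Linked G s b a := by
  induction h with
  | refl => exact .refl _
  | tail _ h ih => exact ReflTransGen.head ⟨h.1.symm, h.2.2, h.2.1⟩ ih

theorem Linked.of_adj {a b : V} (h : G.Adj a b) (ha : a ∉ s) (hb : b ∉ s) : Linked G s a b :=
  ReflTransGen.single ⟨h, ha, hb⟩

theorem Linked.notMem {a b : V} (h : Linked G s a b) (ha : a ∉ s) : b ∉ s := by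
  induction h with
  | refl => exact ha
  | tail _ h _ => exact h.2.2

theorem Linked.reachable {a b : V} (h : Linked G s a b) (ha : a ∉ s) (hb : b ∉ s) :
    (G.induce sᶜ).Reachable ⟨a, ha⟩ ⟨b, hb⟩ := by
  induction h with
  | refl => rfl
  | tail _ h ih => exact (ih h.2.1).trans (Adj.reachable (by exact h.1))

theorem isThreeConnected_of_linked [Finite V] (h3 : 3 < Nat.card V)
    (h : ∀ s : Set V, s.ncard < 3 → ∀ a b, a ∉ s → b ∉ s → Linked G s a b) :
    IsThreeConnected G := by
  rw [← Set.ncard_univ] at h3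
  refine ⟨h3, fun s _ hs => ?_⟩
  have hne : sᶜ.Nonempty := by
    by_contra hne
    rw [Set.not_nonempty_iff_eq_empty, Set.compl_empty_iff] at hne
    subst hne
    omega
  obtain ⟨a, ha⟩ := hne
  have : Nonempty (sᶜ : Set V) := ⟨⟨a, ha⟩⟩
  exact ⟨fun u v => (h s hs u v u.2 v.2).reachable u.2 v.2⟩

end Linked

/-- The underlying graph of a cubic map. -/
def CubicMap_s1.graph {W : Type} (M : CubicMap_s1 W) : SimpleGraph W where
  Adj u v := ∃ i, (M.opp (u, i)).1 = v
  symm := ⟨by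
    rintro u v ⟨i, rfl⟩
    exact ⟨(M.opp (u, i)).2, by rw [Prod.mk.eta, M.opp_opp]⟩⟩
  loopless := ⟨by
    rintro u ⟨i, h⟩
    exact M.opp_fst_ne _ h⟩

section InflationConnected

open InflVert

variable {W : Type} (M : CubicMap_s1 W) {x : W × Fin 3 → ℕ} {s : Set (InflVert x)}

theorem linked_rail (n : ℕ) : ∀ u v : InflVert x, u.dart = v.dart → u.pos + n = v.pos →
    (∀ z : InflVert x, z.dart = v.dart → u.pos ≤ z.pos → z.pos ≤ v.pos → z ∉ s) →
    Linked (inflation M x) s u v := by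
  induction n with
  | zero =>
    intro u v h1 h2 _
    rw [show u = v from InflVert.ext h1 (by omega)]
    exact .refl _
  | succ n ih =>
    intro u v h1 h2 h3
    have hv := v.hi
    obtain ⟨h4, h5⟩ := u.next_of_lt (by rw [h1]; omega)
    refine (Linked.of_adj (inflation_adj_next M x u) (h3 _ h1 le_rfl (by omega))
      (h3 _ (h4.trans h1) (by omega) (by omega))).trans (ih _ _ (h4.trans h1) (by omega) ?_)
    exact fun z hz h6 h7 => h3 z hz (by omega) h7

/-- The last vertex of the ladder of a dart. -/
def top (x : W × Fin 3 → ℕ) (d : W × Fin 3) : InflVert x := ⟨d, x d, by omega, le_rfl⟩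

theorem top_next (d : W × Fin 3) : (top x d).next = bottom x (rotl d) := by
  obtain ⟨h1, h2⟩ := (top x d).next_of_not_lt (by simp [top])
  exact InflVert.ext h1 h2

theorem linked_tip (u : InflVert x)
    (h : ∀ z : InflVert x, z.dart = u.dart → min 0 u.pos ≤ z.pos → z.pos ≤ max 0 u.pos → z ∉ s) :
    Linked (inflation M x) s u (tip x u.dart) := by
  rcases le_total 0 u.pos with h0 | h0
  · refine (linked_rail M u.pos.toNat (tip x u.dart) u rfl (by simp only [tip]; omega) ?_).symm
    exact fun z hz h1 h2 => h z hz (by simp only [tip] at h1; omega) (by omega)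
  · refine linked_rail M (-u.pos).toNat u (tip x u.dart) rfl (by simp only [tip]; omega) ?_
    exact fun z hz h1 h2 => h z hz (by omega) (by simp only [tip] at h2; omega)

theorem linked_tip_rotl (u : InflVert x)
    (h : ∀ z : InflVert x, z.dart = u.dart → u.pos ≤ z.pos → z ∉ s)
    (h' : ∀ z : InflVert x, z.dart = rotl u.dart → z ∉ s) :
    Linked (inflation M x) s u (tip x (rotl u.dart)) := by
  have hu := u.hi
  have h1 : Linked (inflation M x) s u (top x u.dart) :=
    linked_rail M (x u.dart - u.pos).toNat _ _ rfl (by simp only [top]; omega)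
      fun z hz h1 _ => h z hz h1
  have h2 : Linked (inflation M x) s (top x u.dart) (bottom x (rotl u.dart)) := by
    rw [← top_next]
    refine .of_adj (inflation_adj_next M x _) (h _ rfl hu) (h' _ ?_)
    rw [top_next]
    rfl
  exact (h1.trans h2).trans (linked_tip M _ fun z hz _ _ => h' z hz)

theorem linked_tip_rotr (u : InflVert x)
    (h : ∀ z : InflVert x, z.dart = u.dart → z.pos ≤ u.pos → z ∉ s)
    (h' : ∀ z : InflVert x, z.dart = rotr u.dart → z ∉ s) :
    Linked (inflation M x) s u (tip x (rotr u.dart)) := by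
  have hu := u.lo
  have h1 : Linked (inflation M x) s (bottom x u.dart) u :=
    linked_rail M (u.pos + x u.dart).toNat _ _ rfl (by simp only [bottom]; omega)
      fun z hz _ h2 => h z hz h2
  have h2 : Linked (inflation M x) s (top x (rotr u.dart)) (bottom x u.dart) := by
    have := top_next (x := x) (rotr u.dart)
    rw [rotl_rotr] at this
    rw [← this]
    refine .of_adj (inflation_adj_next M x _) (h' _ rfl) (h _ ?_ ?_) <;> rw [this]
    · rfl
    · exact hu
  exact (h1.symm.trans h2.symm).trans (linked_tip M _ fun z hz _ _ => h' z hz)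

theorem linked_of_free_block (u : InflVert x)
    (h : ∀ z : InflVert x, z.dart.1 = u.dart.1 → z ∉ s) (i : Fin 3) :
    Linked (inflation M x) s u (tip x (u.dart.1, i)) := by
  have h1 := linked_tip M u fun z hz _ _ => h z (by rw [hz])
  have h2 := linked_tip_rotl M u (fun z hz _ => h z (by rw [hz]))
    (fun z hz => h z (by rw [hz, rotl_fst]))
  have h3 := linked_tip_rotr M u (fun z hz _ => h z (by rw [hz]))
    (fun z hz => h z (by rw [hz, rotr_fst]))
  rcases (by decide : ∀ i j : Fin 3, i = j ∨ i = j + 1 ∨ i = j + 2) i u.dart.2 with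
    rfl | rfl | rfl
  · exact h1
  · exact h2
  · exact h3

open Classical in
/-- A colouring of the vertices by the three ways of leaving the block of `u`; the paths from `u`
in different ways are disjoint. -/
noncomputable def exitColor (u z : InflVert x) : Fin 3 :=
  if z.dart.1 = u.dart.1 then
    if z.dart = u.dart then
      if min 0 u.pos ≤ z.pos ∧ z.pos ≤ max 0 u.pos then u.dart.2
      else if 0 ≤ z.pos then (rotl u.dart).2 else (rotr u.dart).2
    else z.dart.2
  else if h : ∃ i, (M.opp (u.dart.1, i)).1 = z.dart.1 then h.choose else 0

theorem exitColor_of_opp (u z : InflVert x) (i : Fin 3)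
    (h : (M.opp (u.dart.1, i)).1 = z.dart.1) : exitColor M u z = i := by
  have h1 : z.dart.1 ≠ u.dart.1 := by
    rw [← h]
    exact M.opp_fst_ne _
  have h2 : ∃ i, (M.opp (u.dart.1, i)).1 = z.dart.1 := ⟨i, h⟩
  rw [exitColor, if_neg h1, dif_pos h2]
  exact M.opp_fst_inj _ _ _ (h2.choose_spec.trans h.symm)

theorem exitColor_of_dart_ne (u z : InflVert x) (h : z.dart.1 = u.dart.1) (h' : z.dart ≠ u.dart) :
    exitColor M u z = z.dart.2 := by
  rw [exitColor, if_pos h, if_neg h']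

theorem linked_exit (u : InflVert x) (hu : u ∉ s) (i : Fin 3)
    (hi : ∀ z ∈ s, exitColor M u z ≠ i) :
    Linked (inflation M x) s u (tip x (u.dart.1, i)) := by
  have key : ∀ z, exitColor M u z = i → z ∉ s := fun z hz hs => hi z hs hz
  have same : ∀ z : InflVert x, z.dart = u.dart → exitColor M u z =
      if min 0 u.pos ≤ z.pos ∧ z.pos ≤ max 0 u.pos then u.dart.2
      else if 0 ≤ z.pos then (rotl u.dart).2 else (rotr u.dart).2 := by
    intro z hz
    rw [exitColor, if_pos (by rw [hz]), if_pos hz]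
  have hmate : u.pos ≠ 0 → u.mate M ∉ s → Linked (inflation M x) s u (u.mate M) :=
    fun _ h => .of_adj (inflation_adj_mate M x u) hu h
  rcases (by decide : ∀ i j : Fin 3, i = j ∨ i = j + 1 ∨ i = j + 2) i u.dart.2 with
    rfl | rfl | rfl
  · exact linked_tip M u fun z hz h1 h2 => key z (by rw [same z hz, if_pos ⟨h1, h2⟩])
  · have h' : ∀ z : InflVert x, z.dart = rotl u.dart → z ∉ s := by
      intro z hz
      refine key z ?_
      rw [exitColor_of_dart_ne M u z (by rw [hz, rotl_fst]) (by rw [hz]; exact rotl_ne _), hz]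
      rfl
    rcases le_or_gt 0 u.pos with h0 | h0
    · refine linked_tip_rotl M u (fun z hz h1 => ?_) h'
      rcases h1.eq_or_lt with h1 | h1
      · rwa [show z = u from InflVert.ext hz h1.symm]
      · exact key z (by rw [same z hz, if_neg (by omega), if_pos (by omega)]; rfl)
    · obtain ⟨h2, h3⟩ := u.mate_of_ne M h0.ne
      have h4 : ∀ z : InflVert x, z.dart = (u.mate M).dart → (u.mate M).pos ≤ z.pos → z ∉ s :=
        fun z hz h1 => key z (by
          rw [same z (hz.trans h2), if_neg (by omega), if_pos (by omega)]; rfl)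
      rw [show (u.dart.1, u.dart.2 + 1) = rotl (u.mate M).dart by rw [h2]; rfl]
      exact (hmate h0.ne (h4 _ rfl le_rfl)).trans
        (linked_tip_rotl M _ h4 fun z hz => h' z (by rw [hz, h2]))
  · have h' : ∀ z : InflVert x, z.dart = rotr u.dart → z ∉ s := by
      intro z hz
      refine key z ?_
      rw [exitColor_of_dart_ne M u z (by rw [hz, rotr_fst]) (by rw [hz]; exact rotr_ne _), hz]
      rfl
    rcases le_or_gt u.pos 0 with h0 | h0
    · refine linked_tip_rotr M u (fun z hz h1 => ?_) h'
      rcases h1.eq_or_lt with h1 | h1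
      · rwa [show z = u from InflVert.ext hz h1]
      · exact key z (by rw [same z hz, if_neg (by omega), if_neg (by omega)]; rfl)
    · obtain ⟨h2, h3⟩ := u.mate_of_ne M h0.ne'
      have h4 : ∀ z : InflVert x, z.dart = (u.mate M).dart → z.pos ≤ (u.mate M).pos → z ∉ s :=
        fun z hz h1 => key z (by
          rw [same z (hz.trans h2), if_neg (by omega), if_neg (by omega)]; rfl)
      rw [show (u.dart.1, u.dart.2 + 2) = rotr (u.mate M).dart by rw [h2]; rfl]
      exact (hmate h0.ne' (h4 _ rfl le_rfl)).trans
        (linked_tip_rotr M _ h4 fun z hz => h' z (by rw [hz, h2]))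

theorem inflation_isThreeConnected [Finite W] (h3 : 3 < Nat.card W)
    (h : ∀ B : Set W, B.ncard < 3 → ∀ a b, a ∉ B → b ∉ B → Linked M.graph B a b) :
    IsThreeConnected (inflation M x) := by
  refine isThreeConnected_of_linked (by rw [card_inflVert x M]; omega) fun s hs => ?_
  set B : Set W := (fun v : InflVert x => v.dart.1) '' s with hB
  have hBcard : B.ncard < 3 := (Set.ncard_image_le s.toFinite).trans_lt hs
  have hfree : ∀ w, w ∉ B → ∀ z : InflVert x, z.dart.1 = w → z ∉ s :=
    fun w hw z hz hzs => hw ⟨z, hzs, hz⟩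
  have hlift : ∀ a b, a ∉ B → Linked M.graph B a b →
      Linked (inflation M x) s (tip x (a, 0)) (tip x (b, 0)) := by
    intro a b ha hab
    induction hab with
    | refl => exact .refl _
    | tail _ hbc ih =>
      rename_i b c _
      obtain ⟨⟨i, rfl⟩, hb, hc⟩ := hbc
      refine ih.trans ?_
      have h1 := linked_of_free_block M (tip x (b, 0)) (hfree b hb) i
      have h2 := linked_of_free_block M (tip x (M.opp (b, i))) (hfree _ hc) 0
      refine (h1.trans (.of_adj ⟨.cross, rfl⟩ (hfree b hb _ rfl) (hfree _ hc _ rfl))).trans h2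
  have hexit : ∀ u : InflVert x, u ∉ s → ∃ w, w ∉ B ∧
      Linked (inflation M x) s u (tip x (w, 0)) := by
    intro u hu
    obtain ⟨i, hi⟩ : ∃ i, i ∉ exitColor M u '' s := by
      by_contra hall
      push Not at hall
      have h1 : (exitColor M u '' s) = Set.univ := Set.eq_univ_of_forall hall
      have h2 := Set.ncard_image_le (f := exitColor M u) s.toFinite
      rw [h1, Set.ncard_univ, Nat.card_fin] at h2
      omega
    have hi' : ∀ z ∈ s, exitColor M u z ≠ i := fun z hz he => hi ⟨z, hz, he⟩
    have hw : (M.opp (u.dart.1, i)).1 ∉ B := by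
      rintro ⟨z, hz, he⟩
      exact hi' z hz (exitColor_of_opp M u z i he.symm)
    refine ⟨_, hw, ?_⟩
    have h1 := linked_exit M u hu i hi'
    have h2 := linked_of_free_block M (tip x (M.opp (u.dart.1, i))) (hfree _ hw) 0
    exact (h1.trans (.of_adj ⟨.cross, rfl⟩ (h1.notMem hu) (hfree _ hw _ rfl))).trans h2
  intro a b ha hb
  obtain ⟨v, hv, hav⟩ := hexit a ha
  obtain ⟨w, hw, hbw⟩ := hexit b hb
  exact (hav.trans (hlift v w hv (h B hBcard v w hv hw))).trans hbw.symm

end InflationConnected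

section Cycles

variable {V : Type*} {G : SimpleGraph V}

theorem exists_second_boundary_edge {v : V} {w : G.Walk v v} (hw : w.IsCycle) (A : Set V)
    {a b : V} (hab : s(a, b) ∈ w.edges) (ha : a ∈ A) (hb : b ∉ A) :
    ∃ a' ∈ A, ∃ b' ∉ A, s(a', b') ∈ w.edges ∧ s(a', b') ≠ s(a, b) := by
  have hmem : ∀ e ∈ w.edges, e ∈ (fromEdgeSet {e | e ∈ w.edges}).edgeSet := by
    intro e he
    rw [edgeSet_fromEdgeSet]
    exact ⟨he, fun h => G.not_isDiag_of_mem_edgeSet (w.edges_subset_edgeSet he) h⟩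
  obtain ⟨-, ⟨p⟩⟩ := adj_and_reachable_delete_edges_iff_exists_cycle.2
    ⟨v, w.transfer _ hmem, hw.transfer hmem, by rwa [Walk.edges_transfer]⟩
  obtain ⟨d, -, h1, h2⟩ := p.exists_boundary_dart A ha hb
  have h3 := d.adj
  rw [deleteEdges_adj, fromEdgeSet_adj] at h3
  exact ⟨d.fst, h1, d.snd, h2, h3.1.1, h3.2⟩

theorem card_support_of_isCycle [DecidableEq V] {v : V} {w : G.Walk v v} (hw : w.IsCycle) :
    w.support.toFinset.card = w.length := by
  have h : w.support.toFinset = w.support.tail.toFinset := by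
    ext a
    rw [List.mem_toFinset, List.mem_toFinset, Walk.mem_support_iff]
    refine ⟨?_, Or.inr⟩
    rintro (rfl | h)
    · exact Walk.end_mem_tail_support hw.not_nil
    · exact h
  rw [h, List.toFinset_card_of_nodup hw.support_nodup, List.length_tail, Walk.length_support]
  rfl

theorem exists_walk_of_induce_compl {s : Set V} {a b : (sᶜ : Set V)}
    (p : (G.induce sᶜ).Walk a b) : ∃ p' : G.Walk a b, ∀ z ∈ p'.support, z ∉ s := by
  induction p with
  | @nil u => exact ⟨.nil, fun z hz => by rw [Walk.mem_support_nil_iff.1 hz]; exact u.2⟩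
  | @cons u v _ h _ ih =>
    have h' : G.Adj u v := h
    obtain ⟨p', hp'⟩ := ih
    refine ⟨.cons h' p', fun z hz => ?_⟩
    rw [Walk.support_cons, List.mem_cons] at hz
    rcases hz with rfl | hz
    · exact u.2
    · exact hp' z hz

end Cycles

section InflationCycles

open InflVert

variable {W : Type} (M : CubicMap_s1 W) {x : W × Fin 3 → ℕ}

theorem inflation_adj_of_fst_ne {u v : InflVert x} (h : (inflation M x).Adj u v)
    (hne : u.dart.1 ≠ v.dart.1) : u = tip x u.dart ∧ v = tip x (M.opp u.dart) := by
  obtain ⟨a, rfl⟩ := h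
  cases a
  · exact absurd u.next_fst.symm hne
  · exact absurd u.prev_fst.symm hne
  · by_cases h0 : u.pos = 0
    · obtain ⟨h1, h2⟩ := u.mate_of_zero M h0
      exact ⟨InflVert.ext rfl h0, InflVert.ext h1 h2⟩
    · exact absurd (congrArg Prod.fst (u.mate_of_ne M h0).1.symm) hne

theorem inflation_adj_leave {u v : InflVert x} {j : ℕ} (h : (inflation M x).Adj u v)
    (hj : u.pos.natAbs < j) (hjx : j ≤ x u.dart) (hv : ¬ (v.dart = u.dart ∧ v.pos.natAbs < j)) :
    (v.dart = u.dart ∧ v.pos.natAbs = j) ∨ (u = tip x u.dart ∧ v = tip x (M.opp u.dart)) := by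
  obtain ⟨a, rfl⟩ := h
  cases a
  · obtain ⟨h1, h2⟩ := u.next_of_lt (by omega)
    have h3 : ¬ u.next.pos.natAbs < j := fun h => hv ⟨h1, h⟩
    exact .inl ⟨h1, by rw [step]; omega⟩
  · obtain ⟨h1, h2⟩ := u.prev_of_lt (by omega)
    have h3 : ¬ u.prev.pos.natAbs < j := fun h => hv ⟨h1, h⟩
    exact .inl ⟨h1, by rw [step]; omega⟩
  · by_cases h0 : u.pos = 0
    · obtain ⟨h1, h2⟩ := u.mate_of_zero M h0
      exact .inr ⟨InflVert.ext rfl h0, InflVert.ext h1 h2⟩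
    · obtain ⟨h1, h2⟩ := u.mate_of_ne M h0
      exact absurd ⟨h1, by rw [step, h2]; omega⟩ hv

/-- The darts whose tips are joined to the opposite tips by an edge of the walk `w`. -/
def crossed {u v : InflVert x} (w : (inflation M x).Walk u v) : Set (W × Fin 3) :=
  {d | s(tip x d, tip x (M.opp d)) ∈ w.edges}

variable {M} {u : InflVert x} {w : (inflation M x).Walk u u}

theorem crossed_opp {d : W × Fin 3} (hd : d ∈ crossed M w) : M.opp d ∈ crossed M w := by
  rw [crossed, Set.mem_ofPred_eq, M.opp_opp, Sym2.eq_swap]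
  exact hd

theorem crossed_rot (hw : w.IsCycle) {d : W × Fin 3} (hd : d ∈ crossed M w) :
    rotl d ∈ crossed M w ∨ rotr d ∈ crossed M w := by
  obtain ⟨a, ha, b, hb, hab, hne⟩ := exists_second_boundary_edge hw
    {z : InflVert x | z.dart.1 = d.1} hd rfl (M.opp_fst_ne d)
  rw [Set.mem_ofPred_eq] at ha hb
  obtain ⟨h1, h2⟩ := inflation_adj_of_fst_ne M (w.adj_of_mem_edges hab) (by rw [ha]; exact Ne.symm hb)
  have hmem : a.dart ∈ crossed M w := by
    rw [crossed, Set.mem_ofPred_eq, ← h1, ← h2]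
    exact hab
  have hdne : a.dart ≠ d := by
    intro h
    rw [h] at h1 h2
    exact hne (by rw [h1, h2])
  have h3 : a.dart.2 ≠ d.2 := fun h => hdne (Prod.ext ha h)
  rcases (by decide : ∀ i j : Fin 3, i ≠ j → i = j + 1 ∨ i = j + 2) _ _ h3 with h | h
  · exact .inl ((show a.dart = rotl d from Prod.ext ha h) ▸ hmem)
  · exact .inr ((show a.dart = rotr d from Prod.ext ha h) ▸ hmem)

theorem exists_mem_support_of_crossed (hw : w.IsCycle) {d : W × Fin 3} (hd : d ∈ crossed M w)
    {j : ℕ} (hj : j ≤ x d) : ∃ z ∈ w.support, z.dart = d ∧ z.pos.natAbs = j := by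
  rcases Nat.eq_zero_or_pos j with rfl | h0
  · exact ⟨tip x d, w.fst_mem_support_of_mem_edges hd, rfl, rfl⟩
  · obtain ⟨a, ha, b, hb, hab, hne⟩ := exists_second_boundary_edge hw
      {z : InflVert x | z.dart = d ∧ z.pos.natAbs < j} hd ⟨rfl, h0⟩
      (fun h => M.opp_fst_ne d (congrArg Prod.fst h.1))
    obtain ⟨rfl, ha⟩ := ha
    rcases inflation_adj_leave M (w.adj_of_mem_edges hab) ha hj hb with h | h
    · exact ⟨b, w.snd_mem_support_of_mem_edges hab, h⟩
    · exact absurd (by rw [← h.1, ← h.2]) hne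

theorem sum_crossed_le_length (hw : w.IsCycle) (S : Finset (W × Fin 3))
    (hS : ∀ d ∈ S, d ∈ crossed M w) : ∑ d ∈ S, (x d + 1) ≤ w.length := by
  classical
  have h : (S.sigma fun d => Finset.range (x d + 1)) ⊆
      w.support.toFinset.image fun z => ⟨z.dart, z.pos.natAbs⟩ := by
    rintro ⟨d, j⟩ h
    rw [Finset.mem_sigma, Finset.mem_range] at h
    obtain ⟨z, hz, rfl, rfl⟩ := exists_mem_support_of_crossed hw (hS d h.1) (Nat.lt_succ_iff.1 h.2)
    exact Finset.mem_image.2 ⟨z, List.mem_toFinset.2 hz, rfl⟩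
  have h2 := (Finset.card_le_card h).trans Finset.card_image_le
  rw [Finset.card_sigma, card_support_of_isCycle hw] at h2
  simpa using h2

theorem length_le_of_crossed_eq_empty (hw : w.IsCycle) (hS : crossed M w = ∅) :
    w.length ≤ ∑ i, (2 * x (u.dart.1, i) + 1) := by
  classical
  have hblock : ∀ z ∈ w.support, z.dart.1 = u.dart.1 := by
    intro z hz
    by_contra hne
    obtain ⟨d, hd, h1, h2⟩ := (w.takeUntil z hz).exists_boundary_dart
      {y : InflVert x | y.dart.1 = u.dart.1} rfl hne
    rw [Set.mem_ofPred_eq] at h1 h2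
    obtain ⟨h3, h4⟩ := inflation_adj_of_fst_ne M d.adj (by rw [h1]; exact Ne.symm h2)
    have : d.fst.dart ∈ crossed M w := by
      rw [crossed, Set.mem_ofPred_eq, ← h3, ← h4]
      exact w.edges_takeUntil_subset_edges hz (List.mem_map_of_mem hd)
    rw [hS] at this
    exact this
  rw [← card_support_of_isCycle hw]
  let T : Finset (Σ _ : Fin 3, ℤ) :=
    Finset.univ.sigma fun i => Finset.Icc (-(x (u.dart.1, i) : ℤ)) (x (u.dart.1, i))
  have hT : T.card = ∑ i, (2 * x (u.dart.1, i) + 1) := by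
    rw [Finset.card_sigma]
    refine Finset.sum_congr rfl fun i _ => ?_
    rw [Int.card_Icc]
    omega
  rw [← hT]
  refine Finset.card_le_card_of_injOn (fun z => ⟨z.dart.2, z.pos⟩) ?_ ?_
  · intro z hz
    have h1 := hblock z (List.mem_toFinset.1 hz)
    have h2 : z.dart = (u.dart.1, z.dart.2) := Prod.ext h1 rfl
    simp only [T, Finset.coe_sigma, Set.mem_sigma_iff, Finset.coe_univ, Set.mem_univ, true_and,
      Finset.coe_Icc, Set.mem_Icc]
    rw [← h2]
    exact ⟨z.lo, z.hi⟩
  · intro y hy z hz h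
    have h1 := hblock y (List.mem_toFinset.1 hy)
    have h2 := hblock z (List.mem_toFinset.1 hz)
    simp only [Sigma.mk.injEq, heq_eq_eq] at h
    exact InflVert.ext (Prod.ext (h1.trans h2.symm) h.1) h.2

theorem le_length_of_crossed [Finite W] {N : ℕ} (hw : w.IsCycle) (hne : (crossed M w).Nonempty)
    (hN : ∀ S : Finset (W × Fin 3), S.Nonempty → (∀ d ∈ S, M.opp d ∈ S) →
      (∀ d ∈ S, rotl d ∈ S ∨ rotr d ∈ S) → N ≤ ∑ d ∈ S, (x d + 1)) :
    N ≤ w.length := by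
  have hf := (crossed M w).toFinite
  refine (hN hf.toFinset ?_ ?_ ?_).trans (sum_crossed_le_length hw _ fun d hd => by simpa using hd)
  · simpa using hne
  · intro d hd
    simp only [Set.Finite.mem_toFinset] at hd ⊢
    exact crossed_opp hd
  · intro d hd
    simp only [Set.Finite.mem_toFinset] at hd ⊢
    exact crossed_rot hw hd

theorem exists_crossed_cycle (h3 : IsThreeConnected (inflation M x)) (d : W × Fin 3) :
    ∃ (u : InflVert x) (w : (inflation M x).Walk u u), w.IsCycle ∧ (crossed M w).Nonempty := by
  set a := tip x d with ha
  have hm : a.mate M = tip x (M.opp d) := InflVert.ext (a.mate_of_zero M rfl).1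
    (a.mate_of_zero M rfl).2
  set b := a.mate M with hb
  have hab : a ∉ ({b} : Set (InflVert x)) := fun h => (a.mate_ne M).symm h
  have hcb : b.next ∉ ({b} : Set (InflVert x)) := fun h => b.next_ne h
  obtain ⟨p⟩ := (h3.2 {b} (Set.finite_singleton b) (by simp)).preconnected
    ⟨a, hab⟩ ⟨b.next, hcb⟩
  obtain ⟨p', hp'⟩ := exists_walk_of_induce_compl p
  replace hp' : b ∉ p'.support := fun h => hp' b h rfl
  have hfst : a.dart.1 ≠ b.dart.1 := by
    rw [hm]
    exact (M.opp_fst_ne d).symm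
  have hcyc := adj_and_reachable_delete_edges_iff_exists_cycle.1
    ⟨inflation_adj_mate M x a, by
      rw [reachable_deleteEdges_iff_exists_walk]
      refine ⟨p'.concat (inflation_adj_next M x b).symm, ?_⟩
      rw [Walk.edges_concat]
      simp only [List.concat_eq_append, List.mem_append, List.mem_singleton, not_or]
      refine ⟨fun h => hp' (p'.snd_mem_support_of_mem_edges h), fun h => ?_⟩
      rw [Sym2.eq_iff] at h
      rcases h with ⟨h, -⟩ | ⟨h, -⟩
      · exact hfst ((congrArg (fun z : InflVert x => z.dart.1) h).trans b.next_fst)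
      · exact hfst (congrArg (fun z : InflVert x => z.dart.1) h)⟩
  obtain ⟨u, w, hw, hmem⟩ := hcyc
  rw [← hb, hm] at hmem
  exact ⟨u, w, hw, d, hmem⟩

end InflationCycles

section Columns

open Relation

/-- The four kinds of vertices of the column map. -/
inductive Kind
  | rim
  | upper
  | lower
  | middle
  deriving DecidableEq

instance : Fintype Kind := ⟨{.rim, .upper, .lower, .middle}, by rintro (_ | _ | _ | _) <;> simp⟩

/-- Vertices of the column map with `m` columns on each of its two sides. -/
abbrev ColVert (m : ℕ) : Type := Kind × Bool × ZMod m

variable {m : ℕ}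

/-- Reversal of darts in the column map. On either side, a rim cycle is followed by a ring of
pentagons and a ring of hexagons; the outer ends of the two sides form a common cycle. -/
def colOpp : ColVert m × Fin 3 → ColVert m × Fin 3
  | ((.rim, s, i), 0) => ((.rim, s, i + 1), 1)
  | ((.rim, s, i), 1) => ((.rim, s, i - 1), 0)
  | ((.rim, s, i), 2) => ((.upper, s, i), 1)
  | ((.upper, s, i), 0) => ((.lower, s, i), 1)
  | ((.upper, s, i), 1) => ((.rim, s, i), 2)
  | ((.upper, s, i), 2) => ((.lower, s, i - 1), 0)
  | ((.lower, s, i), 0) => ((.upper, s, i + 1), 2)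
  | ((.lower, s, i), 1) => ((.upper, s, i), 0)
  | ((.lower, s, i), 2) => ((.middle, s, i), 1)
  | ((.middle, s, i), 0) => ((.middle, !s, -i), 0)
  | ((.middle, s, i), 1) => ((.lower, s, i), 2)
  | ((.middle, s, i), 2) => ((.middle, !s, 1 - i), 2)

theorem forall_colDart {p : ColVert m × Fin 3 → Prop}
    (h : ∀ k s i, p ((k, s, i), 0) ∧ p ((k, s, i), 1) ∧ p ((k, s, i), 2)) (d) : p d := by
  obtain ⟨⟨k, s, i⟩, j⟩ := d
  obtain ⟨h0, h1, h2⟩ := h k s i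
  fin_cases j
  · exact h0
  · exact h1
  · exact h2

/-- The column map. -/
def colMap (m : ℕ) (h3 : 3 ≤ m) : CubicMap_s1 (ColVert m) where
  opp := colOpp
  opp_opp := forall_colDart fun k s i => by
    cases k <;> simp [colOpp]
  opp_fst_ne := by
    have : Fact (1 < m) := ⟨by omega⟩
    refine forall_colDart fun k s i => ?_
    cases k <;> simp [colOpp]
  opp_fst_inj := by
    have : Fact (1 < m) := ⟨by omega⟩
    have h2 : (2 : ZMod m) ≠ 0 := by
      intro h
      have := (ZMod.natCast_eq_zero_iff 2 m).1 (by exact_mod_cast h)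
      have := Nat.le_of_dvd (by omega) this
      omega
    have ha : ∀ i : ZMod m, i + 1 ≠ i - 1 := fun i h => h2 (by linear_combination h)
    have hb : ∀ i : ZMod m, -i ≠ 1 - i := fun i h => one_ne_zero (α := ZMod m)
      (by linear_combination -h)
    have hc : ∀ i : ZMod m, i ≠ i - 1 := fun i h => one_ne_zero (α := ZMod m)
      (by linear_combination h)
    rintro ⟨k, s, i⟩ j j' h
    have := ha i
    have := hc i
    have := hb i
    have := (hc i).symm
    cases k <;> fin_cases j <;> fin_cases j' <;> simp_all [colOpp, eq_comm]

/-- The face of the column map containing a dart. -/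
def colFace : ColVert m × Fin 3 → (Bool × ZMod m) ⊕ (Bool × ZMod m) ⊕ Bool
  | ((.rim, s, _), 0) => .inr (.inr s)
  | ((.rim, s, i), 1) => .inl (s, i - 1)
  | ((.rim, s, i), 2) => .inl (s, i)
  | ((.upper, s, i), 0) => .inl (s, i)
  | ((.upper, s, i), 1) => .inl (s, i - 1)
  | ((.upper, s, i), 2) => .inr (.inl (s, i))
  | ((.lower, s, i), 0) => .inl (s, i)
  | ((.lower, s, i), 1) => .inr (.inl (s, i))
  | ((.lower, s, i), 2) => .inr (.inl (s, i + 1))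
  | ((.middle, s, i), 0) => .inr (.inl (s, i + 1))
  | ((.middle, s, i), 1) => .inr (.inl (s, i))
  | ((.middle, s, i), 2) => .inr (.inl (!s, 1 - i))

/-- A dart on each face of the column map. -/
def colFaceDart : (Bool × ZMod m) ⊕ (Bool × ZMod m) ⊕ Bool → ColVert m × Fin 3
  | .inl (s, i) => ((.rim, s, i), 2)
  | .inr (.inl (s, i)) => ((.upper, s, i), 2)
  | .inr (.inr s) => ((.rim, s, 0), 0)

theorem colFace_opp_rotl (d : ColVert m × Fin 3) : colFace (colOpp (rotl d)) = colFace d := by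
  revert d
  refine forall_colDart fun k s i => ?_
  cases k <;> refine ⟨?_, ?_, ?_⟩ <;> simp [colFace, colOpp, rotl]
  ring

theorem colFace_colFaceDart (f : (Bool × ZMod m) ⊕ (Bool × ZMod m) ⊕ Bool) :
    colFace (colFaceDart f) = f := by
  obtain (⟨s, i⟩ | ⟨s, i⟩ | s) := f <;> rfl

theorem colFace_reach [NeZero m] (d : ColVert m × Fin 3) :
    ReflTransGen (fun a b => colOpp (rotl a) = b) d (colFaceDart (colFace d)) := by
  have cyc : ∀ s i, ReflTransGen (fun a b => colOpp (rotl a) = b)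
      (((.rim, s, i), 0) : ColVert m × Fin 3) ((.rim, s, 0), 0) := by
    intro s i
    rw [← ZMod.natCast_zmod_val i]
    induction i.val with
    | zero => rw [Nat.cast_zero]
    | succ n ih => exact .head (by simp [colOpp, rotl]) ih
  have hm0 : ∀ s i, ReflTransGen (fun a b => colOpp (rotl a) = b)
      (((.middle, s, i), 0) : ColVert m × Fin 3) ((.upper, s, i + 1), 2) := fun s i =>
    .head rfl (.single rfl)
  have hm2 : ∀ s i, ReflTransGen (fun a b => colOpp (rotl a) = b)
      (((.middle, s, i), 2) : ColVert m × Fin 3) ((.upper, !s, 1 - i), 2) := fun s i => by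
    have := hm0 (!s) (-i)
    rw [neg_add_eq_sub] at this
    exact .head rfl this
  have hm1 : ∀ s i, ReflTransGen (fun a b => colOpp (rotl a) = b)
      (((.middle, s, i), 1) : ColVert m × Fin 3) ((.upper, s, i), 2) := fun s i => by
    have := hm2 (!s) (1 - i)
    rw [Bool.not_not, sub_sub_cancel] at this
    exact .head rfl this
  have hu1 : ∀ s i, ReflTransGen (fun a b => colOpp (rotl a) = b)
      (((.upper, s, i), 1) : ColVert m × Fin 3) ((.rim, s, i - 1), 2) := fun s i =>
    .head rfl (.head rfl (.single rfl))
  revert d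
  refine forall_colDart fun k s i => ?_
  cases k
  · exact ⟨cyc s i, .head rfl (hu1 s i), .refl⟩
  · exact ⟨.single rfl, hu1 s i, .refl⟩
  · exact ⟨.head rfl (.single rfl), .head rfl (hm1 s i), .single rfl⟩
  · exact ⟨hm0 s i, hm1 s i, hm2 s i⟩

end Columns

section ColumnConnectivity

open Relation

variable {m : ℕ}

/-- The ring of the column map containing a vertex. -/
def colRing : ColVert m → Fin 3 × Bool
  | (.rim, s, _) => (0, s)
  | (.upper, s, _) => (1, s)
  | (.lower, s, _) => (1, s)
  | (.middle, _, _) => (2, false)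

/-- The successor of a vertex on its ring. -/
def ringNext : ColVert m → ColVert m
  | (.rim, s, i) => (.rim, s, i + 1)
  | (.upper, s, i) => (.lower, s, i)
  | (.lower, s, i) => (.upper, s, i + 1)
  | (.middle, false, i) => (.middle, true, -i)
  | (.middle, true, i) => (.middle, false, 1 - i)

theorem colRing_ringNext (v : ColVert m) : colRing (ringNext v) = colRing v := by
  obtain ⟨_ | _ | _ | _, _ | _, i⟩ := v <;> rfl

theorem adj_ringNext (h3 : 3 ≤ m) (v : ColVert m) : (colMap m h3).graph.Adj v (ringNext v) := by
  obtain ⟨_ | _ | _ | _, _ | _, i⟩ := v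
  · exact ⟨0, rfl⟩
  · exact ⟨0, rfl⟩
  · exact ⟨0, rfl⟩
  · exact ⟨0, rfl⟩
  · exact ⟨0, rfl⟩
  · exact ⟨0, rfl⟩
  · exact ⟨0, rfl⟩
  · exact ⟨2, rfl⟩

theorem reflTransGen_ringNext [NeZero m] {a b : ColVert m} (h : colRing a = colRing b) :
    ReflTransGen (fun u v => ringNext u = v) a b := by
  have lift : ∀ f : ZMod m → ColVert m,
      (∀ i, ReflTransGen (fun u v => ringNext u = v) (f i) (f (i + 1))) →
      ∀ i j, ReflTransGen (fun u v => ringNext u = v) (f i) (f j) := by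
    intro f hf i j
    have hn : ∀ n : ℕ, ReflTransGen (fun u v => ringNext u = v) (f i) (f (i + n)) := by
      intro n
      induction n with
      | zero => rw [Nat.cast_zero, add_zero]
      | succ n ih =>
        have := ih.trans (hf (i + n))
        rwa [add_assoc, ← Nat.cast_succ] at this
    have := hn (j - i).val
    rwa [ZMod.natCast_zmod_val, add_sub_cancel] at this
  have hr := fun s => lift (fun i => (.rim, s, i)) fun i => .single rfl
  have hu := fun s => lift (fun i => (.upper, s, i)) fun i => .head rfl (.single rfl)
  have hm := lift (fun i => (.middle, false, i)) fun i =>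
    .head rfl (.single (by simp [ringNext, add_comm]))
  have hm' : ∀ (i) (b : ColVert m), colRing b = (2, false) →
      ReflTransGen (fun u v => ringNext u = v) (.middle, false, i) b := by
    rintro i ⟨_ | _ | _ | _, s', j⟩ hb
    · simp [colRing] at hb
    · simp [colRing] at hb
    · simp [colRing] at hb
    · cases s'
      · exact hm i j
      · exact (hm i (-j)).tail (by simp [ringNext])
  have hu' : ∀ (s i) (b : ColVert m), colRing b = (1, s) →
      ReflTransGen (fun u v => ringNext u = v) (.upper, s, i) b := by
    rintro s i ⟨_ | _ | _ | _, s', j⟩ hb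
    all_goals simp [colRing] at hb
    all_goals subst hb
    · exact hu _ i j
    · exact (hu _ i j).tail rfl
  obtain ⟨_ | _ | _ | _, s, i⟩ := a
  · obtain ⟨_ | _ | _ | _, s', j⟩ := b <;> simp [colRing] at h
    subst h
    exact hr _ i j
  · exact hu' s i b h.symm
  · exact .head rfl (hu' s _ b h.symm)
  · cases s
    · exact hm' i b h.symm
    · exact .head rfl (hm' _ b h.symm)

theorem linked_of_colRing_eq [NeZero m] (h3 : 3 ≤ m) {B : Set (ColVert m)} {a a' : ColVert m}
    (hB : ∀ u ∈ B, ∀ v ∈ B, colRing u = colRing a → colRing v = colRing a → u = v)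
    (ha : a ∉ B) (ha' : a' ∉ B) (h : colRing a' = colRing a) :
    Linked (colMap m h3).graph B a a' := by
  obtain ⟨b, hb, hbB⟩ : ∃ b, colRing b = colRing a ∧ ∀ u ∈ B, colRing u = colRing a → u = b := by
    by_cases hex : ∃ b ∈ B, colRing b = colRing a
    · obtain ⟨b, hb, hba⟩ := hex
      exact ⟨b, hba, fun u hu hua => hB u hu b hb hua hba⟩
    · exact ⟨a, rfl, fun u hu hua => absurd ⟨u, hu, hua⟩ hex⟩
  have hnb : ringNext b ∉ B := fun hmem => (adj_ringNext h3 b).ne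
    (hbB _ hmem ((colRing_ringNext b).trans hb)).symm
  have key : ∀ z, z ∉ B → colRing z = colRing a →
      Linked (colMap m h3).graph B (ringNext b) z := by
    intro z hz hza
    have h1 : ∀ y, ReflTransGen (fun u v => ringNext u = v) b y →
        colRing y = colRing a ∧ (y = b ∨ Linked (colMap m h3).graph B (ringNext b) y) := by
      intro y hy
      induction hy with
      | refl => exact ⟨hb, .inl rfl⟩
      | @tail y y' _ hyy ih =>
        subst hyy
        have hr := (colRing_ringNext y).trans ih.1
        refine ⟨hr, ?_⟩
        rcases ih.2 with rfl | hl
        · exact .inr (.refl _)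
        · by_cases hyb : ringNext y = b
          · exact .inl hyb
          · exact .inr (hl.trans (.of_adj (adj_ringNext h3 y) (hl.notMem hnb)
              fun hmem => hyb (hbB _ hmem hr)))
    rcases (h1 z (reflTransGen_ringNext (hb.trans hza.symm))).2 with rfl | hl
    · exact (Linked.of_adj (adj_ringNext h3 z) hz hnb).symm
    · exact hl
  have hkey := key a' ha' h
  exact (key a ha rfl).symm.trans hkey

/-- The neighbour of a vertex of the column map in an adjacent ring. -/
def spoke : ColVert m → ColVert m
  | (.rim, s, i) => (.upper, s, i)
  | (.upper, s, i) => (.rim, s, i)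
  | (.lower, s, i) => (.middle, s, i)
  | (.middle, s, i) => (.lower, s, i)

theorem adj_spoke (h3 : 3 ≤ m) (v : ColVert m) : (colMap m h3).graph.Adj v (spoke v) := by
  obtain ⟨_ | _ | _ | _, s, i⟩ := v
  · exact ⟨2, rfl⟩
  · exact ⟨1, rfl⟩
  · exact ⟨2, rfl⟩
  · exact ⟨1, rfl⟩

theorem colRing_spoke_ne (v : ColVert m) : colRing (spoke v) ≠ colRing v := by
  obtain ⟨_ | _ | _ | _, s, i⟩ := v <;> simp [spoke, colRing]

theorem colMap_linked (h5 : 5 ≤ m) (h3 : 3 ≤ m) {B : Set (ColVert m)} (hB : B.ncard < 3)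
    {a b : ColVert m} (ha : a ∉ B) (hb : b ∉ B) : Linked (colMap m h3).graph B a b := by
  have : NeZero m := ⟨by omega⟩
  obtain ⟨c, hc⟩ : ∃ c : ZMod m, ∀ v ∈ B, v.2.2 ≠ c ∧ v.2.2 ≠ -c := by
    by_contra! hcon
    have hsub : (Set.univ : Set (ZMod m)) ⊆
        (fun v : ColVert m => v.2.2) '' B ∪ (fun v : ColVert m => -v.2.2) '' B := by
      intro c _
      obtain ⟨v, hv, hvc⟩ := hcon c
      by_cases h : v.2.2 = c
      · exact .inl ⟨v, hv, h⟩
      · exact .inr ⟨v, hv, by simp [hvc h]⟩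
    have h1 := Set.ncard_le_ncard hsub (Set.toFinite _)
    have h2 := Set.ncard_union_le ((fun v : ColVert m => v.2.2) '' B)
      ((fun v : ColVert m => -v.2.2) '' B)
    have h4 := Set.ncard_image_le (f := fun v : ColVert m => v.2.2) B.toFinite
    have h6 := Set.ncard_image_le (f := fun v : ColVert m => -v.2.2) B.toFinite
    rw [Set.ncard_univ, Nat.card_zmod] at h1
    omega
  have h1 : ∀ k s, (k, s, c) ∉ B := fun k s h => (hc _ h).1 rfl
  have h2 : ∀ k s, (k, s, -c) ∉ B := fun k s h => (hc _ h).2 rfl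
  have hside : ∀ s i, (∀ k, (k, s, i) ∉ B) → ∀ k,
      Linked (colMap m h3).graph B (.middle, s, i) (k, s, i) := by
    intro s i hi
    have e1 := Linked.of_adj (adj_spoke h3 (.middle, s, i)) (hi _) (hi _)
    have e2 := Linked.of_adj (adj_ringNext h3 (.upper, s, i)) (hi _) (hi _)
    have e4 := Linked.of_adj (adj_spoke h3 (.upper, s, i)) (hi _) (hi _)
    rintro (_ | _ | _ | _)
    · exact e1.trans (e2.symm.trans e4)
    · exact e1.trans e2.symm
    · exact e1
    · exact .refl _
  have hcol : ∀ k s, ∃ j, (k, s, j) ∉ B ∧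
      Linked (colMap m h3).graph B (.middle, false, c) (k, s, j) := by
    rintro k (_ | _)
    · exact ⟨c, h1 _ _, hside false c (fun k => h1 k _) k⟩
    · exact ⟨-c, h2 _ _, (Linked.of_adj (adj_ringNext h3 (.middle, false, c)) (h1 _ _)
        (h2 _ _)).trans (hside true (-c) (fun k => h2 k _) k)⟩
  have hclean : ∀ z : ColVert m, z ∉ B →
      (∀ u ∈ B, ∀ v ∈ B, colRing u = colRing z → colRing v = colRing z → u = v) →
      Linked (colMap m h3).graph B (.middle, false, c) z := by
    rintro ⟨k, s, i⟩ hz hu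
    obtain ⟨j, hj, hl⟩ := hcol k s
    exact hl.trans (linked_of_colRing_eq h3 hu hz hj (by cases k <;> rfl)).symm
  have hall : ∀ z, z ∉ B → Linked (colMap m h3).graph B (.middle, false, c) z := by
    intro z hz
    by_cases hu : ∀ u ∈ B, ∀ v ∈ B, colRing u = colRing z → colRing v = colRing z → u = v
    · exact hclean z hz hu
    · push Not at hu
      obtain ⟨u, hu, v, hv, huz, hvz, huv⟩ := hu
      have hBeq : {u, v} = B := Set.eq_of_subset_of_ncard_le
        (by rintro y (rfl | rfl) <;> assumption) (by rw [Set.ncard_pair huv]; omega) B.toFinite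
      have hring : ∀ y ∈ B, colRing y = colRing z := by
        rw [← hBeq]
        rintro y (rfl | rfl) <;> assumption
      have hs : spoke z ∉ B := fun h => colRing_spoke_ne z (hring _ h)
      refine (hclean _ hs fun y hy _ _ hy' _ => ?_).trans
        (Linked.of_adj (adj_spoke h3 z) hz hs).symm
      exact absurd (hy'.symm.trans (hring y hy)) (colRing_spoke_ne z)
  exact (hall a ha).symm.trans (hall b hb)

end ColumnConnectivity

section ColumnWeights

variable {m : ℕ}

theorem forall_of_succ [NeZero m] {p : ZMod m → Prop} (h : ∀ i, p i → p (i + 1)) {i : ZMod m}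
    (hi : p i) (j : ZMod m) : p j := by
  have hn : ∀ n : ℕ, p (i + n) := by
    intro n
    induction n with
    | zero => rwa [Nat.cast_zero, add_zero]
    | succ n ih => rw [Nat.cast_succ, ← add_assoc]; exact h _ ih
  have := hn (j - i).val
  rwa [ZMod.natCast_zmod_val, add_sub_cancel] at this

theorem exists_fall_and_rise [NeZero m] {a : ZMod m → Bool} {i j : ZMod m} (hi : a i = true)
    (hj : a j = false) :
    (∃ i, a i = true ∧ a (i + 1) = false) ∧ ∃ j, a j = false ∧ a (j + 1) = true := by
  constructor
  · by_contra! h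
    have := forall_of_succ (p := fun i => a i = true) (fun i hi => by simpa using h i hi) hi j
    simp [hj] at this
  · by_contra! h
    have := forall_of_succ (p := fun i => a i = false) (fun i hi => by simpa using h i hi) hj i
    simp [hi] at this

theorem add_le_sum_of_ne [NeZero m] (A : ZMod m → ℕ) {i j : ZMod m} (h : i ≠ j) :
    A i + A j ≤ ∑ i, A i := by
  rw [← Finset.sum_pair h]
  exact Finset.sum_le_sum_of_subset (Finset.subset_univ _)

theorem add_add_le_sum_of_ne [NeZero m] (A : ZMod m → ℕ) {i j k : ZMod m} (hij : i ≠ j)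
    (hik : i ≠ k) (hjk : j ≠ k) : A i + A j + A k ≤ ∑ i, A i := by
  have h : ∑ l ∈ {i, j, k}, A l = A i + A j + A k := by
    rw [Finset.sum_insert (by simp [hij, hik]), Finset.sum_pair hjk, add_assoc]
  rw [← h]
  exact Finset.sum_le_sum_of_subset (Finset.subset_univ _)

theorem mul_le_sum [NeZero m] (A : ZMod m → ℕ) {c : ℕ} (h : ∀ i, c ≤ A i) : m * c ≤ ∑ i, A i := by
  have := Finset.card_nsmul_le_sum Finset.univ A c fun i _ => h i
  rwa [Finset.card_univ, ZMod.card, smul_eq_mul] at this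

theorem side_weight_ge [NeZero m] (q : ℕ) (hm : 4 * q + 11 ≤ 2 * m)
    (a b e f g : ZMod m → Bool) (n : ZMod m → ℕ)
    (ha : ∀ i, a i = true → a (i + 1) = false → b (i + 1) = true)
    (ha' : ∀ i, a i = false → a (i + 1) = true → b (i + 1) = true)
    (hb : ∀ i, b (i + 1) = true → a i = true ∨ a (i + 1) = true)
    (hbe : ∀ i, b i = true → e i = true ∨ f i = true)
    (hef : ∀ i, b i = false → e i = f i)
    (hg : ∀ i, e i ≠ f (i + 1) → g i = true)
    (hg' : ∀ i, g i = true → e i = true ∨ f (i + 1) = true)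
    (hn : ∀ i, g i = true → 1 ≤ n i)
    (hne : ∃ i, a i = true ∨ b i = true ∨ e i = true ∨ f i = true ∨ g i = true) :
    4 * q + 11 ≤ ∑ i, (2 * (a i).toNat + (q + 3) * (b i).toNat + (q + 2) * (e i).toNat +
      (q + 1) * (f i).toNat + 2 * (g i).toNat + (q + 2) * n i) := by
  set A : ZMod m → ℕ := fun i => 2 * (a i).toNat + (q + 3) * (b i).toNat +
    (q + 2) * (e i).toNat + (q + 1) * (f i).toNat + 2 * (g i).toNat + (q + 2) * n i with hA
  have hAi : ∀ i, A i = 2 * (a i).toNat + (q + 3) * (b i).toNat + (q + 2) * (e i).toNat +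
      (q + 1) * (f i).toNat + 2 * (g i).toNat + (q + 2) * n i := fun i => rfl
  change 4 * q + 11 ≤ ∑ i, A i
  have hm4 : 4 ≤ m := by omega
  have h1 : (1 : ZMod m) ≠ 0 := by
    have : Fact (1 < m) := ⟨by omega⟩
    exact one_ne_zero
  have h2 : (2 : ZMod m) ≠ 0 := by
    intro h
    have := Nat.le_of_dvd (by omega) ((ZMod.natCast_eq_zero_iff 2 m).1 (by exact_mod_cast h))
    omega
  have hsub : ∀ i : ZMod m, i - 1 + 1 = i := fun i => sub_add_cancel i 1
  by_cases hex : ∃ i, a i = true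
  · obtain ⟨i₀, hi₀⟩ := hex
    by_cases hall : ∀ i, a i = true
    · have := mul_le_sum A (c := 2) fun i => by
        rw [hAi, hall i, Bool.toNat_true]
        omega
      omega
    · push Not at hall
      obtain ⟨j₀, hj₀⟩ := hall
      obtain ⟨⟨i, hi, hi'⟩, j, hj, hj'⟩ := exists_fall_and_rise hi₀ (by simpa using hj₀)
      have hbi := ha i hi hi'
      have hbj := ha' j hj hj'
      have hAi1 : 2 * q + 4 ≤ A (i + 1) := by
        rw [hAi, hbi]
        rcases hbe _ hbi with h | h <;> rw [h, Bool.toNat_true] <;> omega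
      have hAj1 : 2 * q + 6 ≤ A (j + 1) := by
        rw [hAi, hbj, hj']
        rcases hbe _ hbj with h | h <;> rw [h, Bool.toNat_true] <;> omega
      have hij : i + 1 ≠ j + 1 := by
        intro h
        rw [h, hj'] at hi'
        simp at hi'
      by_cases hadj : i = j + 1
      · subst hadj
        by_cases hej : e (j + 1) = true
        · have hAj2 : 2 * q + 7 ≤ A (j + 1) := by
            rw [hAi, hbj, hj', hej, Bool.toNat_true]
            omega
          have := add_le_sum_of_ne A hij
          omega
        · have hfj : f (j + 1) = true := (hbe _ hbj).resolve_left hej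
          have hAj : 2 ≤ A j := by
            rw [hAi]
            by_cases he : e j = true
            · rw [he, Bool.toNat_true]
              omega
            · rw [hg j (by rw [hfj]; exact he), Bool.toNat_true]
              omega
          have := add_add_le_sum_of_ne A hij (k := j)
            (fun h => h2 (by linear_combination h)) (fun h => h1 (by linear_combination h))
          omega
      · have hAi0 : 2 ≤ A i := by
          rw [hAi, hi, Bool.toNat_true]
          omega
        have := add_add_le_sum_of_ne A hij (k := i)
          (fun h => h1 (by linear_combination h)) (fun h => hadj h.symm)
        omega
  · have hna : ∀ i, a i = false := fun i => by simpa using fun h => hex ⟨i, h⟩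
    have hnb : ∀ i, b i = false := fun i => by
      by_contra h
      have := hb (i - 1) (by rw [hsub]; simpa using h)
      simp [hna] at this
    have hfe : ∀ i, f i = e i := fun i => (hef i (hnb i)).symm
    obtain ⟨i₀, hi₀⟩ : ∃ i, e i = true := by
      obtain ⟨i, h | h | h | h | h⟩ := hne
      · simp [hna] at h
      · simp [hnb] at h
      · exact ⟨i, h⟩
      · exact ⟨i, hfe i ▸ h⟩
      · rcases hg' i h with h | h
        · exact ⟨i, h⟩
        · exact ⟨i + 1, hfe _ ▸ h⟩
    by_cases hall : ∀ i, e i = true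
    · have := mul_le_sum A (c := 2) fun i => by
        rw [hAi, hall i, Bool.toNat_true]
        omega
      omega
    · push Not at hall
      obtain ⟨j₀, hj₀⟩ := hall
      obtain ⟨⟨i, hi, hi'⟩, j, hj, hj'⟩ := exists_fall_and_rise hi₀ (by simpa using hj₀)
      have hgi := hg i (by rw [hfe, hi, hi']; simp)
      have hgj := hg j (by rw [hfe, hj, hj']; simp)
      have hni := Nat.mul_le_mul_left (q + 2) (hn i hgi)
      have hnj := Nat.mul_le_mul_left (q + 2) (hn j hgj)
      have hAi1 : 3 * q + 7 ≤ A i := by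
        rw [hAi, hgi, hfe, hi, Bool.toNat_true]
        omega
      have hAj1 : q + 4 ≤ A j := by
        rw [hAi, hgj, Bool.toNat_true]
        omega
      have := add_le_sum_of_ne A (i := i) (j := j) (by rintro rfl; simp [hi] at hj)
      omega

/-- The ladder lengths used to inflate the column map; they sum to `r + 1` at each vertex. -/
def colWeight (r : ℕ) : ColVert m × Fin 3 → ℕ
  | ((.rim, _, _), 0) => 0
  | ((.rim, _, _), 1) => 0
  | ((.rim, _, _), 2) => r + 1
  | ((.upper, _, _), 0) => 0
  | ((.upper, _, _), 1) => 1
  | ((.upper, _, _), 2) => r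
  | ((.lower, _, _), 0) => 0
  | ((.lower, _, _), 1) => r + 1
  | ((.lower, _, _), 2) => 0
  | ((.middle, false, _), 0) => 0
  | ((.middle, true, _), 0) => r + 1
  | ((.middle, _, _), 1) => 0
  | ((.middle, false, _), 2) => r + 1
  | ((.middle, true, _), 2) => 0

theorem sum_colWeight (r : ℕ) (w : ColVert m) : ∑ i, colWeight r (w, i) = r + 1 := by
  obtain ⟨_ | _ | _ | _, _ | _, i⟩ := w <;> simp [Fin.sum_univ_three, colWeight, add_comm]

theorem sum_kind (f : Kind → ℕ) : ∑ k, f k = f .rim + f .upper + f .lower + f .middle := by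
  rw [show (Finset.univ : Finset Kind) = {.rim, .upper, .lower, .middle} from rfl]
  simp [add_assoc]

/-- The sum of a function over the darts of a given kind, slot and side. -/
def colCount [NeZero m] (c : ColVert m × Fin 3 → ℕ) (k : Kind) (j : Fin 3) (s : Bool) : ℕ :=
  ∑ i, c ((k, s, i), j)

theorem sum_mul_colWeight [NeZero m] (r : ℕ) (c : ColVert m × Fin 3 → ℕ) :
    ∑ d, c d * (colWeight r d + 1) = ∑ s, (colCount c .rim 0 s + colCount c .rim 1 s +
      (r + 2) * colCount c .rim 2 s + colCount c .upper 0 s + 2 * colCount c .upper 1 s +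
      (r + 1) * colCount c .upper 2 s + colCount c .lower 0 s + (r + 2) * colCount c .lower 1 s +
      colCount c .lower 2 s + colCount c .middle 1 s) +
      (colCount c .middle 0 false + (r + 2) * colCount c .middle 0 true +
      (r + 2) * colCount c .middle 2 false + colCount c .middle 2 true) := by
  simp only [Fintype.sum_prod_type, sum_kind, Fintype.sum_bool, Fin.sum_univ_three, colWeight,
    Finset.sum_add_distrib, ← Finset.sum_mul, colCount]
  ring

set_option maxHeartbeats 1000000 in
theorem colWeight_sum_ge [NeZero m] (r : ℕ) (hm : 4 * r + 15 ≤ 2 * m)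
    (S : Finset (ColVert m × Fin 3)) (hne : S.Nonempty) (hopp : ∀ d ∈ S, colOpp d ∈ S)
    (hrot : ∀ d ∈ S, rotl d ∈ S ∨ rotr d ∈ S) :
    4 * r + 15 ≤ ∑ d ∈ S, (colWeight r d + 1) := by
  classical
  let c : ColVert m × Fin 3 → Bool := fun d => decide (d ∈ S)
  have hc : ∀ d, c (colOpp d) = c d := by
    have hinv : ∀ d : ColVert m × Fin 3, colOpp (colOpp d) = d :=
      (colMap m (by omega)).opp_opp
    intro d
    refine Bool.eq_iff_iff.2 ?_
    simp only [c, decide_eq_true_eq]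
    exact ⟨fun h => hinv d ▸ hopp _ h, hopp d⟩
  have hcrot : ∀ v, (c (v, 0) = true → c (v, 1) = true ∨ c (v, 2) = true) ∧
      (c (v, 1) = true → c (v, 2) = true ∨ c (v, 0) = true) ∧
      (c (v, 2) = true → c (v, 0) = true ∨ c (v, 1) = true) := by
    intro v
    simp only [c, decide_eq_true_eq]
    exact ⟨hrot (v, 0), hrot (v, 1), hrot (v, 2)⟩
  have hr1 : ∀ s i, c ((.rim, s, i + 1), 1) = c ((.rim, s, i), 0) := fun s i =>
    hc ((.rim, s, i), 0)
  have hu1 : ∀ s i, c ((.upper, s, i), 1) = c ((.rim, s, i), 2) := fun s i => hc ((.rim, s, i), 2)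
  have hl1 : ∀ s i, c ((.lower, s, i), 1) = c ((.upper, s, i), 0) := fun s i =>
    hc ((.upper, s, i), 0)
  have hl0 : ∀ s i, c ((.lower, s, i), 0) = c ((.upper, s, i + 1), 2) := fun s i =>
    (hc ((.lower, s, i), 0)).symm
  have hm1 : ∀ s i, c ((.middle, s, i), 1) = c ((.lower, s, i), 2) := fun s i =>
    hc ((.lower, s, i), 2)
  have hm0 : ∀ s i, c ((.middle, !s, -i), 0) = c ((.middle, s, i), 0) := fun s i =>
    hc ((.middle, s, i), 0)
  have hm2 : ∀ s i, c ((.middle, !s, 1 - i), 2) = c ((.middle, s, i), 2) := fun s i =>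
    hc ((.middle, s, i), 2)
  let N : Kind → Fin 3 → Bool → ℕ := colCount fun d => (c d).toNat
  have nr1 : ∀ s, N .rim 1 s = N .rim 0 s := fun s => by
    simp only [N, colCount]
    rw [← Equiv.sum_comp (Equiv.addRight (1 : ZMod m))]
    simp only [Equiv.coe_addRight, hr1]
  have nu1 : ∀ s, N .upper 1 s = N .rim 2 s := fun s => by simp only [N, colCount, hu1]
  have nl1 : ∀ s, N .lower 1 s = N .upper 0 s := fun s => by simp only [N, colCount, hl1]
  have nl0 : ∀ s, N .lower 0 s = N .upper 2 s := fun s => by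
    simp only [N, colCount, hl0]
    exact Equiv.sum_comp (Equiv.addRight (1 : ZMod m)) fun i => (c ((.upper, s, i), 2)).toNat
  have nm1 : ∀ s, N .middle 1 s = N .lower 2 s := fun s => by simp only [N, colCount, hm1]
  have nm0 : N .middle 0 true = N .middle 0 false := by
    simp only [N, colCount]
    rw [← Equiv.sum_comp (Equiv.neg (ZMod m))]
    simp only [Equiv.neg_apply]
    exact Finset.sum_congr rfl fun i _ => by rw [← hm0 false i]; rfl
  have nm2 : N .middle 2 true = N .middle 2 false := by
    simp only [N, colCount]
    rw [← Equiv.sum_comp (Equiv.subLeft (1 : ZMod m))]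
    simp only [Equiv.subLeft_apply]
    exact Finset.sum_congr rfl fun i _ => by rw [← hm2 false i]; rfl
  let T : Bool → ℕ := fun s => 2 * N .rim 0 s + (r + 4) * N .rim 2 s + (r + 3) * N .upper 0 s +
    (r + 2) * N .upper 2 s + 2 * N .lower 2 s
  have htotal : ∑ d ∈ S, (colWeight r d + 1) =
      T false + T true + (r + 3) * (N .middle 0 false + N .middle 2 false) := by
    have h1 : ∑ d ∈ S, (colWeight r d + 1) = ∑ d, (c d).toNat * (colWeight r d + 1) := by
      rw [← Finset.sum_subset (Finset.subset_univ S)]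
      · exact Finset.sum_congr rfl fun d hd => by simp [c, hd]
      · exact fun d _ hd => by simp [c, hd]
    rw [h1, sum_mul_colWeight, Fintype.sum_bool]
    simp only [show colCount (fun d => (c d).toNat) = N from rfl, nr1, nu1, nl1, nl0, nm1, nm0,
      nm2, T]
    ring
  have hside : ∀ s, (∃ i, c ((.rim, s, i), 0) = true ∨ c ((.rim, s, i), 2) = true ∨
      c ((.upper, s, i), 0) = true ∨ c ((.upper, s, i), 2) = true ∨
      c ((.lower, s, i), 2) = true) →
      4 * r + 15 ≤ T s + (r + 3) * (N .middle 0 s + N .middle 2 s) := by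
    intro s hs
    have := side_weight_ge (r + 1) (by omega) (fun i => c ((.rim, s, i), 0))
      (fun i => c ((.rim, s, i), 2)) (fun i => c ((.upper, s, i), 0))
      (fun i => c ((.upper, s, i), 2)) (fun i => c ((.lower, s, i), 2))
      (fun i => (c ((.middle, s, i), 0)).toNat + (c ((.middle, s, i), 2)).toNat)
      ?_ ?_ ?_ ?_ ?_ ?_ ?_ ?_ hs
    · simp only [Finset.sum_add_distrib, ← Finset.mul_sum] at this
      simp only [T, N, colCount]
      linarith
    all_goals intro i
    · have := hcrot (.rim, s, i + 1)
      rw [hr1] at this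
      grind
    · have := hcrot (.rim, s, i + 1)
      rw [hr1] at this
      grind
    · have := hcrot (.rim, s, i + 1)
      rw [hr1] at this
      grind
    · have := hcrot (.upper, s, i)
      rw [hu1] at this
      grind
    · have := hcrot (.upper, s, i)
      rw [hu1] at this
      grind
    · have := hcrot (.lower, s, i)
      rw [hl1, hl0] at this
      grind
    · have := hcrot (.lower, s, i)
      rw [hl1, hl0] at this
      grind
    · have := hcrot (.middle, s, i)
      rw [hm1] at this
      intro h
      rcases this.2.1 h with h | h <;> simp [h]
  have hmid : N .middle 0 true + N .middle 2 true = N .middle 0 false + N .middle 2 false := by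
    rw [nm0, nm2]
  rw [htotal]
  by_cases hex : ∃ s i, c ((.rim, s, i), 0) = true ∨ c ((.rim, s, i), 2) = true ∨
      c ((.upper, s, i), 0) = true ∨ c ((.upper, s, i), 2) = true ∨ c ((.lower, s, i), 2) = true
  · obtain ⟨s, hs⟩ := hex
    have := hside s hs
    cases s
    · omega
    · rw [hmid] at this
      omega
  · push Not at hex
    have hg : ∀ s i, c ((.lower, s, i), 2) = false := fun s i => by simpa using (hex s i).2.2.2.2
    have hh : ∀ s i, c ((.middle, s, i), 0) = c ((.middle, s, i), 2) := fun s i => by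
      have := hcrot (.middle, s, i)
      rw [hm1, hg] at this
      grind
    have hstep : ∀ i, c ((.middle, false, i), 0) = true → c ((.middle, false, i + 1), 0) = true := by
      intro i hi
      have e1 : c ((.middle, true, -i), 0) = c ((.middle, false, i), 0) := hm0 false i
      have e2 : c ((.middle, false, 1 - -i), 2) = c ((.middle, true, -i), 2) := hm2 true (-i)
      rw [sub_neg_eq_add, add_comm] at e2
      rw [hh, e2, ← hh, e1, hi]
    obtain ⟨i₀, hi₀⟩ : ∃ i, c ((.middle, false, i), 0) = true := by
      obtain ⟨d, hd⟩ := hne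
      replace hd : c d = true := by simpa [c] using hd
      obtain ⟨s, i, hsi⟩ : ∃ s i, c ((.middle, s, i), 0) = true := by
        revert hd d
        refine forall_colDart fun k s i => ?_
        have e1 := hex s i
        have e2 := hex s (i - 1)
        have e3 := hex s (i + 1)
        have e4 := hr1 s (i - 1)
        rw [sub_add_cancel] at e4
        cases k
        · rw [e4]
          grind
        · rw [hu1]
          grind
        · rw [hl0, hl1]
          grind
        · rw [hm1, ← hh, hg]
          exact ⟨fun h => ⟨s, i, h⟩, by simp, fun h => ⟨s, i, h⟩⟩
      cases s
      · exact ⟨i, hsi⟩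
      · exact ⟨-i, (hm0 true i).trans hsi⟩
    have hfull := forall_of_succ hstep hi₀
    have hN0 : N .middle 0 false = m := by
      simp only [N, colCount, hfull, Bool.toNat_true, Finset.sum_const, Finset.card_univ, ZMod.card,
        smul_eq_mul, mul_one]
    rw [hN0]
    nlinarith

end ColumnWeights

section ColumnGraph

theorem IsThreeConnected.connected {V : Type*} {G : SimpleGraph V} (h : IsThreeConnected G) :
    G.Connected := by
  have h' := h.2 ∅ Set.finite_empty (by simp)
  obtain ⟨v⟩ := h'.nonempty
  have : Nonempty V := ⟨v⟩
  refine .mk fun a b => ?_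
  obtain ⟨p⟩ := h'.preconnected ⟨a, id⟩ ⟨b, id⟩
  exact ⟨(exists_walk_of_induce_compl p).choose⟩

theorem exists_cycle_gap_graph (r : ℕ) : ∃ (V : Type) (_ : Finite V) (G : SimpleGraph V),
    IsThreeConnected G ∧ IsCubic G ∧ IsPlanar G ∧ CircumferenceAtLeast G (4 * r + 15) ∧
      ∀ ℓ ∈ CycleLengths G, ℓ ≤ 2 * r + 5 ∨ 4 * r + 15 ≤ ℓ := by
  let m := 2 * r + 8
  have hm3 : 3 ≤ m := by omega
  have hm5 : 5 ≤ m := by omega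
  have hm : 4 * r + 15 ≤ 2 * m := by omega
  have : NeZero m := ⟨by omega⟩
  have hkind : Nat.card Kind = 4 := by rw [Nat.card_eq_fintype_card]; rfl
  have hcard : Nat.card (ColVert m) = 8 * m := by
    rw [Nat.card_prod, Nat.card_prod, hkind, Nat.card_zmod, Nat.card_eq_fintype_card,
      Fintype.card_bool]
    ring
  have h3 : IsThreeConnected (inflation (colMap m hm3) (colWeight r)) :=
    inflation_isThreeConnected _ (by omega) fun B hB a b ha hb => colMap_linked hm5 hm3 hB ha hb
  have hlong : ∀ {u} {w : (inflation (colMap m hm3) (colWeight r)).Walk u u}, w.IsCycle →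
      (crossed (colMap m hm3) w).Nonempty → 4 * r + 15 ≤ w.length := fun hw hne =>
    le_length_of_crossed hw hne (colWeight_sum_ge r hm)
  refine ⟨_, inferInstance, inflation (colMap m hm3) (colWeight r), h3, inflation_isCubic _ _,
    ?_, ?_, ?_⟩
  · refine inflation_isPlanar _ _ colFace colFaceDart colFace_opp_rotl colFace_colFaceDart
      colFace_reach ?_ h3.connected
    rw [hcard, Nat.card_sum, Nat.card_sum, Nat.card_prod, Nat.card_zmod, Nat.card_eq_fintype_card,
      Fintype.card_bool]
    ring
  · obtain ⟨u, w, hw, hne⟩ := exists_crossed_cycle h3 ((.rim, true, 0), 0)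
    exact ⟨w.length, ⟨u, w, hw, rfl⟩, hlong hw hne⟩
  · rintro _ ⟨u, w, hw, rfl⟩
    rcases (crossed (colMap m hm3) w).eq_empty_or_nonempty with he | hne
    · refine .inl ((length_le_of_crossed_eq_empty hw he).trans_eq ?_)
      rw [Finset.sum_add_distrib, ← Finset.mul_sum, sum_colWeight]
      simp
      ring
    · exact .inr (hlong hw hne)

end ColumnGraph

/-- For every even `k ≥ 6` there is a 3-connected cubic planar graph of
circumference at least `k` with no cycle of length in `[k, 2k+2]`; in
particular, Merker's conjecture is false for every even `k ≥ 6`. -/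
theorem statement1 (k : ℕ) (hk : Even k) (hk6 : 6 ≤ k) :
    (∃ (m : ℕ) (G : SimpleGraph (Fin m)),
      IsThreeConnected G ∧ IsCubic G ∧ IsPlanar G ∧ CircumferenceAtLeast G k ∧
      ∀ ℓ ∈ CycleLengths G, ¬(k ≤ ℓ ∧ ℓ ≤ 2 * k + 2)) ∧
    ¬(∀ (m : ℕ) (G : SimpleGraph (Fin m)),
        IsThreeConnected G → IsCubic G → IsPlanar G → CircumferenceAtLeast G k →
        ∃ ℓ ∈ CycleLengths G, k ≤ ℓ ∧ ℓ ≤ 2 * k + 2) := by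
  have main : ∃ (m : ℕ) (G : SimpleGraph (Fin m)),
      IsThreeConnected G ∧ IsCubic G ∧ IsPlanar G ∧ CircumferenceAtLeast G k ∧
      ∀ ℓ ∈ CycleLengths G, ¬(k ≤ ℓ ∧ ℓ ≤ 2 * k + 2) := by
    obtain ⟨r, rfl⟩ : ∃ r, k = 2 * r + 6 := by
      obtain ⟨t, rfl⟩ := hk
      exact ⟨t - 3, by omega⟩
    obtain ⟨V, hV, G, h3, hcub, hpl, ⟨n, hn, hnk⟩, hgap⟩ := exists_cycle_gap_graph r
    let φ := Iso.map (Finite.equivFin V) G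
    refine ⟨Nat.card V, G.map (Finite.equivFin V), h3.of_iso φ, hcub.of_iso φ,
      hpl.of_iso φ, ⟨n, cycleLengths_eq_of_iso φ ▸ hn, by omega⟩, fun ℓ hℓ => ?_⟩
    rw [← cycleLengths_eq_of_iso φ] at hℓ
    have := hgap ℓ hℓ
    omega
  refine ⟨main, fun h => ?_⟩
  obtain ⟨m, G, h3, hcub, hpl, hcirc, hgap⟩ := main
  obtain ⟨ℓ, hℓ, hle⟩ := h m G h3 hcub hpl hcirc
  exact hgap ℓ hℓ hle
end
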